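/- arXiv:2211.02705 — 3 statements merged into one kernel-verified Lean document; each statement's English description precedes it below -/
import Mathlib

section
/- There is a universal constant C such that for every real array A = (a_{ijk})_{i,j≤n,k≤m}, every p, ε > 0, every U ⊆ B₂ⁿ + √p·B₁ⁿ, and every finite nonempty S ⊆ ℝᵐ: N(U × S, d_A, ε²·E β_{A,S}(Eₙ) + ε·sup_{x∈U} β_{A,S}(x) + ε·sup_{t∈S} E α_A(Eₙ ⊗ t)) ≤ 4 exp(C ε^{−2} + C √p ε^{−1}). -/
open MeasureTheory ProbabilityTheory Set
open scoped ENNReal BigOperators Pointwise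

noncomputable section

namespace Stmt6

/-- the symmetric exponential distribution on `ℝ`, with density `e^{-|x|}/2`. -/
def symExp : Measure ℝ :=
  MeasureTheory.volume.withDensity fun x => ENNReal.ofReal (Real.exp (-|x|) / 2)

/-- the law of `Eₙ`, a vector of `n` i.i.d. symmetric exponential variables. -/
def expVec (n : ℕ) : Measure (Fin n → ℝ) := Measure.pi fun _ => symExp

/-- the law of a standard Gaussian vector in `ℝⁿ`. -/
def gaussVec (n : ℕ) : Measure (Fin n → ℝ) := Measure.pi fun _ => gaussianReal 0 1

/-- the law of an `n × n` array of i.i.d. standard Gaussian variables. -/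
def gaussMat (n : ℕ) : Measure (Fin n × Fin n → ℝ) := Measure.pi fun _ => gaussianReal 0 1

variable {n m : ℕ}

/-- `α_A(y) = √(∑ᵢ (∑_{jk} a_{ijk} y_{jk})²)` for `y ∈ ℝ^{n×m}`. -/
def alphaA (A : Fin n → Fin n → Fin m → ℝ) (y : Fin n → Fin m → ℝ) : ℝ :=
  Real.sqrt (∑ i, (∑ j, ∑ k, A i j k * y j k) ^ 2)

/-- `α_{∞,A}(y) = maxᵢ |∑_{jk} a_{ijk} y_{jk}|`. -/
def alphaInf (A : Fin n → Fin n → Fin m → ℝ) (y : Fin n → Fin m → ℝ) : ℝ :=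
  ⨆ i, |∑ j, ∑ k, A i j k * y j k|

/-- `x ⊗ t = (x_j t_k)_{jk}`. -/
def tens (x : Fin n → ℝ) (t : Fin m → ℝ) : Fin n → Fin m → ℝ := fun j k => x j * t k

/-- the distance `d_A((x,t),(x',t')) = α_A(x⊗t − x'⊗t')`. -/
def dA (A : Fin n → Fin n → Fin m → ℝ) (z w : (Fin n → ℝ) × (Fin m → ℝ)) : ℝ :=
  alphaA A (tens z.1 z.2 - tens w.1 w.2)

/-- the distance `d_{∞,A}((x,t),(x',t')) = α_{∞,A}(x⊗t − x'⊗t')`. -/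
def dInf (A : Fin n → Fin n → Fin m → ℝ) (z w : (Fin n → ℝ) × (Fin m → ℝ)) : ℝ :=
  alphaInf A (tens z.1 z.2 - tens w.1 w.2)

/-- the diameter of `V` in the metric `d_A`. -/
def diamA (A : Fin n → Fin n → Fin m → ℝ) (V : Set ((Fin n → ℝ) × (Fin m → ℝ))) : ℝ :=
  ⨆ z ∈ V, ⨆ w ∈ V, dA A z w

/-- the diameter of `V` in the metric `d_{∞,A}`. -/
def diamInf (A : Fin n → Fin n → Fin m → ℝ) (V : Set ((Fin n → ℝ) × (Fin m → ℝ))) : ℝ :=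
  ⨆ z ∈ V, ⨆ w ∈ V, dInf A z w

/-- `F_A(V) = E sup_{(x,t)∈V} ∑_{ijk} a_{ijk} gᵢ x_j t_k`. -/
def FA (A : Fin n → Fin n → Fin m → ℝ) (V : Set ((Fin n → ℝ) × (Fin m → ℝ))) : ℝ :=
  ∫ g, (⨆ z ∈ V, ∑ i, ∑ j, ∑ k, A i j k * g i * z.1 j * z.2 k) ∂gaussVec n

/-- `β_{A,T}(x) = E sup_{s∈T} |∑_{ijk} a_{ijk} gᵢ x_j s_k|`. -/
def betaA (A : Fin n → Fin n → Fin m → ℝ) (T : Set (Fin m → ℝ)) (x : Fin n → ℝ) : ℝ :=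
  ∫ g, (⨆ s ∈ T, |∑ i, ∑ j, ∑ k, A i j k * g i * x j * s k|) ∂gaussVec n

/-- `s_A(T) = E sup_{t∈T} |∑_{ijk} a_{ijk} g_{ij} t_k| + E sup_{t∈T} |∑_{ijk} a_{ijk} gᵢ ℰⱼ t_k|`. -/
def sA (A : Fin n → Fin n → Fin m → ℝ) (T : Set (Fin m → ℝ)) : ℝ :=
  (∫ G, (⨆ t ∈ T, |∑ i, ∑ j, ∑ k, A i j k * G (i, j) * t k|) ∂gaussMat n) +
  (∫ w, (⨆ t ∈ T, |∑ i, ∑ j, ∑ k, A i j k * w.1 i * w.2 j * t k|)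
      ∂((gaussVec n).prod (expVec n)))

/-- `E α_A(Eₙ ⊗ t)`. -/
def expAlpha (A : Fin n → Fin n → Fin m → ℝ) (t : Fin m → ℝ) : ℝ :=
  ∫ e, alphaA A (tens e t) ∂expVec n

/-- the closed Euclidean unit ball `B₂ⁿ`. -/
def B2 (n : ℕ) : Set (Fin n → ℝ) := {x | Real.sqrt (∑ i, x i ^ 2) ≤ 1}

/-- the closed `ℓ₁` unit ball `B₁ⁿ`. -/
def B1 (n : ℕ) : Set (Fin n → ℝ) := {x | ∑ i, |x i| ≤ 1}

/-- the Minkowski sum `B₂ⁿ + √p·B₁ⁿ`. -/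
def UB (n : ℕ) (p : ℝ) : Set (Fin n → ℝ) := B2 n + Real.sqrt p • B1 n

/-- `s_q(A) = (∑_k (∑_{ij} a_{ijk}²)^{q/2})^{1/q}`. -/
def sq (q : ℝ) (A : Fin n → Fin n → Fin m → ℝ) : ℝ :=
  (∑ k, (∑ i, ∑ j, A i j k ^ 2) ^ (q / 2)) ^ (1 / q)

/-- `φ_A(x) = (∑_k (∑ᵢ (∑ⱼ a_{ijk} x_j)⁴ / ∑ⱼ a_{ijk}²)^{q/2})^{1/(2q)}`. -/
def phiA (q : ℝ) (A : Fin n → Fin n → Fin m → ℝ) (x : Fin n → ℝ) : ℝ :=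
  (∑ k, (∑ i, (∑ j, A i j k * x j) ^ 4 / ∑ j, A i j k ^ 2) ^ (q / 2)) ^ (1 / (2 * q))

/-- `B_{q'} = {t ∈ ℝᵐ : ∑_k |t_k|^{q'} ≤ 1}`. -/
def Bconj (q' : ℝ) (m : ℕ) : Set (Fin m → ℝ) := {t | ∑ k, |t k| ^ q' ≤ 1}


section Density

variable {ι : Type*} [Fintype ι]

theorem pi_withDensity_ofReal {ρ : ℝ → ℝ} (h0 : ∀ x, 0 ≤ ρ x) (hint : Integrable ρ) :
    Measure.pi (fun _ : ι => volume.withDensity fun x => ENNReal.ofReal (ρ x)) =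
      (volume : Measure (ι → ℝ)).withDensity fun y => ENNReal.ofReal (∏ i, ρ (y i)) := by
  have : IsFiniteMeasure (volume.withDensity fun x => ENNReal.ofReal (ρ x)) :=
    isFiniteMeasure_withDensity_ofReal hint.2
  refine Measure.pi_eq fun s hs => ?_
  have hind : ∀ y : ι → ℝ, (Set.univ.pi s).indicator (fun y => ∏ i, ρ (y i)) y
      = ∏ i, (s i).indicator ρ (y i) := by
    intro y
    by_cases hy : y ∈ Set.univ.pi s
    · rw [indicator_of_mem hy]
      exact Finset.prod_congr rfl fun i _ => (indicator_of_mem (hy i (mem_univ i)) ρ).symm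
    · rw [indicator_of_notMem hy]
      obtain ⟨i, hi⟩ : ∃ i, y i ∉ s i := by simpa [Set.mem_pi] using hy
      exact (Finset.prod_eq_zero (Finset.mem_univ i) (indicator_of_notMem hi ρ)).symm
  have hprod : Integrable (fun y : ι → ℝ => ∏ i, ρ (y i)) :=
    Integrable.fintype_prod (f := fun _ => ρ) fun _ => hint
  rw [withDensity_apply _ (MeasurableSet.univ_pi hs),
    ← ofReal_integral_eq_lintegral_ofReal hprod.integrableOn
      (ae_of_all _ fun y => Finset.prod_nonneg fun i _ => h0 _),
    ← integral_indicator (MeasurableSet.univ_pi hs)]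
  simp_rw [hind]
  rw [integral_fintype_prod_volume_eq_prod (f := fun i => (s i).indicator ρ),
    ENNReal.ofReal_prod_of_nonneg
      fun i _ => integral_nonneg fun x => indicator_nonneg (fun x _ => h0 x) x]
  refine Finset.prod_congr rfl fun i _ => ?_
  rw [withDensity_apply _ (hs i), integral_indicator (hs i),
    ofReal_integral_eq_lintegral_ofReal hint.integrableOn (ae_of_all _ h0)]

/-- Lower bound for the mass of a translate of a symmetric set under an even density. -/
theorem mul_measure_le_measure_translate {ρ : (ι → ℝ) → ℝ} (hρ : Measurable ρ)
    (h0 : ∀ y, 0 ≤ ρ y) (heven : ∀ y, ρ (-y) = ρ y) {K : Set (ι → ℝ)} (hK : MeasurableSet K)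
    (hsymm : ∀ y ∈ K, -y ∈ K) {h : ι → ℝ} {c : ℝ} (hc0 : 0 ≤ c)
    (hc : ∀ y ∈ K, 2 * c * ρ y ≤ ρ (y + h) + ρ (y - h)) :
    ENNReal.ofReal c * volume.withDensity (fun y => ENNReal.ofReal (ρ y)) K
      ≤ volume.withDensity (fun y => ENNReal.ofReal (ρ y)) {y | y - h ∈ K} := by
  have hKh : MeasurableSet {y | y - h ∈ K} := hK.preimage (measurable_id.sub_const h)
  have hplus : volume.withDensity (fun y => ENNReal.ofReal (ρ y)) {y | y - h ∈ K}
      = ∫⁻ y in K, ENNReal.ofReal (ρ (y + h)) := by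
    rw [withDensity_apply _ hKh, ← lintegral_indicator hKh, ← lintegral_indicator hK,
      ← lintegral_add_right_eq_self _ h]
    refine lintegral_congr fun y => ?_
    by_cases hy : y ∈ K
    · rw [indicator_of_mem hy, indicator_of_mem (by simpa using hy)]
    · rw [indicator_of_notMem hy, indicator_of_notMem (by simpa using hy)]
  have hminus : ∫⁻ y in K, ENNReal.ofReal (ρ (y + h)) = ∫⁻ y in K, ENNReal.ofReal (ρ (y - h)) := by
    rw [← lintegral_indicator hK, ← lintegral_indicator hK, ← lintegral_neg_eq_self]
    refine lintegral_congr fun y => ?_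
    have hiff : -y ∈ K ↔ y ∈ K := ⟨fun hy => by simpa using hsymm _ hy, hsymm y⟩
    have hval : ρ (-y + h) = ρ (y - h) := by rw [← heven]; congr 1; abel
    by_cases hy : y ∈ K
    · rw [indicator_of_mem hy, indicator_of_mem (hiff.2 hy), hval]
    · rw [indicator_of_notMem hy, indicator_of_notMem (mt hiff.1 hy)]
  have hm1 : Measurable fun y => ENNReal.ofReal (ρ (y + h)) :=
    (hρ.comp (measurable_id.add_const h)).ennreal_ofReal
  have key : 2 * (ENNReal.ofReal c * volume.withDensity (fun y => ENNReal.ofReal (ρ y)) K)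
      ≤ 2 * volume.withDensity (fun y => ENNReal.ofReal (ρ y)) {y | y - h ∈ K} := by
    calc 2 * (ENNReal.ofReal c * volume.withDensity (fun y => ENNReal.ofReal (ρ y)) K)
        = ∫⁻ y in K, ENNReal.ofReal (2 * c * ρ y) := by
          rw [withDensity_apply _ hK, ← mul_assoc, ← lintegral_const_mul _ hρ.ennreal_ofReal]
          refine lintegral_congr fun y => ?_
          rw [ENNReal.ofReal_mul (by positivity), ENNReal.ofReal_mul zero_le_two,
            ENNReal.ofReal_ofNat]
      _ ≤ ∫⁻ y in K, (ENNReal.ofReal (ρ (y + h)) + ENNReal.ofReal (ρ (y - h))) := by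
          refine setLIntegral_mono' hK fun y hy => ?_
          rw [← ENNReal.ofReal_add (h0 _) (h0 _)]
          exact ENNReal.ofReal_le_ofReal (hc y hy)
      _ = 2 * volume.withDensity (fun y => ENNReal.ofReal (ρ y)) {y | y - h ∈ K} := by
          rw [lintegral_add_left hm1, ← hminus, ← hplus, two_mul]
  exact (ENNReal.mul_le_mul_iff_right two_ne_zero ENNReal.ofNat_ne_top).1 key

end Density

section Counting

variable {Ω ι : Type*} [MeasurableSpace Ω] {μ : Measure Ω}

/-- Markov's inequality, with a strict event, so that no positivity is needed. -/
theorem measureReal_mul_integral_lt_le [IsProbabilityMeasure μ] {f : Ω → ℝ} (h0 : ∀ x, 0 ≤ f x)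
    (hf : Integrable f μ) {c : ℝ} (hc : 0 < c) : μ.real {x | c * ∫ y, f y ∂μ < f x} ≤ 1 / c := by
  rcases (integral_nonneg (μ := μ) (f := f) h0).eq_or_lt with h | h
  · have hz : f =ᵐ[μ] 0 := (integral_eq_zero_iff_of_nonneg h0 hf).1 h.symm
    have : μ {x | c * ∫ y, f y ∂μ < f x} = 0 := by
      rw [← h]
      refine measure_mono_null (fun x hx => ?_) (ae_iff.1 hz)
      have hx' : c * 0 < f x := hx
      rw [mul_zero] at hx'
      exact hx'.ne'
    rw [measureReal_def, this]
    simp [hc.le]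
  · have h1 := mul_meas_ge_le_integral_of_nonneg (ae_of_all _ h0) hf (c * ∫ y, f y ∂μ)
    have h2 : μ.real {x | c * ∫ y, f y ∂μ < f x} ≤ μ.real {x | c * ∫ y, f y ∂μ ≤ f x} :=
      measureReal_mono (ofPred_subset_ofPred.2 fun x hx => hx.le)
    rw [le_div_iff₀ hc]
    refine (mul_le_mul_of_nonneg_right h2 hc.le).trans (le_of_mul_le_mul_right ?_ h)
    linarith

theorem card_mul_le_of_forall_card_le [IsProbabilityMeasure μ] (T : Finset ι) {G : ι → Set Ω}
    (hG : ∀ i ∈ T, MeasurableSet (G i)) {q B : ℝ} (hq : ∀ i ∈ T, q ≤ μ.real (G i))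
    (hcard : ∀ ω, ∀ T' ⊆ T, (∀ i ∈ T', ω ∈ G i) → (T'.card : ℝ) ≤ B) :
    T.card * q ≤ B := by
  classical
  calc T.card * q = ∑ i ∈ T, q := by simp
    _ ≤ ∑ i ∈ T, μ.real (G i) := Finset.sum_le_sum hq
    _ = ∑ i ∈ T, ∫ ω, (G i).indicator 1 ω ∂μ :=
        Finset.sum_congr rfl fun i hi => (integral_indicator_one (hG i hi)).symm
    _ = ∫ ω, ∑ i ∈ T, (G i).indicator 1 ω ∂μ :=
        (integral_finsetSum _ fun i hi => (integrable_const (1 : ℝ)).indicator (hG i hi)).symm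
    _ ≤ ∫ _, B ∂μ := by
        refine integral_mono
          (integrable_finsetSum _ fun i hi => (integrable_const (1 : ℝ)).indicator (hG i hi))
          (integrable_const B) fun ω => ?_
        have := hcard ω (T.filter fun i => ω ∈ G i) (Finset.filter_subset _ _)
          fun i hi => (Finset.mem_filter.1 hi).2
        simpa [indicator, Finset.sum_ite] using this
    _ = B := by simp

/-- A maximal separated subset is a net. -/
theorem exists_separated_net {X : Type*} {d : X → X → ℝ} (hsymm : ∀ x y, d x y = d y x)
    {V : Set X} {R : ℝ} (hself : ∀ x, d x x ≤ R) {B : ℕ}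
    (hB : ∀ c : Finset X, ↑c ⊆ V → (∀ x ∈ c, ∀ y ∈ c, x ≠ y → R < d x y) → c.card ≤ B) :
    ∃ c : Finset X, ↑c ⊆ V ∧ (∀ x ∈ c, ∀ y ∈ c, x ≠ y → R < d x y) ∧
      ∀ z ∈ V, ∃ w ∈ c, d z w ≤ R := by
  classical
  set N : Set ℕ := {k | ∃ c : Finset X, ↑c ⊆ V ∧ (∀ x ∈ c, ∀ y ∈ c, x ≠ y → R < d x y) ∧
    c.card = k}
  have hne : N.Nonempty := ⟨0, ∅, by simp⟩
  have hbdd : BddAbove N := by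
    refine ⟨B, ?_⟩
    rintro k ⟨c, hcV, hc, rfl⟩
    exact hB c hcV hc
  obtain ⟨c, hcV, hc, hcard⟩ := Nat.sSup_mem hne hbdd
  refine ⟨c, hcV, hc, fun z hz => ?_⟩
  by_contra! hcon
  have hzc : z ∉ c := fun h => absurd (hself z) (not_le.2 (hcon z h))
  have hmem : (insert z c).card ∈ N := by
    refine ⟨insert z c, ?_, ?_, rfl⟩
    · rw [Finset.coe_insert]
      exact insert_subset hz hcV
    · intro x hx y hy hxy
      rcases Finset.mem_insert.1 hx with rfl | hx' <;> rcases Finset.mem_insert.1 hy with rfl | hy'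
      · exact absurd rfl hxy
      · exact hcon y hy'
      · rw [hsymm]; exact hcon x hx'
      · exact hc x hx' y hy' hxy
  have := le_csSup hbdd hmem
  rw [Finset.card_insert_of_notMem hzc] at this
  omega

end Counting

section Supremum

variable {κ : Type*} {S : Set κ} {f : κ → ℝ} {b : ℝ}

theorem le_biSup_of_forall_le (hb : ∀ s ∈ S, f s ≤ b) {t : κ} (ht : t ∈ S) :
    f t ≤ ⨆ s ∈ S, f s := by
  have hbdd : BddAbove (range fun s => ⨆ _ : s ∈ S, f s) := by
    refine ⟨max b 0, ?_⟩
    rintro _ ⟨s, rfl⟩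
    exact Real.iSup_le (fun hs => (hb s hs).trans (le_max_left _ _)) (le_max_right _ _)
  calc f t = ⨆ _ : t ∈ S, f t := (ciSup_pos (f := fun _ => f t) ht).symm
    _ ≤ ⨆ s ∈ S, f s := le_ciSup hbdd t

theorem le_biSup_of_finite (hS : S.Finite) {t : κ} (ht : t ∈ S) : f t ≤ ⨆ s ∈ S, f s := by
  obtain ⟨b, hb⟩ := (hS.image f).bddAbove
  exact le_biSup_of_forall_le (fun s hs => hb (mem_image_of_mem f hs)) ht

theorem biSup_le_of_nonneg (h0 : 0 ≤ b) (hb : ∀ s ∈ S, f s ≤ b) : ⨆ s ∈ S, f s ≤ b :=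
  Real.iSup_le (fun s => Real.iSup_le (hb s) h0) h0

theorem biSup_nonneg_of_nonneg (hf : ∀ s, 0 ≤ f s) : 0 ≤ ⨆ s ∈ S, f s :=
  Real.iSup_nonneg fun s => Real.iSup_nonneg fun _ => hf s

end Supremum

section Seminorms

/-- `x ↦ sup_{s ∈ S} |ℓ_s(x)|` for a finite family of linear forms. -/
def supSeminorm {E κ : Type*} [AddCommGroup E] [Module ℝ E] {S : Set κ} (hS : S.Finite)
    (ℓ : κ → E →ₗ[ℝ] ℝ) : Seminorm ℝ E :=
  Seminorm.of (fun x => ⨆ s ∈ S, |ℓ s x|)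
    (fun x y => biSup_le_of_nonneg
      (add_nonneg (biSup_nonneg_of_nonneg fun _ => abs_nonneg _)
        (biSup_nonneg_of_nonneg fun _ => abs_nonneg _))
      fun s hs => by
        rw [map_add]
        exact (abs_add_le _ _).trans (add_le_add
          (le_biSup_of_finite (f := fun s => |ℓ s x|) hS hs)
          (le_biSup_of_finite (f := fun s => |ℓ s y|) hS hs)))
    (fun a x => by
      simp_rw [map_smul, smul_eq_mul, abs_mul, Real.norm_eq_abs,
        Real.mul_iSup_of_nonneg (abs_nonneg a)])

/-- `x ↦ ∫ p_ω(x) dμ(ω)` for an integrable family of seminorms. -/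
def integralSeminorm {E Ω : Type*} [AddCommGroup E] [Module ℝ E] [MeasurableSpace Ω]
    {μ : Measure Ω} {p : Ω → Seminorm ℝ E} (hp : ∀ x, Integrable (fun ω => p ω x) μ) :
    Seminorm ℝ E :=
  Seminorm.of (fun x => ∫ ω, p ω x ∂μ)
    (fun x y => by
      rw [← integral_add (hp x) (hp y)]
      exact integral_mono (hp _) ((hp x).add (hp y)) fun ω => map_add_le_add (p ω) x y)
    (fun a x => by
      simp_rw [map_smul_eq_mul]
      exact integral_const_mul _ _)

variable {ι : Type*} [Fintype ι]

theorem seminorm_le_sum [DecidableEq ι] (p : Seminorm ℝ (ι → ℝ)) (x : ι → ℝ) :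
    p x ≤ ∑ i, |x i| * p (Pi.single i 1) := by
  have hx : x = ∑ i, x i • (Pi.single i 1 : ι → ℝ) := by
    ext j; simp [Finset.sum_apply, Pi.single_apply]
  calc p x = p (∑ i, x i • (Pi.single i 1 : ι → ℝ)) := by rw [← hx]
    _ ≤ ∑ i, p (x i • (Pi.single i 1 : ι → ℝ)) :=
        Finset.le_sum_of_subadditive p (map_zero p).le (map_add_le_add p) _ _
    _ = ∑ i, |x i| * p (Pi.single i 1) := by simp_rw [map_smul_eq_mul, Real.norm_eq_abs]

theorem continuous_seminorm (p : Seminorm ℝ (ι → ℝ)) : Continuous p := by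
  classical
  have hC : 0 ≤ ∑ i, p (Pi.single i 1) := Finset.sum_nonneg fun i _ => apply_nonneg p _
  refine Seminorm.continuous_of_le (q := (∑ i, p (Pi.single i 1)).toNNReal • normSeminorm ℝ (ι → ℝ))
    (continuous_const.mul continuous_norm) fun x => (seminorm_le_sum p x).trans ?_
  change _ ≤ ((∑ i, p (Pi.single i 1)).toNNReal : ℝ) * ‖x‖
  rw [Real.coe_toNNReal _ hC, mul_comm, Finset.mul_sum]
  exact Finset.sum_le_sum fun i _ =>
    mul_le_mul_of_nonneg_right (norm_le_pi_norm x i) (apply_nonneg p _)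

theorem integrable_seminorm_pi {ν : Measure ℝ} [IsProbabilityMeasure ν] (hν : Integrable id ν)
    (p : Seminorm ℝ (ι → ℝ)) : Integrable p (Measure.pi fun _ : ι => ν) := by
  classical
  have hi : ∀ i : ι, Integrable (fun x : ι → ℝ => x i) (Measure.pi fun _ : ι => ν) := fun i =>
    integrable_comp_eval (μ := fun _ : ι => ν) (f := id) hν
  refine Integrable.mono' (g := fun x => ∑ i, |x i| * p (Pi.single i 1))
    (integrable_finsetSum _ fun i _ => (hi i).abs.mul_const _)
    (continuous_seminorm p).aestronglyMeasurable (ae_of_all _ fun x => ?_)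
  rw [Real.norm_of_nonneg (apply_nonneg p x)]
  exact seminorm_le_sum p x

/-- The Euclidean norm on `ι → ℝ`. -/
def l2 (ι : Type*) [Fintype ι] : Seminorm ℝ (ι → ℝ) :=
  (normSeminorm ℝ (EuclideanSpace ℝ ι)).comp (WithLp.linearEquiv 2 ℝ (ι → ℝ)).symm.toLinearMap

theorem l2_apply (v : ι → ℝ) : l2 ι v = Real.sqrt (∑ i, v i ^ 2) := by
  change ‖WithLp.toLp 2 v‖ = _
  simp [EuclideanSpace.norm_eq]

theorem sq_l2 (v : ι → ℝ) : l2 ι v ^ 2 = ∑ i, v i ^ 2 := by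
  rw [l2_apply, Real.sq_sqrt (Finset.sum_nonneg fun i _ => sq_nonneg _)]

end Seminorms

section Translation

variable {ι : Type*} [Fintype ι]

/-- Lower bound for the mass of a translate of a symmetric set under a product of even densities
`k e^{-φ}`. -/
theorem exp_neg_mul_le_measureReal_translate {k : ℝ} (hk : 0 ≤ k) {φ : ℝ → ℝ}
    (hφ : Measurable φ) (heven : ∀ x, φ (-x) = φ x) {ν : Measure ℝ} [IsProbabilityMeasure ν]
    (hν : ν = volume.withDensity fun x => ENNReal.ofReal (k * Real.exp (-φ x)))
    (hint : Integrable fun x => k * Real.exp (-φ x)) {K : Set (ι → ℝ)} (hK : MeasurableSet K)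
    (hsymm : ∀ y ∈ K, -y ∈ K) {h : ι → ℝ} {D : ℝ}
    (hD : ∀ y ∈ K, ∑ i, (φ (y i + h i) + φ (y i - h i)) ≤ 2 * (∑ i, φ (y i) + D)) :
    Real.exp (-D) * (Measure.pi fun _ : ι => ν).real K
      ≤ (Measure.pi fun _ : ι => ν).real {y | y - h ∈ K} := by
  have hprod : ∀ y : ι → ℝ, ∏ i, k * Real.exp (-φ (y i))
      = k ^ Fintype.card ι * Real.exp (-∑ i, φ (y i)) := by
    intro y
    rw [Finset.prod_mul_distrib, Finset.prod_const, Finset.card_univ, ← Real.exp_sum,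
      Finset.sum_neg_distrib]
  have key : ENNReal.ofReal (Real.exp (-D)) * (Measure.pi fun _ : ι => ν) K
      ≤ (Measure.pi fun _ : ι => ν) {y | y - h ∈ K} := by
    rw [hν, pi_withDensity_ofReal (fun x => by positivity) hint]
    refine mul_measure_le_measure_translate (ρ := fun y : ι → ℝ => ∏ i, k * Real.exp (-φ (y i)))
      (by fun_prop) (fun y => Finset.prod_nonneg fun i _ => by positivity)
      (fun y => by simp [heven]) hK hsymm (Real.exp_pos _).le fun y hy => ?_
    simp only [hprod, Pi.add_apply, Pi.sub_apply]
    set a := ∑ i, φ (y i + h i)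
    set b := ∑ i, φ (y i - h i)
    set s := ∑ i, φ (y i)
    have hab : a + b ≤ 2 * (s + D) := by
      simpa only [a, b, s, Finset.sum_add_distrib] using hD y hy
    have h1 : 2 * Real.exp (-D - s) ≤ Real.exp (-a) + Real.exp (-b) := by
      have h2 : Real.exp (-D - s) ^ 2 ≤ Real.exp (-a) * Real.exp (-b) := by
        rw [← Real.exp_add, ← Real.exp_nat_mul]
        exact Real.exp_le_exp.2 (by push_cast; linarith)
      exact abs_le_of_sq_le_sq' (by nlinarith [sq_nonneg (Real.exp (-a) - Real.exp (-b))])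
        (by positivity) |>.2
    calc 2 * Real.exp (-D) * (k ^ Fintype.card ι * Real.exp (-s))
        = k ^ Fintype.card ι * (2 * Real.exp (-D - s)) := by
          rw [sub_eq_add_neg, Real.exp_add]; ring
      _ ≤ k ^ Fintype.card ι * (Real.exp (-a) + Real.exp (-b)) := by gcongr
      _ = _ := by ring
  have := ENNReal.toReal_mono (measure_ne_top _ _) key
  rwa [ENNReal.toReal_mul, ENNReal.toReal_ofReal (Real.exp_pos _).le] at this

instance (n : ℕ) : IsProbabilityMeasure (gaussVec n) := by
  unfold gaussVec; infer_instance

theorem gaussVec_translate {n : ℕ} {K : Set (Fin n → ℝ)} (hK : MeasurableSet K)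
    (hsymm : ∀ y ∈ K, -y ∈ K) (h : Fin n → ℝ) :
    Real.exp (-(l2 (Fin n) h ^ 2 / 2)) * (gaussVec n).real K
      ≤ (gaussVec n).real {y | y - h ∈ K} := by
  have hpdf : gaussianPDFReal 0 1
      = fun x => (Real.sqrt (2 * Real.pi))⁻¹ * Real.exp (-(x ^ 2 / 2)) := by
    ext x
    simp [gaussianPDFReal, neg_div]
  refine exp_neg_mul_le_measureReal_translate (k := (Real.sqrt (2 * Real.pi))⁻¹)
    (φ := fun x => x ^ 2 / 2) (by positivity) (by fun_prop) (fun x => by simp) ?_ ?_ hK hsymm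
    fun y _ => ?_
  · rw [gaussianReal_of_var_ne_zero _ one_ne_zero]
    simp only [gaussianPDF_def, hpdf]
  · exact hpdf ▸ integrable_gaussianPDFReal 0 1
  · rw [sq_l2, Finset.sum_div, ← Finset.sum_add_distrib, Finset.mul_sum]
    exact Finset.sum_le_sum fun i _ => by nlinarith

theorem integrable_seminorm_gaussVec {n : ℕ} (p : Seminorm ℝ (Fin n → ℝ)) :
    Integrable p (gaussVec n) :=
  integrable_seminorm_pi ((memLp_id_gaussianReal 1).integrable le_rfl) p

end Translation

section Sudakov

variable {n : ℕ} {ι : Type*} {T : Finset ι} {v : ι → Fin n → ℝ} {W : Seminorm ℝ (Fin n → ℝ)}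

theorem dotProduct_self_eq_sq_l2 (u : Fin n → ℝ) : u ⬝ᵥ u = l2 (Fin n) u ^ 2 := by
  rw [sq_l2]
  exact Finset.sum_congr rfl fun i _ => (pow_two _).symm

/-- Local form of Sudakov's minoration. -/
theorem card_le_of_separated_of_ball {v₀ : Fin n → ℝ} {K δ r : ℝ} (hK : 0 < K) (hδ : 0 < δ)
    (hW : ∀ i ∈ T, ∀ g, |g ⬝ᵥ v i| ≤ W g) (hE : ∫ g, W g ∂gaussVec n ≤ K * δ)
    (hsep : ∀ i ∈ T, ∀ j ∈ T, i ≠ j → δ ≤ l2 (Fin n) (v i - v j))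
    (hball : ∀ i ∈ T, l2 (Fin n) (v i - v₀) ≤ r * δ) :
    (T.card : ℝ) ≤ 2 * Real.exp (81 * (K * r) ^ 2 / 2) := by
  set E := ∫ g, W g ∂gaussVec n
  set B : Set (Fin n → ℝ) := {g | W g ≤ 2 * E} with hB
  have hBm : MeasurableSet B := measurableSet_le (continuous_seminorm W).measurable
    measurable_const
  have hBhalf : 1 / 2 ≤ (gaussVec n).real B := by
    have h1 := measureReal_mul_integral_lt_le (fun g => apply_nonneg W g)
      (integrable_seminorm_gaussVec W) two_pos
    have h2 : {g | 2 * E < W g} = Bᶜ := by ext g; simp [hB]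
    rw [h2, probReal_compl_eq_one_sub hBm] at h1
    linarith
  set t : ℝ := 9 * K / δ with ht
  have htδ : t * δ = 9 * K := by rw [ht]; field_simp
  have ht0 : 0 ≤ t := by positivity
  set G : ι → Set (Fin n → ℝ) := fun i => {y | y - t • (v i - v₀) ∈ B} with hG
  have hcount : (T.card : ℝ) * (Real.exp (-(81 * (K * r) ^ 2 / 2)) * (1 / 2)) ≤ 1 := by
    refine card_mul_le_of_forall_card_le (μ := gaussVec n) T (G := G)
      (fun i _ => hBm.preimage (measurable_id.sub_const _)) (fun i hi => ?_)
      fun y T' hT' hy => ?_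
    · refine le_trans ?_ (gaussVec_translate hBm (fun g hg => ?_) (t • (v i - v₀)))
      · refine mul_le_mul (Real.exp_le_exp.2 (neg_le_neg ?_)) hBhalf (by norm_num)
          (Real.exp_pos _).le
        rw [map_smul_eq_mul, Real.norm_of_nonneg ht0]
        have h3 : t * l2 (Fin n) (v i - v₀) ≤ 9 * (K * r) := by
          calc t * l2 (Fin n) (v i - v₀) ≤ t * (r * δ) := by gcongr; exact hball i hi
            _ = (t * δ) * r := by ring
            _ = 9 * (K * r) := by rw [htδ]; ring
        have h4 : (t * l2 (Fin n) (v i - v₀)) ^ 2 ≤ (9 * (K * r)) ^ 2 :=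
          pow_le_pow_left₀ (mul_nonneg ht0 (apply_nonneg _ _)) h3 2
        linarith
      · change W (-g) ≤ 2 * E
        rw [map_neg_eq_map]
        exact hg
    · rw [← Nat.cast_one, Nat.cast_le, Finset.card_le_one]
      intro i hi j hj
      by_contra hij
      set u := v j - v i with hu
      have hyi : W (y - t • (v i - v₀)) ≤ 2 * E := hy i hi
      have hyj : W (y - t • (v j - v₀)) ≤ 2 * E := hy j hj
      have hw : W (t • u) ≤ 4 * E := by
        have : t • u = (y - t • (v i - v₀)) - (y - t • (v j - v₀)) := by
          rw [hu]; module
        rw [this]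
        exact (map_sub_le_add W _ _).trans (by linarith)
      have hdot : (t • u) ⬝ᵥ u ≤ 2 * W (t • u) := by
        conv_lhs => rw [hu, dotProduct_sub, ← hu]
        have h5 := le_of_abs_le (hW j (hT' hj) (t • u))
        have h6 := neg_le_of_abs_le (hW i (hT' hi) (t • u))
        linarith
      rw [smul_dotProduct, dotProduct_self_eq_sq_l2, smul_eq_mul] at hdot
      have hsq : δ ^ 2 ≤ l2 (Fin n) u ^ 2 :=
        pow_le_pow_left₀ hδ.le (hsep j (hT' hj) i (hT' hi) (Ne.symm hij)) 2
      have h7 : 9 * K * δ ≤ t * l2 (Fin n) u ^ 2 := by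
        calc 9 * K * δ = t * δ ^ 2 := by rw [← htδ]; ring
          _ ≤ _ := by gcongr
      nlinarith [mul_pos hK hδ]
  rw [Real.exp_neg] at hcount
  have hpos := Real.exp_pos (81 * (K * r) ^ 2 / 2)
  calc (T.card : ℝ) = T.card * ((Real.exp (81 * (K * r) ^ 2 / 2))⁻¹ * (1 / 2))
        * (2 * Real.exp (81 * (K * r) ^ 2 / 2)) := by field_simp
    _ ≤ 1 * (2 * Real.exp (81 * (K * r) ^ 2 / 2)) := by gcongr
    _ = _ := one_mul _

theorem two_le_exp_of_l2_sub {u₁ u₂ : Fin n → ℝ} {K δ : ℝ} (hK : 0 < K) (hδ : 0 < δ)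
    (h₁ : ∀ g, |g ⬝ᵥ u₁| ≤ W g) (h₂ : ∀ g, |g ⬝ᵥ u₂| ≤ W g)
    (hE : ∫ g, W g ∂gaussVec n ≤ K * δ) (hsep : δ ≤ l2 (Fin n) (u₁ - u₂)) :
    2 ≤ Real.exp (324 * K ^ 2) := by
  set u := u₁ - u₂ with hu
  have hu0 : 0 < l2 (Fin n) u := hδ.trans_le hsep
  have hneg : l2 (Fin n) (-u) = l2 (Fin n) u := map_neg_eq_map _ _
  have hdbl : l2 (Fin n) u ≤ l2 (Fin n) (u + u) := by
    rw [← two_smul ℝ u, map_smul_eq_mul, Real.norm_of_nonneg zero_le_two]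
    linarith
  have hdbl' : l2 (Fin n) u ≤ l2 (Fin n) (-u - u) := by
    rw [← neg_add', map_neg_eq_map]
    exact hdbl
  have hWu : ∀ g, |g ⬝ᵥ u| ≤ (W + W) g := fun g => by
    rw [hu, dotProduct_sub]
    exact (abs_sub _ _).trans (add_le_add (h₁ g) (h₂ g))
  have hint : ∫ g, (W + W) g ∂gaussVec n ≤ 2 * K * l2 (Fin n) u := by
    have : ∫ g, (W + W) g ∂gaussVec n = (∫ g, W g ∂gaussVec n) + ∫ g, W g ∂gaussVec n :=
      integral_add (integrable_seminorm_gaussVec W) (integrable_seminorm_gaussVec W)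
    rw [this]
    nlinarith
  have h3 := card_le_of_separated_of_ball (T := (Finset.univ : Finset (Fin 3)))
    (v := ![0, u, -u]) (v₀ := 0) (W := W + W) (K := 2 * K) (r := 1) (by positivity) hu0
    (by
      intro i _ g
      fin_cases i
      · simp
      · exact hWu g
      · simpa using hWu g)
    hint
    (by
      intro i _ j _ hij
      fin_cases i <;> fin_cases j <;> first | exact absurd rfl hij | simp [hneg, hdbl, hdbl'])
    (by
      intro i _
      fin_cases i <;> simp [hneg])
  have h4 : (81 : ℝ) * (2 * K * 1) ^ 2 / 2 = 162 * K ^ 2 := by ring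
  rw [h4] at h3
  have h5 : Real.exp (324 * K ^ 2) = Real.exp (162 * K ^ 2) ^ 2 := by
    rw [← Real.exp_nat_mul]; congr 1; push_cast; ring
  simp only [Finset.card_univ, Fintype.card_fin, Nat.cast_ofNat] at h3
  rw [h5]
  nlinarith

theorem card_le_exp_of_separated_of_diam (k : ℕ) {T : Finset ι} {K δ : ℝ} (hK : 0 < K)
    (hδ : 0 < δ) (hW : ∀ i ∈ T, ∀ g, |g ⬝ᵥ v i| ≤ W g) (hE : ∫ g, W g ∂gaussVec n ≤ K * δ)
    (hsep : ∀ i ∈ T, ∀ j ∈ T, i ≠ j → δ < l2 (Fin n) (v i - v j))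
    (hdiam : ∀ i ∈ T, ∀ j ∈ T, l2 (Fin n) (v i - v j) ≤ 2 ^ k * δ) :
    (T.card : ℝ) ≤ Real.exp (648 * K ^ 2) := by
  classical
  induction k generalizing T K δ with
  | zero =>
    have h1 : T.card ≤ 1 := Finset.card_le_one.2 fun i hi j hj => by
      by_contra hij
      have := hdiam i hi j hj
      rw [pow_zero, one_mul] at this
      exact absurd (hsep i hi j hj hij) (not_lt.2 this)
    exact (Nat.cast_le_one.2 h1).trans (Real.one_le_exp (by positivity))
  | succ k ih =>
    rcases Nat.lt_or_ge 1 T.card with hT | hT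
    swap
    · exact (Nat.cast_le_one.2 hT).trans (Real.one_le_exp (by positivity))
    obtain ⟨i, hi, j, hj, hij⟩ := Finset.one_lt_card.1 hT
    have h2 := two_le_exp_of_l2_sub hK hδ (hW i hi) (hW j hj) hE (hsep i hi j hj hij).le
    obtain ⟨c, hcT, hc, hnet⟩ := exists_separated_net
      (d := fun i j => l2 (Fin n) (v i - v j)) (fun i j => map_sub_rev _ _ _) (V := ↑T)
      (R := 2 * δ) (fun i => by simpa using hδ.le) (B := T.card)
      fun c hc _ => Finset.card_le_card (Finset.coe_subset.1 hc)
    rw [Finset.coe_subset] at hcT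
    have hccard : (c.card : ℝ) ≤ Real.exp (648 * (K / 2) ^ 2) :=
      ih (by positivity) (by positivity) (fun i hi => hW i (hcT hi)) (by linarith) hc
        fun i hi j hj => (hdiam i (hcT hi) j (hcT hj)).trans_eq (by ring)
    have hcover : T ⊆ c.biUnion fun w => T.filter fun z => l2 (Fin n) (v z - v w) ≤ 2 * δ :=
      fun z hz => by
        obtain ⟨w, hw, hzw⟩ := hnet z hz
        exact Finset.mem_biUnion.2 ⟨w, hw, Finset.mem_filter.2 ⟨hz, hzw⟩⟩
    have hfib : ∀ w ∈ c, ((T.filter fun z => l2 (Fin n) (v z - v w) ≤ 2 * δ).card : ℝ)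
        ≤ 2 * Real.exp (81 * (K * 2) ^ 2 / 2) := fun w _ =>
      card_le_of_separated_of_ball hK hδ (fun i hi => hW i (Finset.mem_filter.1 hi).1) hE
        (fun i hi j hj hij =>
          (hsep i (Finset.mem_filter.1 hi).1 j (Finset.mem_filter.1 hj).1 hij).le)
        fun i hi => (Finset.mem_filter.1 hi).2
    calc (T.card : ℝ)
        ≤ ((∑ w ∈ c, (T.filter fun z => l2 (Fin n) (v z - v w) ≤ 2 * δ).card : ℕ) : ℝ) :=
          Nat.cast_le.2 ((Finset.card_le_card hcover).trans Finset.card_biUnion_le)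
      _ ≤ ∑ w ∈ c, 2 * Real.exp (81 * (K * 2) ^ 2 / 2) := by
          push_cast
          exact Finset.sum_le_sum hfib
      _ = c.card * (2 * Real.exp (81 * (K * 2) ^ 2 / 2)) := by simp
      _ ≤ Real.exp (648 * (K / 2) ^ 2)
            * (Real.exp (324 * K ^ 2) * Real.exp (81 * (K * 2) ^ 2 / 2)) := by gcongr
      _ = Real.exp (648 * K ^ 2) := by
          rw [← Real.exp_add, ← Real.exp_add]
          congr 1
          ring

/-- **Sudakov's minoration**, as a bound for the cardinality of a separated family. -/
theorem card_le_exp_of_separated {K δ : ℝ} (hK : 0 < K)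
    (hW : ∀ i ∈ T, ∀ g, |g ⬝ᵥ v i| ≤ W g) (hE : ∫ g, W g ∂gaussVec n ≤ K * δ)
    (hsep : ∀ i ∈ T, ∀ j ∈ T, i ≠ j → δ < l2 (Fin n) (v i - v j)) :
    (T.card : ℝ) ≤ Real.exp (648 * K ^ 2) := by
  classical
  rcases Nat.lt_or_ge 1 T.card with hT | hT
  swap
  · exact (Nat.cast_le_one.2 hT).trans (Real.one_le_exp (by positivity))
  obtain ⟨i₀, hi₀, j₀, hj₀, hij₀⟩ := Finset.one_lt_card.1 hT
  have hδ : 0 ≤ δ := by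
    have : 0 ≤ ∫ g, W g ∂gaussVec n := integral_nonneg fun g => apply_nonneg W g
    exact nonneg_of_mul_nonneg_right (this.trans hE) hK
  obtain ⟨⟨i₁, j₁⟩, hmem, hmin⟩ := T.offDiag.exists_min_image
    (fun x => l2 (Fin n) (v x.1 - v x.2)) ⟨(i₀, j₀), Finset.mem_offDiag.2 ⟨hi₀, hj₀, hij₀⟩⟩
  obtain ⟨hi₁, hj₁, hij₁⟩ := Finset.mem_offDiag.1 hmem
  obtain ⟨δ', hδδ', hδ'⟩ := exists_between (hsep i₁ hi₁ j₁ hj₁ hij₁)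
  have hδ'0 : 0 < δ' := hδ.trans_lt hδδ'
  obtain ⟨⟨i₂, j₂⟩, -, hmax⟩ := (T ×ˢ T).exists_max_image
    (fun x => l2 (Fin n) (v x.1 - v x.2)) ⟨(i₀, j₀), Finset.mk_mem_product hi₀ hj₀⟩
  obtain ⟨k, hk⟩ := pow_unbounded_of_one_lt (l2 (Fin n) (v i₂ - v j₂) / δ') one_lt_two
  refine card_le_exp_of_separated_of_diam k hK hδ'0 hW (hE.trans (by gcongr))
    (fun i hi j hj hij => hδ'.trans_le (hmin (i, j) (Finset.mem_offDiag.2 ⟨hi, hj, hij⟩)))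
    fun i hi j hj => (hmax (i, j) (Finset.mk_mem_product hi hj)).trans
      ((div_le_iff₀ hδ'0).1 hk.le)

end Sudakov

section Exponential

theorem integral_exp_neg_abs_div_two : ∫ x : ℝ, Real.exp (-|x|) / 2 = 1 := by
  rw [integral_comp_abs (f := fun x => Real.exp (-x) / 2), integral_div,
    integral_exp_neg_Ioi_zero]
  norm_num

theorem integrable_exp_neg_abs_div_two : Integrable fun x : ℝ => Real.exp (-|x|) / 2 :=
  integrable_of_integral_eq_one integral_exp_neg_abs_div_two

instance : IsProbabilityMeasure symExp := by
  refine ⟨?_⟩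
  rw [symExp, withDensity_apply _ MeasurableSet.univ, Measure.restrict_univ,
    ← ofReal_integral_eq_lintegral_ofReal integrable_exp_neg_abs_div_two
      (ae_of_all _ fun x => by positivity), integral_exp_neg_abs_div_two, ENNReal.ofReal_one]

instance (n : ℕ) : IsProbabilityMeasure (expVec n) := by
  unfold expVec; infer_instance

theorem integrable_id_symExp : Integrable id symExp := by
  have hm : Measurable fun x : ℝ => ENNReal.ofReal (Real.exp (-|x|) / 2) := by fun_prop
  rw [symExp, integrable_withDensity_iff hm (ae_of_all _ fun x => ENNReal.ofReal_lt_top)]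
  have h : Integrable fun x : ℝ => 2 * (Real.exp (-|x * (1 / 2)|) / 2) :=
    (integrable_exp_neg_abs_div_two.comp_mul_right' (by norm_num)).const_mul 2
  refine h.mono' (by fun_prop) (ae_of_all _ fun x => ?_)
  rw [ENNReal.toReal_ofReal (by positivity), id, norm_mul, Real.norm_eq_abs,
    Real.norm_of_nonneg (by positivity)]
  have h1 : Real.exp (-|x|) = Real.exp (-|x * (1 / 2)|) * Real.exp (-|x * (1 / 2)|) := by
    rw [← Real.exp_add, abs_mul, abs_of_pos (by norm_num : (0 : ℝ) < 1 / 2)]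
    congr 1; ring
  have h2 : |x| * Real.exp (-|x * (1 / 2)|) ≤ 2 := by
    have h3 : |x * (1 / 2)| ≤ Real.exp |x * (1 / 2)| :=
      (by linarith : |x * (1 / 2)| ≤ |x * (1 / 2)| + 1).trans (Real.add_one_le_exp _)
    rw [Real.exp_neg, ← div_eq_mul_inv, div_le_iff₀ (Real.exp_pos _)]
    rw [abs_mul, abs_of_pos (by norm_num : (0 : ℝ) < 1 / 2)] at h3 ⊢
    linarith
  rw [h1]
  nlinarith [Real.exp_pos (-|x * (1 / 2)|)]

theorem integrable_seminorm_expVec {n : ℕ} (p : Seminorm ℝ (Fin n → ℝ)) :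
    Integrable p (expVec n) :=
  integrable_seminorm_pi integrable_id_symExp p

theorem symExp_Icc_le {b : ℝ} (hb : 0 ≤ b) : symExp.real (Icc (-b) b) ≤ b := by
  refine ENNReal.toReal_le_of_le_ofReal hb ?_
  rw [symExp, withDensity_apply _ measurableSet_Icc]
  calc ∫⁻ x in Icc (-b) b, ENNReal.ofReal (Real.exp (-|x|) / 2)
      ≤ ∫⁻ _ in Icc (-b) b, ENNReal.ofReal (1 / 2) := by
        refine lintegral_mono fun x => ENNReal.ofReal_le_ofReal ?_
        have : Real.exp (-|x|) ≤ 1 := Real.exp_le_one_iff.2 (by simp)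
        linarith
    _ = ENNReal.ofReal b := by
        rw [setLIntegral_const, Real.volume_Icc, ← ENNReal.ofReal_mul (by norm_num)]
        congr 1; ring

theorem integrable_max_sub_abs_symExp (b : ℝ) :
    Integrable (fun x => max (|b| - |x|) 0) symExp := by
  refine (integrable_const |b|).mono' (by fun_prop) (ae_of_all _ fun x => ?_)
  rw [Real.norm_of_nonneg (le_max_right _ _)]
  exact max_le (by linarith [abs_nonneg x]) (abs_nonneg b)

theorem integral_max_sub_abs_symExp_le (b : ℝ) :
    ∫ x, max (|b| - |x|) 0 ∂symExp ≤ b ^ 2 := by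
  calc ∫ x, max (|b| - |x|) 0 ∂symExp
      ≤ ∫ x, (Icc (-|b|) |b|).indicator (fun _ => |b|) x ∂symExp := by
        refine integral_mono (integrable_max_sub_abs_symExp b)
          ((integrable_const _).indicator measurableSet_Icc) fun x => ?_
        by_cases hx : x ∈ Icc (-|b|) |b|
        · simp only [indicator_of_mem hx]
          exact max_le (by linarith [abs_nonneg x]) (abs_nonneg b)
        · simp only [indicator_of_notMem hx]
          rw [mem_Icc, ← abs_le, not_le] at hx
          exact max_le (by linarith) le_rfl
    _ = symExp.real (Icc (-|b|) |b|) * |b| := by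
        rw [integral_indicator measurableSet_Icc, setIntegral_const, smul_eq_mul]
    _ ≤ |b| * |b| := by gcongr; exact symExp_Icc_le (abs_nonneg b)
    _ = b ^ 2 := by rw [abs_mul_abs_self, pow_two]

variable {n : ℕ}

theorem expVec_sum_max_sub_abs_le (a : Fin n → ℝ) :
    (expVec n).real {y | 8 * l2 (Fin n) a ^ 2 < ∑ i, max (|a i| - |y i|) 0} ≤ 1 / 8 := by
  have hi : ∀ i, Integrable (fun y : Fin n → ℝ => max (|a i| - |y i|) 0) (expVec n) := fun i =>
    integrable_comp_eval (μ := fun _ : Fin n => symExp) (integrable_max_sub_abs_symExp (a i))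
  have hE : ∫ y, ∑ i, max (|a i| - |y i|) 0 ∂expVec n ≤ l2 (Fin n) a ^ 2 := by
    rw [integral_finsetSum _ fun i _ => hi i, sq_l2]
    refine Finset.sum_le_sum fun i _ => ?_
    have : ∫ y, max (|a i| - |y i|) 0 ∂expVec n = ∫ x, max (|a i| - |x|) 0 ∂symExp :=
      integral_comp_eval (μ := fun _ : Fin n => symExp)
        (integrable_max_sub_abs_symExp (a i)).aestronglyMeasurable
    rw [this]
    exact integral_max_sub_abs_symExp_le (a i)
  have hmarkov := measureReal_mul_integral_lt_le (μ := expVec n)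
    (fun y : Fin n → ℝ => Finset.sum_nonneg fun i (_ : i ∈ Finset.univ) =>
      le_max_right (|a i| - |y i|) 0)
    (integrable_finsetSum _ fun i _ => hi i) (by norm_num : (0 : ℝ) < 8)
  refine le_trans (measureReal_mono (ofPred_subset_ofPred.2 fun y hy => ?_)) hmarkov
  linarith

/-- Lower bound for the mass, under the exponential law, of a translate of the intersection of two
balls whose radii are comparable to the mean of the corresponding seminorm. -/
theorem expVec_translate (p q : Seminorm ℝ (Fin n → ℝ)) (a b : Fin n → ℝ) :
    Real.exp (-(8 * l2 (Fin n) a ^ 2 + ∑ i, |b i|)) * (1 / 2)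
      ≤ (expVec n).real {y | p (y - (a + b)) ≤ 8 * (∫ e, p e ∂expVec n) ∧
          q (y - (a + b)) ≤ 8 * ∫ e, q e ∂expVec n} := by
  set P : Set (Fin n → ℝ) := {y | 8 * (∫ e, p e ∂expVec n) < p y}
  set Q : Set (Fin n → ℝ) := {y | 8 * (∫ e, q e ∂expVec n) < q y}
  set M : Set (Fin n → ℝ) := {y | 8 * l2 (Fin n) a ^ 2 < ∑ i, max (|a i| - |y i|) 0}
  have hPm : MeasurableSet P := measurableSet_lt measurable_const (continuous_seminorm p).measurable
  have hQm : MeasurableSet Q := measurableSet_lt measurable_const (continuous_seminorm q).measurable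
  have hMm : MeasurableSet M := measurableSet_lt measurable_const (by fun_prop)
  have hP : (expVec n).real P ≤ 1 / 8 := measureReal_mul_integral_lt_le
    (fun e => apply_nonneg p e) (integrable_seminorm_expVec p) (by norm_num)
  have hQ : (expVec n).real Q ≤ 1 / 8 := measureReal_mul_integral_lt_le
    (fun e => apply_nonneg q e) (integrable_seminorm_expVec q) (by norm_num)
  have hM : (expVec n).real M ≤ 1 / 8 := expVec_sum_max_sub_abs_le a
  set K : Set (Fin n → ℝ) := (P ∪ Q ∪ M)ᶜ with hK
  have hKm : MeasurableSet K := ((hPm.union hQm).union hMm).compl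
  have hKhalf : 1 / 2 ≤ (expVec n).real K := by
    rw [hK, probReal_compl_eq_one_sub ((hPm.union hQm).union hMm)]
    have h1 := measureReal_union_le (μ := expVec n) (P ∪ Q) M
    have h2 := measureReal_union_le (μ := expVec n) P Q
    linarith
  have hmem : ∀ y, y ∈ K ↔ (p y ≤ 8 * (∫ e, p e ∂expVec n) ∧ q y ≤ 8 * (∫ e, q e ∂expVec n)) ∧
      ∑ i, max (|a i| - |y i|) 0 ≤ 8 * l2 (Fin n) a ^ 2 := fun y => by
    simp [hK, P, Q, M]
  calc _ ≤ Real.exp (-(8 * l2 (Fin n) a ^ 2 + ∑ i, |b i|)) * (expVec n).real K := by gcongr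
    _ ≤ (expVec n).real {y | y - (a + b) ∈ K} := by
        refine exp_neg_mul_le_measureReal_translate (k := 2⁻¹) (φ := fun x => |x|)
          (by norm_num) (by fun_prop) abs_neg ?_ ?_ hKm (fun y hy => ?_) fun y hy => ?_
        · simp only [symExp, div_eq_inv_mul]
        · simpa only [div_eq_inv_mul] using integrable_exp_neg_abs_div_two
        · rw [hmem] at hy ⊢
          simpa only [map_neg_eq_map, Pi.neg_apply, abs_neg] using hy
        · have hterm : ∀ i, |y i + (a + b) i| + |y i - (a + b) i|
              ≤ 2 * (|y i| + max (|a i| - |y i|) 0 + |b i|) := fun i => by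
            rw [Pi.add_apply]
            rcases max_cases (|a i| - |y i|) 0 with h | h <;>
            rcases abs_cases (a i) with h1 | h1 <;> rcases abs_cases (y i) with h2 | h2 <;>
            rcases abs_cases (b i) with h3 | h3 <;>
            rcases abs_cases (y i + (a i + b i)) with h4 | h4 <;>
            rcases abs_cases (y i - (a i + b i)) with h5 | h5 <;> linarith
          refine (Finset.sum_le_sum fun i _ => hterm i).trans ?_
          rw [← Finset.mul_sum, Finset.sum_add_distrib, Finset.sum_add_distrib]
          linarith [((hmem y).1 hy).2]
    _ ≤ _ := measureReal_mono (ofPred_subset_ofPred.2 fun y hy => ((hmem _).1 hy).1)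

end Exponential

section Entropy

/-- The linear map `x ↦ (∑_{jk} a_{ijk} x_j t_k)ᵢ`. -/
def contract (A : Fin n → Fin n → Fin m → ℝ) (t : Fin m → ℝ) :
    (Fin n → ℝ) →ₗ[ℝ] (Fin n → ℝ) where
  toFun x i := ∑ j, ∑ k, A i j k * (x j * t k)
  map_add' x y := by
    ext i
    simp only [Pi.add_apply, add_mul, mul_add, Finset.sum_add_distrib]
  map_smul' c x := by
    ext i
    simp only [Pi.smul_apply, smul_eq_mul, RingHom.id_apply, Finset.mul_sum]
    exact Finset.sum_congr rfl fun j _ => Finset.sum_congr rfl fun k _ => by ring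

/-- The bilinear form `(g, x) ↦ ∑_{ijk} a_{ijk} gᵢ x_j t_k`. -/
def contractForm (A : Fin n → Fin n → Fin m → ℝ) (t : Fin m → ℝ) :
    (Fin n → ℝ) →ₗ[ℝ] (Fin n → ℝ) →ₗ[ℝ] ℝ :=
  LinearMap.mk₂ ℝ (fun g x => g ⬝ᵥ contract A t x)
    (fun g g' x => add_dotProduct g g' _) (fun c g x => smul_dotProduct c g _)
    (fun g x y => by rw [map_add, dotProduct_add])
    (fun c g x => by rw [map_smul, dotProduct_smul])

/-- The seminorm `x ↦ α_A(x ⊗ t)`. -/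
def alphaSeminorm (A : Fin n → Fin n → Fin m → ℝ) (t : Fin m → ℝ) : Seminorm ℝ (Fin n → ℝ) :=
  (l2 (Fin n)).comp (contract A t)

theorem alphaA_tens (A : Fin n → Fin n → Fin m → ℝ) (x : Fin n → ℝ) (t : Fin m → ℝ) :
    alphaA A (tens x t) = alphaSeminorm A t x :=
  (l2_apply _).symm

theorem dA_eq_l2 (A : Fin n → Fin n → Fin m → ℝ) (z w : (Fin n → ℝ) × (Fin m → ℝ)) :
    dA A z w = l2 (Fin n) (contract A z.2 z.1 - contract A w.2 w.1) := by
  rw [l2_apply]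
  simp only [dA, alphaA, tens, contract, LinearMap.coe_mk, AddHom.coe_mk, Pi.sub_apply, mul_sub,
    Finset.sum_sub_distrib]

variable {S : Set (Fin m → ℝ)}

/-- The seminorm `g ↦ sup_{s ∈ S} |∑_{ijk} a_{ijk} gᵢ x_j s_k|`. -/
def supContract (A : Fin n → Fin n → Fin m → ℝ) (hS : S.Finite) (x : Fin n → ℝ) :
    Seminorm ℝ (Fin n → ℝ) :=
  supSeminorm hS fun s => (contractForm A s).flip x

/-- The seminorm `β_{A,S}`. -/
def betaSeminorm (A : Fin n → Fin n → Fin m → ℝ) (hS : S.Finite) : Seminorm ℝ (Fin n → ℝ) :=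
  integralSeminorm (μ := gaussVec n) (p := fun g => supSeminorm hS fun s => contractForm A s g)
    fun x => integrable_seminorm_gaussVec (supContract A hS x)

theorem abs_dotProduct_contract_le (A : Fin n → Fin n → Fin m → ℝ) (hS : S.Finite)
    (x : Fin n → ℝ) {t : Fin m → ℝ} (ht : t ∈ S) (g : Fin n → ℝ) :
    |g ⬝ᵥ contract A t x| ≤ supContract A hS x g :=
  le_biSup_of_finite (f := fun s => |g ⬝ᵥ contract A s x|) hS ht

theorem betaSeminorm_eq_integral (A : Fin n → Fin n → Fin m → ℝ) (hS : S.Finite)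
    (x : Fin n → ℝ) : betaSeminorm A hS x = ∫ g, supContract A hS x g ∂gaussVec n := rfl

theorem betaA_eq_betaSeminorm (A : Fin n → Fin n → Fin m → ℝ) (hS : S.Finite) :
    betaA A S = betaSeminorm A hS := by
  ext x
  change _ = ∫ g, (⨆ s ∈ S, |g ⬝ᵥ contract A s x|) ∂gaussVec n
  have : ∀ (g : Fin n → ℝ) (s : Fin m → ℝ),
      ∑ i, ∑ j, ∑ k, A i j k * g i * x j * s k = g ⬝ᵥ contract A s x := fun g s => by
    simp only [dotProduct, contract, LinearMap.coe_mk, AddHom.coe_mk, Finset.mul_sum]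
    exact Finset.sum_congr rfl fun i _ => Finset.sum_congr rfl fun j _ =>
      Finset.sum_congr rfl fun k _ => by ring
  simp only [betaA, this]

theorem exists_decomposition_of_mem_UB {p : ℝ} {x : Fin n → ℝ} (hx : x ∈ UB n p) :
    ∃ a b : Fin n → ℝ, x = a + b ∧ l2 (Fin n) a ≤ 1 ∧ ∑ i, |b i| ≤ Real.sqrt p := by
  obtain ⟨a, ha, _, ⟨b, hb, rfl⟩, rfl⟩ := hx
  refine ⟨a, Real.sqrt p • b, rfl, (l2_apply a).trans_le ha, ?_⟩
  simp only [Pi.smul_apply, smul_eq_mul, abs_mul, abs_of_nonneg (Real.sqrt_nonneg p),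
    ← Finset.mul_sum]
  exact mul_le_of_le_one_right (Real.sqrt_nonneg p) hb

theorem abs_le_of_mem_UB {p : ℝ} {x : Fin n → ℝ} (hx : x ∈ UB n p) (i : Fin n) :
    |x i| ≤ 1 + Real.sqrt p := by
  obtain ⟨a, b, rfl, ha, hb⟩ := exists_decomposition_of_mem_UB hx
  have h1 : |a i| ≤ l2 (Fin n) a := by
    rw [l2_apply]
    exact Real.abs_le_sqrt (Finset.single_le_sum (f := fun i => a i ^ 2)
      (fun i _ => sq_nonneg _) (Finset.mem_univ i))
  have h2 : |b i| ≤ ∑ i, |b i| :=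
    Finset.single_le_sum (f := fun i => |b i|) (fun i _ => abs_nonneg _) (Finset.mem_univ i)
  exact (abs_add_le _ _).trans (by linarith)

theorem seminorm_le_biSup_of_subset_UB {p : ℝ} {U : Set (Fin n → ℝ)} (hU : U ⊆ UB n p)
    (q : Seminorm ℝ (Fin n → ℝ)) {x : Fin n → ℝ} (hx : x ∈ U) : q x ≤ ⨆ x ∈ U, q x :=
  le_biSup_of_forall_le (b := ∑ i, (1 + Real.sqrt p) * q (Pi.single i 1))
    (fun y hy => (seminorm_le_sum q y).trans (Finset.sum_le_sum fun i _ =>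
      mul_le_mul_of_nonneg_right (abs_le_of_mem_UB (hU hy) i) (apply_nonneg q _))) hx

/-- Bound for the cardinality of a `d_A`-separated subset of `U × S`. -/
theorem card_le_of_dA_separated (A : Fin n → Fin n → Fin m → ℝ) {p ε : ℝ} (hε : 0 < ε)
    {U : Set (Fin n → ℝ)} (hU : U ⊆ UB n p) (hS : S.Finite)
    {T : Finset ((Fin n → ℝ) × (Fin m → ℝ))} (hT : ↑T ⊆ U ×ˢ S)
    (hsep : ∀ z ∈ T, ∀ w ∈ T, z ≠ w →
      (ε ^ 2 * (∫ e, betaA A S e ∂expVec n) + ε * (⨆ x ∈ U, betaA A S x)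
        + ε * ⨆ t ∈ S, expAlpha A t) / 2 < dA A z w) :
    (T.card : ℝ) ≤ 2 * Real.exp (10784 / ε ^ 2 + 32 * Real.sqrt p / ε) := by
  rw [betaA_eq_betaSeminorm A hS] at hsep
  set β := betaSeminorm A hS
  set Eβ := ∫ e, β e ∂expVec n
  set bU := ⨆ x ∈ U, β x
  set aS := ⨆ t ∈ S, expAlpha A t
  have hEβ : 0 ≤ Eβ := integral_nonneg fun e => apply_nonneg β e
  set η : ℝ := ε / 32 with hη
  have hη0 : 0 < η := by positivity
  set G : (Fin n → ℝ) × (Fin m → ℝ) → Set (Fin n → ℝ) := fun z =>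
    {y | alphaSeminorm A z.2 (y - η⁻¹ • z.1) ≤ 8 * (∫ e, alphaSeminorm A z.2 e ∂expVec n) ∧
      β (y - η⁻¹ • z.1) ≤ 8 * Eβ}
  have hGm : ∀ z, MeasurableSet (G z) := fun z =>
    have hq : ∀ q : Seminorm ℝ (Fin n → ℝ), Measurable fun y => q (y - η⁻¹ • z.1) := fun q =>
      (continuous_seminorm q).measurable.comp (measurable_id.sub_const _)
    (measurableSet_le (hq _) measurable_const).inter (measurableSet_le (hq _) measurable_const)
  have hGmass : ∀ z ∈ T, Real.exp (-(8192 / ε ^ 2 + 32 * Real.sqrt p / ε)) * (1 / 2)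
      ≤ (expVec n).real (G z) := fun z hz => by
    obtain ⟨a, b, hab, ha, hb⟩ := exists_decomposition_of_mem_UB (hU (hT hz).1)
    have h1 := expVec_translate (alphaSeminorm A z.2) β (η⁻¹ • a) (η⁻¹ • b)
    rw [← smul_add, ← hab] at h1
    refine le_trans (mul_le_mul_of_nonneg_right (Real.exp_le_exp.2 (neg_le_neg ?_))
      (by norm_num)) h1
    have h2 : l2 (Fin n) (η⁻¹ • a) ^ 2 ≤ 1024 / ε ^ 2 := by
      rw [map_smul_eq_mul, Real.norm_of_nonneg (by positivity), mul_pow]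
      calc η⁻¹ ^ 2 * l2 (Fin n) a ^ 2 ≤ η⁻¹ ^ 2 * 1 ^ 2 := by
            gcongr
        _ = 1024 / ε ^ 2 := by rw [hη]; field_simp; norm_num
    have h3 : ∑ i, |(η⁻¹ • b) i| ≤ 32 * Real.sqrt p / ε := by
      simp only [Pi.smul_apply, smul_eq_mul, abs_mul, ← Finset.mul_sum]
      rw [abs_of_pos (by positivity)]
      calc η⁻¹ * ∑ i, |b i| ≤ η⁻¹ * Real.sqrt p := by gcongr
        _ = 32 * Real.sqrt p / ε := by rw [hη]; field_simp
    calc _ ≤ 8 * (1024 / ε ^ 2) + 32 * Real.sqrt p / ε := by gcongr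
      _ = _ := by ring
  have hcount : (T.card : ℝ) * (Real.exp (-(8192 / ε ^ 2 + 32 * Real.sqrt p / ε)) * (1 / 2))
      ≤ Real.exp (648 * (2 / ε) ^ 2) := by
    refine card_mul_le_of_forall_card_le (μ := expVec n) T (fun z _ => hGm z) hGmass
      fun e T' hT' he => ?_
    rcases T'.eq_empty_or_nonempty with rfl | ⟨z₀, hz₀⟩
    · simpa using (Real.exp_pos _).le
    set y := η • e
    have hscale : ∀ (q : Seminorm ℝ (Fin n → ℝ)) (x : Fin n → ℝ),
        q (y - x) = η * q (e - η⁻¹ • x) := fun q x => by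
      rw [← Real.norm_of_nonneg hη0.le, ← map_smul_eq_mul, Real.norm_of_nonneg hη0.le, smul_sub,
        smul_inv_smul₀ hη0.ne']
    have hα : ∀ z ∈ T', alphaSeminorm A z.2 (y - z.1) ≤ ε / 4 * aS := fun z hz => by
      have h1 : ∫ e, alphaSeminorm A z.2 e ∂expVec n ≤ aS :=
        le_biSup_of_finite (f := expAlpha A) hS (hT (hT' hz)).2 |>.trans' (by
          simp only [expAlpha, alphaA_tens]; exact le_rfl)
      rw [hscale]
      calc η * alphaSeminorm A z.2 (e - η⁻¹ • z.1) ≤ η * (8 * aS) := by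
            gcongr
            exact (he z hz).1.trans (by gcongr)
        _ = ε / 4 * aS := by rw [hη]; ring
    have hβ : β y ≤ bU + ε * Eβ := by
      have h1 : β z₀.1 ≤ bU := seminorm_le_biSup_of_subset_UB hU β (hT (hT' hz₀)).1
      have h2 : β (y - z₀.1) ≤ η * (8 * Eβ) := by
        rw [hscale]
        gcongr
        exact (he z₀ hz₀).2
      calc β y = β (z₀.1 + (y - z₀.1)) := by rw [add_sub_cancel]
        _ ≤ β z₀.1 + β (y - z₀.1) := map_add_le_add _ _ _
        _ ≤ bU + η * (8 * Eβ) := add_le_add h1 h2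
        _ ≤ bU + ε * Eβ := by rw [hη]; nlinarith
    refine card_le_exp_of_separated (v := fun z => contract A z.2 y) (W := supContract A hS y)
      (δ := ε / 2 * (bU + ε * Eβ)) (by positivity)
      (fun z hz => abs_dotProduct_contract_le A hS y (hT (hT' hz)).2) ?_ fun z hz w hw hzw => ?_
    · rw [← betaSeminorm_eq_integral]
      refine hβ.trans_eq ?_
      field_simp
    · have h1 := hsep z (hT' hz) w (hT' hw) hzw
      rw [dA_eq_l2] at h1
      have h2 : contract A z.2 z.1 - contract A w.2 w.1
          = (contract A z.2 y - contract A w.2 y)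
            + (contract A w.2 (y - w.1) - contract A z.2 (y - z.1)) := by
        rw [map_sub, map_sub]; abel
      have h3 : l2 (Fin n) (contract A z.2 z.1 - contract A w.2 w.1)
          ≤ l2 (Fin n) (contract A z.2 y - contract A w.2 y)
            + (alphaSeminorm A w.2 (y - w.1) + alphaSeminorm A z.2 (y - z.1)) := by
        rw [h2]
        exact (map_add_le_add _ _ _).trans (add_le_add le_rfl (map_sub_le_add (l2 (Fin n)) _ _))
      nlinarith [hα z hz, hα w hw]
  rw [Real.exp_neg] at hcount
  have hpos := Real.exp_pos (8192 / ε ^ 2 + 32 * Real.sqrt p / ε)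
  calc (T.card : ℝ)
      = T.card * ((Real.exp (8192 / ε ^ 2 + 32 * Real.sqrt p / ε))⁻¹ * (1 / 2))
          * (2 * Real.exp (8192 / ε ^ 2 + 32 * Real.sqrt p / ε)) := by field_simp
    _ ≤ Real.exp (648 * (2 / ε) ^ 2)
          * (2 * Real.exp (8192 / ε ^ 2 + 32 * Real.sqrt p / ε)) := by gcongr
    _ = 2 * Real.exp (10784 / ε ^ 2 + 32 * Real.sqrt p / ε) := by
        rw [mul_left_comm, ← Real.exp_add]
        congr 2
        ring

end Entropy

/-- entropy estimate. `N(U × S, d_A, r) ≤ 4·exp(Cε⁻² + C√p·ε⁻¹)` where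
`r = ε²·E β_{A,S}(Eₙ) + ε·sup_{x∈U} β_{A,S}(x) + ε·sup_{t∈S} E α_A(Eₙ ⊗ t)`; a covering
by closed balls of diameter `r` is witnessed by centers at `d_A`-distance at most `r/2`. -/
theorem statement_6 :
    ∃ C : ℝ, 0 < C ∧
      ∀ (n m : ℕ) (A : Fin n → Fin n → Fin m → ℝ) (p ε : ℝ), 0 < p → 0 < ε →
      ∀ U : Set (Fin n → ℝ), U ⊆ UB n p →
      ∀ S : Set (Fin m → ℝ), S.Finite → S.Nonempty →
      ∃ c : Finset ((Fin n → ℝ) × (Fin m → ℝ)),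
        (c.card : ℝ) ≤ 4 * Real.exp (C / ε ^ 2 + C * Real.sqrt p / ε) ∧
        ∀ z ∈ U ×ˢ S, ∃ w ∈ c, dA A z w ≤
          (ε ^ 2 * (∫ e, betaA A S e ∂expVec n) + ε * (⨆ x ∈ U, betaA A S x)
            + ε * ⨆ t ∈ S, expAlpha A t) / 2 := by
  refine ⟨10784, by norm_num, fun n m A p ε _ hε U hU S hS _ => ?_⟩
  have hcard : ∀ c : Finset ((Fin n → ℝ) × (Fin m → ℝ)), ↑c ⊆ U ×ˢ S →
      (∀ z ∈ c, ∀ w ∈ c, z ≠ w →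
        (ε ^ 2 * (∫ e, betaA A S e ∂expVec n) + ε * (⨆ x ∈ U, betaA A S x)
          + ε * ⨆ t ∈ S, expAlpha A t) / 2 < dA A z w) →
      (c.card : ℝ) ≤ 2 * Real.exp (10784 / ε ^ 2 + 32 * Real.sqrt p / ε) :=
    fun c hc => card_le_of_dA_separated A hε hU hS hc
  obtain ⟨c, hcV, hc, hnet⟩ := exists_separated_net (d := dA A)
    (fun z w => by rw [dA_eq_l2, dA_eq_l2, map_sub_rev]) (V := U ×ˢ S)
    (R := (ε ^ 2 * (∫ e, betaA A S e ∂expVec n) + ε * (⨆ x ∈ U, betaA A S x)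
      + ε * ⨆ t ∈ S, expAlpha A t) / 2)
    (fun z => by
      rw [dA_eq_l2, sub_self, map_zero, betaA_eq_betaSeminorm A hS]
      have h1 : 0 ≤ ∫ e, betaSeminorm A hS e ∂expVec n :=
        integral_nonneg fun e => apply_nonneg _ e
      have h2 : 0 ≤ ⨆ x ∈ U, betaSeminorm A hS x :=
        biSup_nonneg_of_nonneg fun x => apply_nonneg _ x
      have h3 : 0 ≤ ⨆ t ∈ S, expAlpha A t :=
        biSup_nonneg_of_nonneg fun t => integral_nonneg fun e => Real.sqrt_nonneg _
      positivity)
    (fun c hcV hc => Nat.le_floor (hcard c hcV hc))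
  refine ⟨c, (hcard c hcV hc).trans ?_, hnet⟩
  have hexp : Real.exp (10784 / ε ^ 2 + 32 * Real.sqrt p / ε)
      ≤ Real.exp (10784 / ε ^ 2 + 10784 * Real.sqrt p / ε) :=
    Real.exp_le_exp.2 (by gcongr; norm_num)
  linarith [Real.exp_pos (10784 / ε ^ 2 + 32 * Real.sqrt p / ε)]

end Stmt6
end
end

section
/- There is a universal constant C such that for every real array A = (a_{ijk})_{i,j≤n,k≤m}, every p ≥ 1, every finite nonempty T ⊆ ℝᵐ, and every W ⊆ (B₂ⁿ + √p·B₁ⁿ) × (T − T): F_A(W) ≤ C { p^{−1/2} s_A(T) + sup_{(x,t)∈W} β_{A,T}(x) + sup_{(x,t)∈W} E α_A(Eₙ ⊗ t) + √p · Δ_A(W) }. -/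
open MeasureTheory ProbabilityTheory Set
open scoped ENNReal BigOperators Pointwise

noncomputable section

namespace Stmt9

/-- the symmetric exponential distribution on `ℝ`, with density `e^{-|x|}/2`. -/
def symExp : Measure ℝ :=
  MeasureTheory.volume.withDensity fun x => ENNReal.ofReal (Real.exp (-|x|) / 2)

/-- the law of `Eₙ`, a vector of `n` i.i.d. symmetric exponential variables. -/
def expVec (n : ℕ) : Measure (Fin n → ℝ) := Measure.pi fun _ => symExp

/-- the law of a standard Gaussian vector in `ℝⁿ`. -/
def gaussVec (n : ℕ) : Measure (Fin n → ℝ) := Measure.pi fun _ => gaussianReal 0 1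

/-- the law of an `n × n` array of i.i.d. standard Gaussian variables. -/
def gaussMat (n : ℕ) : Measure (Fin n × Fin n → ℝ) := Measure.pi fun _ => gaussianReal 0 1

variable {n m : ℕ}

/-- `α_A(y) = √(∑ᵢ (∑_{jk} a_{ijk} y_{jk})²)` for `y ∈ ℝ^{n×m}`. -/
def alphaA (A : Fin n → Fin n → Fin m → ℝ) (y : Fin n → Fin m → ℝ) : ℝ :=
  Real.sqrt (∑ i, (∑ j, ∑ k, A i j k * y j k) ^ 2)

/-- `α_{∞,A}(y) = maxᵢ |∑_{jk} a_{ijk} y_{jk}|`. -/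
def alphaInf (A : Fin n → Fin n → Fin m → ℝ) (y : Fin n → Fin m → ℝ) : ℝ :=
  ⨆ i, |∑ j, ∑ k, A i j k * y j k|

/-- `x ⊗ t = (x_j t_k)_{jk}`. -/
def tens (x : Fin n → ℝ) (t : Fin m → ℝ) : Fin n → Fin m → ℝ := fun j k => x j * t k

/-- the distance `d_A((x,t),(x',t')) = α_A(x⊗t − x'⊗t')`. -/
def dA (A : Fin n → Fin n → Fin m → ℝ) (z w : (Fin n → ℝ) × (Fin m → ℝ)) : ℝ :=
  alphaA A (tens z.1 z.2 - tens w.1 w.2)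

/-- the distance `d_{∞,A}((x,t),(x',t')) = α_{∞,A}(x⊗t − x'⊗t')`. -/
def dInf (A : Fin n → Fin n → Fin m → ℝ) (z w : (Fin n → ℝ) × (Fin m → ℝ)) : ℝ :=
  alphaInf A (tens z.1 z.2 - tens w.1 w.2)

/-- the diameter of `V` in the metric `d_A`. -/
def diamA (A : Fin n → Fin n → Fin m → ℝ) (V : Set ((Fin n → ℝ) × (Fin m → ℝ))) : ℝ :=
  ⨆ z ∈ V, ⨆ w ∈ V, dA A z w

/-- the diameter of `V` in the metric `d_{∞,A}`. -/
def diamInf (A : Fin n → Fin n → Fin m → ℝ) (V : Set ((Fin n → ℝ) × (Fin m → ℝ))) : ℝ :=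
  ⨆ z ∈ V, ⨆ w ∈ V, dInf A z w

/-- `F_A(V) = E sup_{(x,t)∈V} ∑_{ijk} a_{ijk} gᵢ x_j t_k`. -/
def FA (A : Fin n → Fin n → Fin m → ℝ) (V : Set ((Fin n → ℝ) × (Fin m → ℝ))) : ℝ :=
  ∫ g, (⨆ z ∈ V, ∑ i, ∑ j, ∑ k, A i j k * g i * z.1 j * z.2 k) ∂gaussVec n

/-- `β_{A,T}(x) = E sup_{s∈T} |∑_{ijk} a_{ijk} gᵢ x_j s_k|`. -/
def betaA (A : Fin n → Fin n → Fin m → ℝ) (T : Set (Fin m → ℝ)) (x : Fin n → ℝ) : ℝ :=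
  ∫ g, (⨆ s ∈ T, |∑ i, ∑ j, ∑ k, A i j k * g i * x j * s k|) ∂gaussVec n

/-- `s_A(T) = E sup_{t∈T} |∑_{ijk} a_{ijk} g_{ij} t_k| + E sup_{t∈T} |∑_{ijk} a_{ijk} gᵢ ℰⱼ t_k|`. -/
def sA (A : Fin n → Fin n → Fin m → ℝ) (T : Set (Fin m → ℝ)) : ℝ :=
  (∫ G, (⨆ t ∈ T, |∑ i, ∑ j, ∑ k, A i j k * G (i, j) * t k|) ∂gaussMat n) +
  (∫ w, (⨆ t ∈ T, |∑ i, ∑ j, ∑ k, A i j k * w.1 i * w.2 j * t k|)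
      ∂((gaussVec n).prod (expVec n)))

/-- `E α_A(Eₙ ⊗ t)`. -/
def expAlpha (A : Fin n → Fin n → Fin m → ℝ) (t : Fin m → ℝ) : ℝ :=
  ∫ e, alphaA A (tens e t) ∂expVec n

/-- the closed Euclidean unit ball `B₂ⁿ`. -/
def B2 (n : ℕ) : Set (Fin n → ℝ) := {x | Real.sqrt (∑ i, x i ^ 2) ≤ 1}

/-- the closed `ℓ₁` unit ball `B₁ⁿ`. -/
def B1 (n : ℕ) : Set (Fin n → ℝ) := {x | ∑ i, |x i| ≤ 1}

/-- the Minkowski sum `B₂ⁿ + √p·B₁ⁿ`. -/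
def UB (n : ℕ) (p : ℝ) : Set (Fin n → ℝ) := B2 n + Real.sqrt p • B1 n

/-- `s_q(A) = (∑_k (∑_{ij} a_{ijk}²)^{q/2})^{1/q}`. -/
def sq (q : ℝ) (A : Fin n → Fin n → Fin m → ℝ) : ℝ :=
  (∑ k, (∑ i, ∑ j, A i j k ^ 2) ^ (q / 2)) ^ (1 / q)

/-- `φ_A(x) = (∑_k (∑ᵢ (∑ⱼ a_{ijk} x_j)⁴ / ∑ⱼ a_{ijk}²)^{q/2})^{1/(2q)}`. -/
def phiA (q : ℝ) (A : Fin n → Fin n → Fin m → ℝ) (x : Fin n → ℝ) : ℝ :=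
  (∑ k, (∑ i, (∑ j, A i j k * x j) ^ 4 / ∑ j, A i j k ^ 2) ^ (q / 2)) ^ (1 / (2 * q))

/-- `B_{q'} = {t ∈ ℝᵐ : ∑_k |t_k|^{q'} ≤ 1}`. -/
def Bconj (q' : ℝ) (m : ℕ) : Set (Fin m → ℝ) := {t | ∑ k, |t k| ^ q' ≤ 1}

theorem measurable_symExp_density :
    Measurable fun x : ℝ => ENNReal.ofReal (Real.exp (-|x|) / 2) := by
  fun_prop

theorem integral_symExp_density : ∫ x : ℝ, Real.exp (-|x|) / 2 = 1 := by
  rw [integral_comp_abs (f := fun x => Real.exp (-x) / 2), integral_div, integral_exp_neg_Ioi_zero]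
  norm_num

instance isProbabilityMeasure_symExp : IsProbabilityMeasure symExp := by
  constructor
  have hint : Integrable (fun x : ℝ => Real.exp (-|x|) / 2) :=
    Integrable.of_integral_ne_zero (by rw [integral_symExp_density]; norm_num)
  rw [symExp, withDensity_apply _ MeasurableSet.univ, Measure.restrict_univ,
    ← ofReal_integral_eq_lintegral_ofReal hint (ae_of_all _ fun x => by positivity),
    integral_symExp_density, ENNReal.ofReal_one]

instance isProbabilityMeasure_expVec (n : ℕ) : IsProbabilityMeasure (expVec n) := by
  unfold expVec; infer_instance

instance isProbabilityMeasure_gaussVec (n : ℕ) : IsProbabilityMeasure (gaussVec n) := by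
  unfold gaussVec; infer_instance

theorem integrable_abs_symExp : Integrable (fun x : ℝ => |x|) symExp := by
  rw [symExp, integrable_withDensity_iff_integrable_smul' measurable_symExp_density
    (ae_of_all _ fun x => ENNReal.ofReal_lt_top)]
  have h : ∫ x : ℝ, Real.exp (-|x|) / 2 * |x| = 1 := by
    rw [integral_comp_abs (f := fun x => Real.exp (-x) / 2 * x)]
    have h2 := Real.Gamma_eq_integral (s := 2) (by norm_num)
    rw [Real.Gamma_two] at h2
    rw [← integral_const_mul, h2]
    refine setIntegral_congr_fun measurableSet_Ioi fun x hx => ?_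
    norm_num
    ring
  have := Integrable.of_integral_ne_zero (h.trans_ne one_ne_zero)
  refine this.congr (ae_of_all _ fun x => ?_)
  simp only [smul_eq_mul]
  rw [ENNReal.toReal_ofReal (by positivity)]

theorem measurePreserving_neg_symExp : MeasurePreserving (fun x : ℝ => -x) symExp symExp := by
  refine ⟨measurable_neg, ?_⟩
  ext s hs
  rw [Measure.map_apply measurable_neg hs, symExp, withDensity_apply _ (measurable_neg hs),
    withDensity_apply _ hs, ← (Measure.measurePreserving_neg (volume : Measure ℝ)).setLIntegral_comp_preimage
      hs measurable_symExp_density]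
  simp only [abs_neg]

theorem integral_max_abs_sub_le (a : ℝ) : ∫ y, max (|a| - |y|) 0 ∂symExp ≤ a ^ 2 := by
  have hsub : symExp (Icc (-|a|) |a|) ≤ ENNReal.ofReal |a| := by
    rw [symExp, withDensity_apply _ measurableSet_Icc]
    calc ∫⁻ x in Icc (-|a|) |a|, ENNReal.ofReal (Real.exp (-|x|) / 2)
        ≤ ∫⁻ x in Icc (-|a|) |a|, ENNReal.ofReal (1 / 2) := by
          refine lintegral_mono fun x => ENNReal.ofReal_le_ofReal ?_
          have : Real.exp (-|x|) ≤ 1 := Real.exp_le_one_iff.2 (by simp)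
          linarith
      _ = ENNReal.ofReal |a| := by
          rw [setLIntegral_const, Real.volume_Icc, ← ENNReal.ofReal_mul (by norm_num)]
          congr 1; ring
  calc ∫ y, max (|a| - |y|) 0 ∂symExp
      ≤ ∫ y, (Icc (-|a|) |a|).indicator (fun _ => |a|) y ∂symExp := by
        refine integral_mono_of_nonneg (ae_of_all _ fun y => le_max_right _ _)
          ((integrable_const _).indicator measurableSet_Icc) (ae_of_all _ fun y => ?_)
        by_cases hy : y ∈ Icc (-|a|) |a|
        · simp only [indicator_of_mem hy]
          exact max_le (by linarith [abs_nonneg y]) (abs_nonneg a)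
        · simp only [indicator_of_notMem hy]
          rw [mem_Icc, ← abs_le, not_le] at hy
          exact max_le (by linarith) le_rfl
    _ = symExp.real (Icc (-|a|) |a|) * |a| := by
        rw [integral_indicator_const _ measurableSet_Icc, smul_eq_mul]
    _ ≤ |a| * |a| := by
        gcongr
        exact ENNReal.toReal_le_of_le_ofReal (abs_nonneg a) hsub
    _ = a ^ 2 := by rw [abs_mul_abs_self, pow_two]

theorem map_add_withDensity_symExp (d : ℝ) :
    (symExp.withDensity fun y => ENNReal.ofReal (Real.exp (-(|y + d| - |y|)))).map (· + d)
      = symExp := by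
  have hm : Measurable fun y : ℝ => ENNReal.ofReal (Real.exp (-(|y + d| - |y|))) := by fun_prop
  ext s hs
  have hs' : MeasurableSet ((· + d) ⁻¹' s) := measurable_add_const d hs
  rw [Measure.map_apply (measurable_add_const d) hs, symExp,
    ← withDensity_mul _ measurable_symExp_density hm, withDensity_apply _ hs',
    withDensity_apply _ hs,
    ← (measurePreserving_add_right (volume : Measure ℝ) d).setLIntegral_comp_preimage
      hs measurable_symExp_density]
  refine lintegral_congr fun y => ?_
  simp only [Pi.mul_apply]
  rw [← ENNReal.ofReal_mul (by positivity)]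
  congr 1
  rw [div_mul_eq_mul_div, ← Real.exp_add]
  ring_nf

theorem pi_withDensity {ι : Type*} [Fintype ι] {α : ι → Type*} [∀ i, MeasurableSpace (α i)]
    (μ : ∀ i, Measure (α i)) [∀ i, IsProbabilityMeasure (μ i)] {f : ∀ i, α i → ℝ≥0∞}
    (hf : ∀ i, Measurable (f i)) [∀ i, SigmaFinite ((μ i).withDensity (f i))] :
    Measure.pi (fun i => (μ i).withDensity (f i))
      = (Measure.pi μ).withDensity fun x => ∏ i, f i (x i) := by
  refine Measure.pi_eq fun s hs => ?_
  have hind := iIndepFun_pi (μ := μ) (X := fun i => (s i).indicator (f i))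
    fun i => ((hf i).indicator (hs i)).aemeasurable
  have h := lintegral_prod_eq_prod_lintegral_of_indepFun Finset.univ _ hind
    fun i => ((hf i).indicator (hs i)).comp (measurable_pi_apply i)
  rw [withDensity_apply _ (MeasurableSet.univ_pi hs), ← lintegral_indicator (MeasurableSet.univ_pi hs)]
  convert h using 1
  · refine lintegral_congr fun x => ?_
    by_cases hx : x ∈ univ.pi s
    · rw [indicator_of_mem hx]
      exact Finset.prod_congr rfl fun i _ => (indicator_of_mem (hx i (mem_univ i)) _).symm
    · rw [indicator_of_notMem hx]
      simp only [mem_pi, mem_univ, true_implies, not_forall] at hx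
      obtain ⟨i, hi⟩ := hx
      exact (Finset.prod_eq_zero (Finset.mem_univ i) (indicator_of_notMem hi _)).symm
  · refine Finset.prod_congr rfl fun i _ => ?_
    rw [withDensity_apply _ (hs i), ← lintegral_indicator (hs i)]
    exact ((measurePreserving_eval μ i).lintegral_comp ((hf i).indicator (hs i))).symm

/-- A translate of `Eₙ` reweighted by the density ratio has the law of `Eₙ`. -/
theorem lintegral_expVec_shift {n : ℕ} (d : Fin n → ℝ) {F : (Fin n → ℝ) → ℝ≥0∞}
    (hF : Measurable F) :
    ∫⁻ y, ENNReal.ofReal (Real.exp (-∑ j, (|y j + d j| - |y j|))) * F (y + d) ∂expVec n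
      = ∫⁻ y, F y ∂expVec n := by
  set f : Fin n → ℝ → ℝ≥0∞ := fun j y => ENNReal.ofReal (Real.exp (-(|y + d j| - |y|)))
  have hf : ∀ j, Measurable (f j) := fun j => by simp only [f]; fun_prop
  have hmap : ∀ j, MeasurePreserving (· + d j) (symExp.withDensity (f j)) symExp :=
    fun j => ⟨measurable_add_const _, map_add_withDensity_symExp (d j)⟩
  have hpi := measurePreserving_pi (fun j => symExp.withDensity (f j)) (fun _ => symExp) hmap
  have : ∀ j, IsProbabilityMeasure (symExp.withDensity (f j)) := fun j =>
    ⟨by rw [← preimage_univ (f := (· + d j)), (hmap j).measure_preimage nullMeasurableSet_univ,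
      measure_univ]⟩
  rw [pi_withDensity (fun _ => symExp) hf] at hpi
  have hprod : Measurable fun y : Fin n → ℝ => ∏ j, f j (y j) :=
    Finset.measurable_prod _ fun j _ => (hf j).comp (measurable_pi_apply j)
  rw [expVec, ← hpi.lintegral_comp hF]
  refine Eq.trans ?_
    (lintegral_withDensity_eq_lintegral_mul _ hprod (hF.comp hpi.measurable)).symm
  refine lintegral_congr fun y => ?_
  simp only [Pi.mul_apply, f]
  rw [← ENNReal.ofReal_prod_of_nonneg fun j _ => (Real.exp_pos _).le, ← Real.exp_sum,
    Finset.sum_neg_distrib]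
  rfl

theorem measurePreserving_neg_expVec (n : ℕ) :
    MeasurePreserving (fun y : Fin n → ℝ => -y) (expVec n) (expVec n) :=
  measurePreserving_pi (fun _ => symExp) (fun _ => symExp) fun _ => measurePreserving_neg_symExp

theorem setIntegral_comp_neg_expVec {n : ℕ} {D : Set (Fin n → ℝ)} (hD : -D = D)
    (f : (Fin n → ℝ) → ℝ) :
    ∫ y in D, f (-y) ∂expVec n = ∫ y in D, f y ∂expVec n := by
  have h := (measurePreserving_neg_expVec n).setIntegral_preimage_emb
    (MeasurableEquiv.neg (Fin n → ℝ)).measurableEmbedding f D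
  rwa [show (fun y : Fin n → ℝ => -y) ⁻¹' D = D from hD] at h

theorem integrable_abs_eval_expVec {n : ℕ} (j : Fin n) :
    Integrable (fun y : Fin n → ℝ => |y j|) (expVec n) :=
  integrable_comp_eval (μ := fun _ : Fin n => symExp) integrable_abs_symExp

theorem integrable_eval_expVec {n : ℕ} (j : Fin n) :
    Integrable (fun y : Fin n → ℝ => y j) (expVec n) :=
  (integrable_abs_eval_expVec j).mono (measurable_pi_apply j).aestronglyMeasurable (ae_of_all _ fun y => by simp)

theorem integrable_abs_add_sub_abs_expVec {n : ℕ} (d : Fin n → ℝ) :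
    Integrable (fun y : Fin n → ℝ => ∑ j, (|y j + d j| - |y j|)) (expVec n) :=
  integrable_finsetSum _ fun j _ =>
    (((integrable_eval_expVec j).add (integrable_const _)).abs).sub (integrable_abs_eval_expVec j)

theorem abs_add_sub_abs_symm_le (y a : ℝ) :
    ((|y + a| - |y|) + (|-y + a| - |-y|)) / 2 ≤ max (|a| - |y|) 0 := by
  rcases abs_cases (y + a) with h1 | h1 <;> rcases abs_cases (-y + a) with h2 | h2 <;>
  rcases abs_cases y with h3 | h3 <;> rcases abs_cases a with h4 | h4 <;>
  rcases max_cases (|a| - |y|) 0 with h5 | h5 <;> rw [abs_neg] <;> linarith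

/-- Integrated over a symmetric set, the logarithm of the density ratio of a translate by `d`
is at most `∑ⱼ dⱼ²`. -/
theorem setIntegral_abs_add_sub_abs_le_sum_sq {n : ℕ} (d : Fin n → ℝ) {D : Set (Fin n → ℝ)}
    (hD : -D = D) :
    ∫ y in D, ∑ j, (|y j + d j| - |y j|) ∂expVec n ≤ ∑ j, d j ^ 2 := by
  set L : (Fin n → ℝ) → ℝ := fun y => ∑ j, (|y j + d j| - |y j|)
  have hL : Integrable L (expVec n) := integrable_abs_add_sub_abs_expVec d
  have hL' : Integrable (fun y => L (-y)) (expVec n) :=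
    (measurePreserving_neg_expVec n).integrable_comp_of_integrable hL
  have hmax : ∀ j, Integrable (fun y : Fin n → ℝ => max (|d j| - |y j|) 0) (expVec n) := fun j =>
    ((integrable_const _).sub (integrable_abs_eval_expVec j)).pos_part
  calc ∫ y in D, L y ∂expVec n = ∫ y in D, (L y + L (-y)) / 2 ∂expVec n := by
        rw [integral_div, integral_add hL.integrableOn hL'.integrableOn,
          setIntegral_comp_neg_expVec hD]
        ring
    _ ≤ ∫ y in D, ∑ j, max (|d j| - |y j|) 0 ∂expVec n := by
        refine integral_mono ((hL.add hL').div_const 2).integrableOn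
          (integrable_finsetSum _ fun j _ => hmax j).integrableOn fun y => ?_
        simp only [L, ← Finset.sum_add_distrib, Finset.sum_div]
        exact Finset.sum_le_sum fun j _ => abs_add_sub_abs_symm_le (y j) (d j)
    _ ≤ ∫ y, ∑ j, max (|d j| - |y j|) 0 ∂expVec n :=
        setIntegral_le_integral (integrable_finsetSum _ fun j _ => hmax j)
          (ae_of_all _ fun y => Finset.sum_nonneg fun j _ => le_max_right _ _)
    _ = ∑ j, ∫ y, max (|d j| - |y|) 0 ∂symExp := by
        rw [integral_finsetSum _ fun j _ => hmax j]
        refine Finset.sum_congr rfl fun j _ => ?_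
        exact integral_comp_eval (μ := fun _ : Fin n => symExp)
          (f := fun y : ℝ => max (|d j| - |y|) 0) (by fun_prop)
    _ ≤ ∑ j, d j ^ 2 := Finset.sum_le_sum fun j _ => integral_max_abs_sub_le (d j)

/-- The same bound for a translate by `a + b`, with the `ℓ₁` norm of `b`. -/
theorem setIntegral_abs_add_sub_abs_le {n : ℕ} (a b : Fin n → ℝ) {D : Set (Fin n → ℝ)}
    (hD : -D = D) :
    ∫ y in D, ∑ j, (|y j + (a + b) j| - |y j|) ∂expVec n ≤ ∑ j, a j ^ 2 + ∑ j, |b j| := by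
  calc ∫ y in D, ∑ j, (|y j + (a + b) j| - |y j|) ∂expVec n
      ≤ ∫ y in D, (∑ j, (|y j + a j| - |y j|) + ∑ j, |b j|) ∂expVec n := by
        refine integral_mono (integrable_abs_add_sub_abs_expVec _).integrableOn
          ((integrable_abs_add_sub_abs_expVec a).add (integrable_const _)).integrableOn fun y => ?_
        simp only [← Finset.sum_add_distrib]
        refine Finset.sum_le_sum fun j _ => ?_
        have := abs_add_le (y j + a j) (b j)
        rw [Pi.add_apply, ← add_assoc]
        linarith
    _ = ∫ y in D, ∑ j, (|y j + a j| - |y j|) ∂expVec n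
          + (expVec n).real D * ∑ j, |b j| := by
        rw [integral_add (integrable_abs_add_sub_abs_expVec a).integrableOn
          (integrable_const _), setIntegral_const, smul_eq_mul]
    _ ≤ ∑ j, a j ^ 2 + 1 * ∑ j, |b j| := by
        gcongr
        · exact setIntegral_abs_add_sub_abs_le_sum_sq a hD
        · exact measureReal_le_one
    _ = _ := by rw [one_mul]

instance isGaussian_gaussVec (n : ℕ) : IsGaussian (gaussVec n) := by
  have h : gaussVec n = (stdGaussian (EuclideanSpace ℝ (Fin n))).map
      (PiLp.continuousLinearEquiv 2 ℝ fun _ : Fin n => ℝ).toContinuousLinearMap := by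
    rw [← map_pi_eq_stdGaussian, Measure.map_map (by fun_prop) (by fun_prop)]
    exact Measure.map_id.symm
  rw [h]
  infer_instance

theorem integrable_eval_gaussVec {n : ℕ} (i : Fin n) :
    Integrable (fun g : Fin n → ℝ => g i) (gaussVec n) :=
  integrable_eval (μ := fun _ : Fin n => gaussianReal 0 1)
    ((memLp_id_gaussianReal 1).integrable le_rfl)

theorem integral_eval_gaussVec {n : ℕ} (i : Fin n) : ∫ g, g i ∂gaussVec n = 0 := by
  rw [gaussVec, integral_eval (μ := fun _ : Fin n => gaussianReal 0 1), integral_id_gaussianReal]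

theorem integrable_dotProduct_gaussVec {n : ℕ} (b : Fin n → ℝ) :
    Integrable (fun g => b ⬝ᵥ g) (gaussVec n) :=
  integrable_finsetSum _ fun i _ => (integrable_eval_gaussVec i).const_mul _

theorem integral_dotProduct_gaussVec {n : ℕ} (b : Fin n → ℝ) :
    ∫ g, b ⬝ᵥ g ∂gaussVec n = 0 := by
  simp only [dotProduct]
  rw [integral_finsetSum _ fun i _ => (integrable_eval_gaussVec i).const_mul _]
  simp [integral_const_mul, integral_eval_gaussVec]

theorem integral_id_gaussVec (n : ℕ) : ∫ g, id g ∂gaussVec n = 0 := by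
  ext i
  simp only [id]
  rw [eval_integral fun i => integrable_eval_gaussVec i]
  exact integral_eval_gaussVec i

theorem measurePreserving_rotation_gaussVec (n : ℕ) (θ : ℝ) :
    MeasurePreserving (ContinuousLinearMap.rotation θ : (Fin n → ℝ) × (Fin n → ℝ) →L[ℝ] _)
      ((gaussVec n).prod (gaussVec n)) ((gaussVec n).prod (gaussVec n)) :=
  ⟨by fun_prop, IsGaussian.map_rotation_eq_self (integral_id_gaussVec n) θ⟩

theorem lintegral_exp_dotProduct_gaussVec {n : ℕ} (b : Fin n → ℝ) :
    ∫⁻ g, ENNReal.ofReal (Real.exp (b ⬝ᵥ g)) ∂gaussVec n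
      = ENNReal.ofReal (Real.exp ((∑ i, b i ^ 2) / 2)) := by
  have hint : Integrable (fun g : Fin n → ℝ => ∏ i, Real.exp (b i * g i)) (gaussVec n) :=
    Integrable.fintype_prod (f := fun i x => Real.exp (b i * x))
      fun i => integrable_exp_mul_gaussianReal (b i)
  have hexp : ∀ g : Fin n → ℝ, Real.exp (b ⬝ᵥ g) = ∏ i, Real.exp (b i * g i) := fun g => by
    rw [← Real.exp_sum]; rfl
  simp only [hexp]
  rw [← ofReal_integral_eq_lintegral_ofReal hint
    (ae_of_all _ fun g => Finset.prod_nonneg fun i _ => (Real.exp_pos _).le)]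
  congr 1
  rw [gaussVec, integral_fintype_prod_eq_prod (fun i x => Real.exp (b i * x)), Finset.sum_div,
    Real.exp_sum]
  refine Finset.prod_congr rfl fun i _ => ?_
  have := congrFun (mgf_id_gaussianReal (μ := 0) (v := 1)) (b i)
  simpa [mgf] using this

theorem integrable_exp_dotProduct_gaussVec {n : ℕ} (b : Fin n → ℝ) :
    Integrable (fun g => Real.exp (b ⬝ᵥ g)) (gaussVec n) := by
  have hm : Measurable fun g : Fin n → ℝ => Real.exp (b ⬝ᵥ g) := by
    simp only [dotProduct]; fun_prop
  refine ⟨hm.aestronglyMeasurable, ?_⟩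
  rw [hasFiniteIntegral_iff_ofReal (ae_of_all _ fun g => (Real.exp_pos _).le),
    lintegral_exp_dotProduct_gaussVec]
  exact ENNReal.ofReal_lt_top

/-- A finite family of linear functionals has a measurable selection of a maximizer. -/
theorem exists_measurable_argmax {n : ℕ} (S : Finset (Fin n → ℝ)) (hS : S.Nonempty) :
    ∃ B : (Fin n → ℝ) → Fin n → ℝ, Measurable B ∧ (∀ g, B g ∈ S) ∧
      ∀ g, ∀ b ∈ S, b ⬝ᵥ g ≤ B g ⬝ᵥ g := by
  classical
  induction hS using Finset.Nonempty.cons_induction with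
  | singleton a => exact ⟨fun _ => a, measurable_const, by simp, by simp⟩
  | cons a S ha hS ih =>
    obtain ⟨B, hB, hBS, hmax⟩ := ih
    have hset : MeasurableSet {g : Fin n → ℝ | B g ⬝ᵥ g ≤ a ⬝ᵥ g} :=
      measurableSet_le (Finset.measurable_sum _ fun i _ => by fun_prop)
        (Finset.measurable_sum _ fun i _ => by fun_prop)
    refine ⟨fun g => if B g ⬝ᵥ g ≤ a ⬝ᵥ g then a else B g,
      Measurable.ite hset measurable_const hB, fun g => ?_, fun g b hb => ?_⟩
    · dsimp only
      split_ifs <;> simp [hBS g]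
    · dsimp only
      rw [Finset.mem_cons] at hb
      split_ifs with h
      · rcases hb with rfl | hb
        · exact le_rfl
        · exact (hmax g b hb).trans h
      · rcases hb with rfl | hb
        · exact (not_le.1 h).le
        · exact hmax g b hb

theorem exp_mul_le_of_mem_Icc {θ : ℝ} (h0 : 0 ≤ θ) (h1 : θ ≤ 1) (w : ℝ) :
    Real.exp (θ * w) ≤ θ * Real.exp w + (1 - θ) := by
  have := convexOn_exp.2 (mem_univ w) (mem_univ 0) h0 (sub_nonneg.2 h1) (by ring)
  simpa using this

/-- Jensen's inequality for powers, in exponential form. -/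
theorem lintegral_exp_mul_le {Ω : Type*} [MeasurableSpace Ω] {γ : Measure Ω}
    [IsProbabilityMeasure γ] {f : Ω → ℝ} (hexp : Integrable (fun g => Real.exp (f g)) γ)
    {θ : ℝ} (h0 : 0 ≤ θ) (h1 : θ ≤ 1) :
    ∫⁻ g, ENNReal.ofReal (Real.exp (θ * f g)) ∂γ
      ≤ ENNReal.ofReal (Real.exp (θ * Real.log (∫ g, Real.exp (f g) ∂γ))) := by
  set Z : ℝ := ∫ g, Real.exp (f g) ∂γ
  have hZ : 0 < Z := integral_exp_pos hexp
  set l : ℝ := Real.log Z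
  have hl : Real.exp l = Z := Real.exp_log hZ
  have hi' : Integrable (fun g => θ * Real.exp (f g - l)) γ := by
    simp only [Real.exp_sub]
    exact (hexp.div_const _).const_mul _
  have hi : Integrable (fun g => (θ * Real.exp (f g - l) + (1 - θ)) * Real.exp (θ * l)) γ :=
    (hi'.add (integrable_const _)).mul_const _
  calc ∫⁻ g, ENNReal.ofReal (Real.exp (θ * f g)) ∂γ
      ≤ ∫⁻ g, ENNReal.ofReal ((θ * Real.exp (f g - l) + (1 - θ)) * Real.exp (θ * l)) ∂γ := by
        refine lintegral_mono fun g => ENNReal.ofReal_le_ofReal ?_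
        rw [show θ * f g = θ * (f g - l) + θ * l by ring, Real.exp_add]
        gcongr
        exact exp_mul_le_of_mem_Icc h0 h1 _
    _ = ENNReal.ofReal (Real.exp (θ * l)) := by
        rw [← ofReal_integral_eq_lintegral_ofReal hi (ae_of_all _ fun g => ?_)]
        · congr 1
          rw [integral_mul_const, integral_add hi' (integrable_const _), integral_const_mul,
            integral_const]
          simp only [Real.exp_sub, integral_div, hl, probReal_univ, one_smul]
          rw [div_self hZ.ne']
          ring
        · have h3 : 0 ≤ 1 - θ := sub_nonneg.2 h1
          positivity

theorem exp_neg_integral_le {Ω : Type*} [MeasurableSpace Ω] {γ : Measure Ω}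
    [IsProbabilityMeasure γ] {f : Ω → ℝ} (hf : Integrable f γ)
    (hexp : Integrable (fun g => Real.exp (-f g)) γ) :
    Real.exp (-∫ g, f g ∂γ) ≤ ∫ g, Real.exp (-f g) ∂γ := by
  set m := ∫ g, f g ∂γ with hm
  have hs : Integrable (fun g => m - f g) γ := (integrable_const _).sub hf
  have hi : Integrable (fun g => m - f g + 1) γ := hs.add (integrable_const _)
  calc Real.exp (-m) = ∫ g, Real.exp (-m) * (m - f g + 1) ∂γ := by
        rw [integral_const_mul, integral_add hs (integrable_const _),
          integral_sub (integrable_const _) hf, ← hm]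
        simp
    _ ≤ ∫ g, Real.exp (-f g) ∂γ := by
        refine integral_mono (hi.const_mul _) hexp fun g => ?_
        rw [show -f g = -m + (m - f g) by ring, Real.exp_add]
        exact mul_le_mul_of_nonneg_left (Real.add_one_le_exp _) (Real.exp_pos _).le

theorem lintegral_lintegral_exp_add_dotProduct_le {n : ℕ} {S : Finset (Fin n → ℝ)} {R : ℝ}
    (hR : ∀ b ∈ S, ∑ i, b i ^ 2 ≤ R) {B : (Fin n → ℝ) → Fin n → ℝ} (hBS : ∀ g, B g ∈ S)
    {f : (Fin n → ℝ) → ℝ} {t : ℝ} (ht : t ^ 2 = 2) :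
    ∫⁻ u, ∫⁻ v, ENNReal.ofReal (Real.exp (f u + t * (B u ⬝ᵥ v))) ∂gaussVec n ∂gaussVec n
      ≤ (∫⁻ u, ENNReal.ofReal (Real.exp (f u)) ∂gaussVec n) * ENNReal.ofReal (Real.exp R) := by
  rw [← lintegral_mul_const' _ _ ENNReal.ofReal_ne_top]
  refine lintegral_mono fun u => ?_
  simp only [Real.exp_add, ENNReal.ofReal_mul (Real.exp_pos _).le]
  rw [lintegral_const_mul' _ _ ENNReal.ofReal_ne_top]
  gcongr
  simp only [← smul_eq_mul, ← smul_dotProduct]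
  rw [lintegral_exp_dotProduct_gaussVec]
  refine ENNReal.ofReal_le_ofReal (Real.exp_le_exp.2 ?_)
  simp only [Pi.smul_apply, smul_eq_mul, mul_pow, ht, ← Finset.mul_sum]
  linarith [hR _ (hBS u)]

theorem lintegral_le_of_le_half_add {Ω : Type*} [MeasurableSpace Ω] {μ : Measure Ω}
    {F G H : Ω → ℝ≥0∞} {K : ℝ≥0∞} (hG : Measurable G) (h : ∀ w, F w ≤ 2⁻¹ * (G w + H w))
    (hGK : ∫⁻ w, G w ∂μ ≤ K) (hHK : ∫⁻ w, H w ∂μ ≤ K) : ∫⁻ w, F w ∂μ ≤ K :=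
  calc ∫⁻ w, F w ∂μ ≤ ∫⁻ w, 2⁻¹ * (G w + H w) ∂μ := lintegral_mono h
    _ = 2⁻¹ * (∫⁻ w, G w ∂μ + ∫⁻ w, H w ∂μ) := by
      rw [lintegral_const_mul' _ _ (by simp), lintegral_add_left hG]
    _ ≤ 2⁻¹ * (K + K) := by gcongr
    _ = K := by
      rw [← two_mul, ← mul_assoc, ENNReal.inv_mul_cancel two_ne_zero ENNReal.ofNat_ne_top, one_mul]

/-- A Gaussian vector has exponential moments of a supremum of linear functionals controlled by the
mean of the supremum and the weak variance. -/
theorem integral_exp_argmax_le {n : ℕ} {S : Finset (Fin n → ℝ)} {R : ℝ}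
    (hR : ∀ b ∈ S, ∑ i, b i ^ 2 ≤ R) {B : (Fin n → ℝ) → Fin n → ℝ} (hB : Measurable B)
    (hBS : ∀ g, B g ∈ S) (hmax : ∀ g, ∀ b ∈ S, b ⬝ᵥ g ≤ B g ⬝ᵥ g) :
    Integrable (fun g => Real.exp (B g ⬝ᵥ g)) (gaussVec n) ∧
    Integrable (fun g => B g ⬝ᵥ g) (gaussVec n) ∧
    ∫ g, Real.exp (B g ⬝ᵥ g) ∂gaussVec n
      ≤ Real.exp ((√2 + 1) * (∫ g, B g ⬝ᵥ g ∂gaussVec n + R)) := by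
  set γ := gaussVec n
  set f : (Fin n → ℝ) → ℝ := fun g => B g ⬝ᵥ g
  have hfm : Measurable f := by simp only [f, dotProduct]; fun_prop
  have hexp : Integrable (fun g => Real.exp (f g)) γ := by
    refine (integrable_finsetSum S fun b _ => integrable_exp_dotProduct_gaussVec b).mono
      (by fun_prop) (ae_of_all _ fun g => ?_)
    rw [Real.norm_of_nonneg (Real.exp_pos _).le,
      Real.norm_of_nonneg (Finset.sum_nonneg fun b _ => (Real.exp_pos _).le)]
    exact Finset.single_le_sum (f := fun b => Real.exp (b ⬝ᵥ g))
      (fun b _ => (Real.exp_pos _).le) (hBS g)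
  have hint : Integrable f γ := by
    refine (integrable_finsetSum S fun b _ => (integrable_dotProduct_gaussVec b).abs).mono
      (by fun_prop) (ae_of_all _ fun g => ?_)
    rw [Real.norm_of_nonneg (Finset.sum_nonneg fun b _ => abs_nonneg _)]
    exact Finset.single_le_sum (f := fun b => |b ⬝ᵥ g|) (fun b _ => abs_nonneg _) (hBS g)
  refine ⟨hexp, hint, ?_⟩
  have h2 : √2 ^ 2 = 2 := Real.sq_sqrt (by norm_num)
  have h2' : 1 ≤ √2 := Real.one_le_sqrt.2 (by norm_num)
  have h2'' : √2 ≤ 2 := by nlinarith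
  set c : ℝ := √2 / 2
  set θ : ℝ := 2 - √2
  set Z : ℝ := ∫ g, Real.exp (f g) ∂γ
  have hZ : 0 < Z := integral_exp_pos hexp
  set l : ℝ := Real.log Z
  have hl : Real.exp l = Z := Real.exp_log hZ
  have hθ : ∫⁻ g, ENNReal.ofReal (Real.exp (θ * f g)) ∂γ ≤ ENNReal.ofReal (Real.exp (θ * l)) :=
    lintegral_exp_mul_le hexp (by simp only [θ]; linarith) (by simp only [θ]; linarith)
  have hΨ : ∀ t : ℝ, t ^ 2 = 2 →
      ∫⁻ u, ∫⁻ v, ENNReal.ofReal (Real.exp (θ * f u + t * (B u ⬝ᵥ v))) ∂γ ∂γ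
        ≤ ENNReal.ofReal (Real.exp (θ * l + R)) := fun t ht =>
    (lintegral_lintegral_exp_add_dotProduct_le hR hBS ht).trans (by
      rw [Real.exp_add, ENNReal.ofReal_mul (Real.exp_pos _).le]
      gcongr)
  have hΨm : ∀ t : ℝ, Measurable fun w : (Fin n → ℝ) × (Fin n → ℝ) =>
      ENNReal.ofReal (Real.exp (θ * f w.1 + t * (B w.1 ⬝ᵥ w.2))) := by
    intro t
    simp only [dotProduct]
    fun_prop
  have hpt : ∀ g g' : Fin n → ℝ, ENNReal.ofReal (Real.exp (-f g)) * ENNReal.ofReal (Real.exp (f g'))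
      ≤ 2⁻¹ * (ENNReal.ofReal (Real.exp (θ * f g' + -√2 * (B g' ⬝ᵥ g)))
        + ENNReal.ofReal (Real.exp (θ * f (c • g + c • g')
          + √2 * (B (c • g + c • g') ⬝ᵥ (-c • g + c • g'))))) := by
    intro g g'
    have e1 : f g' - f (c • g + c • g') ≤ (θ * f g' + -√2 * (B g' ⬝ᵥ g)) / 2 := by
      have := hmax (c • g + c • g') _ (hBS g')
      simp only [f, dotProduct_add, dotProduct_smul, smul_eq_mul, θ, c] at this ⊢
      linarith
    have e2 : f (c • g + c • g') - f g ≤ (θ * f (c • g + c • g')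
          + √2 * (B (c • g + c • g') ⬝ᵥ (-c • g + c • g'))) / 2 := by
      have := hmax g _ (hBS (c • g + c • g'))
      simp only [f, dotProduct_add, dotProduct_smul, smul_eq_mul, θ] at this ⊢
      have hc : √2 * c = 1 := by simp only [c]; linarith
      linear_combination this + (B (c • g + c • g') ⬝ᵥ g) * hc
    set a := θ * f g' + -√2 * (B g' ⬝ᵥ g)
    set b := θ * f (c • g + c • g') + √2 * (B (c • g + c • g') ⬝ᵥ (-c • g + c • g'))
    rw [← ENNReal.ofReal_mul (Real.exp_pos _).le, ← Real.exp_add,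
      ← ENNReal.ofReal_add (Real.exp_pos _).le (Real.exp_pos _).le,
      show (2⁻¹ : ℝ≥0∞) = ENNReal.ofReal 2⁻¹ by
        rw [ENNReal.ofReal_inv_of_pos two_pos, ENNReal.ofReal_ofNat],
      ← ENNReal.ofReal_mul (by norm_num)]
    refine ENNReal.ofReal_le_ofReal ?_
    have hconv := convexOn_exp.2 (mem_univ a) (mem_univ b) (by norm_num : (0 : ℝ) ≤ 2⁻¹)
      (by norm_num : (0 : ℝ) ≤ 2⁻¹) (by norm_num)
    simp only [smul_eq_mul] at hconv
    calc Real.exp (-f g + f g') ≤ Real.exp (2⁻¹ * a + 2⁻¹ * b) := Real.exp_le_exp.2 (by linarith)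
      _ ≤ _ := by linarith
  have hrot : ∫⁻ w, ENNReal.ofReal (Real.exp (θ * f (c • w.1 + c • w.2)
      + √2 * (B (c • w.1 + c • w.2) ⬝ᵥ (-c • w.1 + c • w.2)))) ∂(γ.prod γ)
      ≤ ENNReal.ofReal (Real.exp (θ * l + R)) := by
    have h := (measurePreserving_rotation_gaussVec n (Real.pi / 4)).lintegral_comp (hΨm √2)
    simp only [ContinuousLinearMap.rotation_apply, Real.cos_pi_div_four,
      Real.sin_pi_div_four] at h
    rw [h, lintegral_prod _ (hΨm _).aemeasurable]
    exact hΨ _ h2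
  have hdir : ∫⁻ w, ENNReal.ofReal (Real.exp (θ * f w.2 + -√2 * (B w.2 ⬝ᵥ w.1))) ∂(γ.prod γ)
      ≤ ENNReal.ofReal (Real.exp (θ * l + R)) := by
    rw [← lintegral_prod_swap]
    simp only [Prod.fst_swap, Prod.snd_swap]
    rw [lintegral_prod _ (hΨm _).aemeasurable]
    exact hΨ _ (by rw [neg_sq, h2])
  have hneg : Integrable (fun g => Real.exp (-f g)) γ := by
    obtain ⟨b, hb⟩ : S.Nonempty := ⟨_, hBS 0⟩
    refine (integrable_exp_dotProduct_gaussVec (-b)).mono (by fun_prop) (ae_of_all _ fun g => ?_)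
    rw [Real.norm_of_nonneg (Real.exp_pos _).le, Real.norm_of_nonneg (Real.exp_pos _).le,
      neg_dotProduct]
    exact Real.exp_le_exp.2 (neg_le_neg (hmax g b hb))
  have hprod : ENNReal.ofReal (∫ g, Real.exp (-f g) ∂γ) * ENNReal.ofReal Z
      ≤ ENNReal.ofReal (Real.exp (θ * l + R)) := by
    rw [ofReal_integral_eq_lintegral_ofReal hneg (ae_of_all _ fun g => (Real.exp_pos _).le),
      ofReal_integral_eq_lintegral_ofReal hexp (ae_of_all _ fun g => (Real.exp_pos _).le),
      ← lintegral_prod_mul (by fun_prop) (by fun_prop)]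
    exact lintegral_le_of_le_half_add ((hΨm (-√2)).comp measurable_swap)
      (fun w => hpt w.1 w.2) hdir hrot
  have hjensen : Real.exp (-∫ g, f g ∂γ) ≤ ∫ g, Real.exp (-f g) ∂γ :=
    exp_neg_integral_le hint hneg
  have hreal : Real.exp (-∫ g, f g ∂γ) * Z ≤ Real.exp (θ * l + R) := by
    rw [← ENNReal.ofReal_mul (integral_nonneg fun g => (Real.exp_pos _).le)] at hprod
    refine le_trans ?_ ((ENNReal.ofReal_le_ofReal_iff (Real.exp_pos _).le).1 hprod)
    gcongr
  rw [← hl, ← Real.exp_add, Real.exp_le_exp] at hreal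
  rw [← hl, Real.exp_le_exp]
  simp only [θ] at hreal
  have h3 : (√2 - 1) * l ≤ ∫ g, f g ∂γ + R := by linarith
  linear_combination mul_le_mul_of_nonneg_left h3 (by positivity : 0 ≤ √2 + 1) - l * h2

theorem le_biSup_of_le {ι : Type*} {s : Set ι} {f : ι → ℝ} {K : ℝ} (hK : ∀ i ∈ s, f i ≤ K)
    {i : ι} (hi : i ∈ s) : f i ≤ ⨆ i ∈ s, f i := by
  have hb : BddAbove (range fun i => ⨆ _ : i ∈ s, f i) := by
    refine ⟨max K 0, ?_⟩
    rintro _ ⟨j, rfl⟩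
    exact Real.iSup_le (fun hj => (hK j hj).trans (le_max_left _ _)) (le_max_right _ _)
  refine le_trans ?_ (le_ciSup hb i)
  rw [ciSup_pos hi]

theorem biSup_le_of_le {ι : Type*} {s : Set ι} {f : ι → ℝ} {K : ℝ} (hK : ∀ i ∈ s, f i ≤ K)
    (h0 : 0 ≤ K) : ⨆ i ∈ s, f i ≤ K :=
  Real.iSup_le (fun i => Real.iSup_le (hK i) h0) h0

theorem biSup_nonneg {ι : Type*} {s : Set ι} {f : ι → ℝ} (h : ∀ i, 0 ≤ f i) :
    0 ≤ ⨆ i ∈ s, f i :=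
  Real.iSup_nonneg fun i => Real.iSup_nonneg fun _ => h i

theorem le_biSup_of_finite {ι : Type*} {s : Set ι} (hs : s.Finite) (f : ι → ℝ) {i : ι}
    (hi : i ∈ s) : f i ≤ ⨆ i ∈ s, f i := by
  obtain ⟨K, hK⟩ := (hs.image f).bddAbove
  exact le_biSup_of_le (fun i hi => hK (mem_image_of_mem f hi)) hi

theorem biSup_le_sum {ι : Type*} {s : Set ι} (hs : s.Finite) {f : ι → ℝ} (h : ∀ i, 0 ≤ f i) :
    ⨆ i ∈ s, f i ≤ ∑ i ∈ hs.toFinset, f i :=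
  biSup_le_of_le (fun _ hi => Finset.single_le_sum (fun i _ => h i) (hs.mem_toFinset.2 hi))
    (Finset.sum_nonneg fun i _ => h i)

/-- The vector `(∑_{jk} a_{ijk} x_j t_k)_i`. -/
def contract (A : Fin n → Fin n → Fin m → ℝ) (x : Fin n → ℝ) (t : Fin m → ℝ) : Fin n → ℝ :=
  fun i => ∑ j, ∑ k, A i j k * x j * t k

theorem contract_add_left (A : Fin n → Fin n → Fin m → ℝ) (x y : Fin n → ℝ) (t : Fin m → ℝ) :
    contract A (x + y) t = contract A x t + contract A y t := by
  ext i
  simp only [contract, Pi.add_apply, ← Finset.sum_add_distrib]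
  exact Finset.sum_congr rfl fun j _ => Finset.sum_congr rfl fun k _ => by ring

theorem contract_smul_left (A : Fin n → Fin n → Fin m → ℝ) (c : ℝ) (x : Fin n → ℝ)
    (t : Fin m → ℝ) : contract A (c • x) t = c • contract A x t := by
  ext i
  simp only [contract, Pi.smul_apply, smul_eq_mul, Finset.mul_sum]
  exact Finset.sum_congr rfl fun j _ => Finset.sum_congr rfl fun k _ => by ring

theorem contract_neg_left (A : Fin n → Fin n → Fin m → ℝ) (x : Fin n → ℝ) (t : Fin m → ℝ) :
    contract A (-x) t = -contract A x t := by
  rw [← neg_one_smul ℝ, contract_smul_left, neg_one_smul]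

theorem contract_sub_right (A : Fin n → Fin n → Fin m → ℝ) (x : Fin n → ℝ) (t s : Fin m → ℝ) :
    contract A x (t - s) = contract A x t - contract A x s := by
  ext i
  simp only [contract, Pi.sub_apply, ← Finset.sum_sub_distrib]
  exact Finset.sum_congr rfl fun j _ => Finset.sum_congr rfl fun k _ => by ring

@[fun_prop]
theorem continuous_contract (A : Fin n → Fin n → Fin m → ℝ) {X : Type*} [TopologicalSpace X]
    {f : X → Fin n → ℝ} {h : X → Fin m → ℝ} (hf : Continuous f) (hh : Continuous h) :
    Continuous fun z => contract A (f z) (h z) := by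
  unfold contract
  fun_prop

theorem sum_eq_contract_dotProduct (A : Fin n → Fin n → Fin m → ℝ) (g x : Fin n → ℝ)
    (t : Fin m → ℝ) :
    ∑ i, ∑ j, ∑ k, A i j k * g i * x j * t k = contract A x t ⬝ᵥ g := by
  simp only [contract, dotProduct, Finset.sum_mul]
  exact Finset.sum_congr rfl fun i _ => Finset.sum_congr rfl fun j _ =>
    Finset.sum_congr rfl fun k _ => by ring

theorem alphaA_tens (A : Fin n → Fin n → Fin m → ℝ) (x : Fin n → ℝ) (t : Fin m → ℝ) :
    alphaA A (tens x t) = ‖WithLp.toLp 2 (contract A x t)‖ := by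
  simp [alphaA, tens, contract, EuclideanSpace.norm_eq, mul_assoc]

theorem dA_eq (A : Fin n → Fin n → Fin m → ℝ) (z w : (Fin n → ℝ) × (Fin m → ℝ)) :
    dA A z w = ‖WithLp.toLp 2 (contract A z.1 z.2 - contract A w.1 w.2)‖ := by
  simp [dA, alphaA, tens, contract, EuclideanSpace.norm_eq, mul_assoc, mul_sub]

theorem sum_sq_eq_norm_sq (v : Fin n → ℝ) : ∑ i, v i ^ 2 = ‖WithLp.toLp 2 v‖ ^ 2 := by
  simp [EuclideanSpace.real_norm_sq_eq]

theorem abs_contract_dotProduct_le (A : Fin n → Fin n → Fin m → ℝ) (g x : Fin n → ℝ)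
    (t : Fin m → ℝ) :
    |contract A x t ⬝ᵥ g| ≤ ∑ i, ∑ j, ∑ k, |A i j k| * |t k| * (|g i| * |x j|) := by
  rw [← sum_eq_contract_dotProduct]
  refine (Finset.abs_sum_le_sum_abs _ _).trans (Finset.sum_le_sum fun i _ => ?_)
  refine (Finset.abs_sum_le_sum_abs _ _).trans (Finset.sum_le_sum fun j _ => ?_)
  refine (Finset.abs_sum_le_sum_abs _ _).trans (Finset.sum_le_sum fun k _ => ?_)
  rw [abs_mul, abs_mul, abs_mul]
  exact le_of_eq (by ring)

theorem integrable_contract_dotProduct_expVec (A : Fin n → Fin n → Fin m → ℝ) (g : Fin n → ℝ)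
    (t : Fin m → ℝ) : Integrable (fun y => contract A y t ⬝ᵥ g) (expVec n) := by
  simp only [← sum_eq_contract_dotProduct]
  exact integrable_finsetSum _ fun i _ => integrable_finsetSum _ fun j _ =>
    integrable_finsetSum _ fun k _ => ((integrable_eval_expVec j).const_mul _).mul_const _

theorem integrable_alphaA_tens (A : Fin n → Fin n → Fin m → ℝ) (t : Fin m → ℝ) :
    Integrable (fun y => alphaA A (tens y t)) (expVec n) := by
  simp only [alphaA_tens]
  refine (integrable_finsetSum Finset.univ fun i _ =>
    (integrable_finsetSum Finset.univ fun j _ => integrable_finsetSum Finset.univ fun k _ =>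
      ((integrable_eval_expVec j).const_mul (A i j k)).mul_const (t k)).abs).mono'
    (by fun_prop) (ae_of_all _ fun y => ?_)
  rw [norm_norm, EuclideanSpace.norm_eq]
  refine Real.sqrt_le_iff.2 ⟨Finset.sum_nonneg fun i _ => abs_nonneg _, ?_⟩
  simp only [Real.norm_eq_abs]
  exact Finset.sum_sq_le_sq_sum_of_nonneg fun i _ => abs_nonneg _

theorem betaA_eq (A : Fin n → Fin n → Fin m → ℝ) (T : Set (Fin m → ℝ)) (x : Fin n → ℝ) :
    betaA A T x = ∫ g, (⨆ s ∈ T, |contract A x s ⬝ᵥ g|) ∂gaussVec n := by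
  simp only [betaA, sum_eq_contract_dotProduct]

theorem measurable_biSup_contract (A : Fin n → Fin n → Fin m → ℝ) {T : Set (Fin m → ℝ)}
    (hT : T.Finite) : Measurable fun w : (Fin n → ℝ) × (Fin n → ℝ) =>
      ⨆ s ∈ T, |contract A w.2 s ⬝ᵥ w.1| := by
  refine Measurable.biSup _ hT.countable fun s _ => ?_
  simp only [← sum_eq_contract_dotProduct]
  fun_prop

theorem integrable_biSup_contract_gaussVec (A : Fin n → Fin n → Fin m → ℝ)
    {T : Set (Fin m → ℝ)} (hT : T.Finite) (x : Fin n → ℝ) :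
    Integrable (fun g => ⨆ s ∈ T, |contract A x s ⬝ᵥ g|) (gaussVec n) := by
  refine (integrable_finsetSum hT.toFinset fun s _ =>
    (integrable_dotProduct_gaussVec (contract A x s)).abs).mono'
    ((measurable_biSup_contract A hT).comp
      (measurable_id.prodMk measurable_const)).aestronglyMeasurable (ae_of_all _ fun g => ?_)
  rw [Real.norm_of_nonneg (biSup_nonneg fun _ => abs_nonneg _)]
  exact biSup_le_sum hT fun _ => abs_nonneg _

theorem integrable_biSup_contract_prod (A : Fin n → Fin n → Fin m → ℝ)
    {T : Set (Fin m → ℝ)} (hT : T.Finite) :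
    Integrable (fun w : (Fin n → ℝ) × (Fin n → ℝ) => ⨆ s ∈ T, |contract A w.2 s ⬝ᵥ w.1|)
      ((gaussVec n).prod (expVec n)) := by
  refine (integrable_finsetSum hT.toFinset fun s _ => integrable_finsetSum Finset.univ fun i _ =>
    integrable_finsetSum Finset.univ fun j _ => integrable_finsetSum Finset.univ fun k _ =>
      ((integrable_eval_gaussVec i).abs.mul_prod (integrable_eval_expVec j).abs).const_mul
        (|A i j k| * |s k|)).mono'
    (measurable_biSup_contract A hT).aestronglyMeasurable (ae_of_all _ fun w => ?_)
  rw [Real.norm_of_nonneg (biSup_nonneg fun _ => abs_nonneg _)]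
  exact (biSup_le_sum hT fun _ => abs_nonneg _).trans
    (Finset.sum_le_sum fun s _ => abs_contract_dotProduct_le A w.1 w.2 s)

theorem betaA_nonneg (A : Fin n → Fin n → Fin m → ℝ) (T : Set (Fin m → ℝ)) (x : Fin n → ℝ) :
    0 ≤ betaA A T x :=
  integral_nonneg fun _ => biSup_nonneg fun _ => abs_nonneg _

theorem measurable_betaA (A : Fin n → Fin n → Fin m → ℝ) {T : Set (Fin m → ℝ)}
    (hT : T.Finite) : Measurable (betaA A T) := by
  simp only [funext (betaA_eq A T)]
  exact ((measurable_biSup_contract A hT).stronglyMeasurable.integral_prod_left').measurable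

theorem betaA_add_le (A : Fin n → Fin n → Fin m → ℝ) {T : Set (Fin m → ℝ)} (hT : T.Finite)
    (x y : Fin n → ℝ) : betaA A T (x + y) ≤ betaA A T x + betaA A T y := by
  have hi := integrable_biSup_contract_gaussVec A hT
  simp only [betaA_eq]
  rw [← integral_add (hi x) (hi y)]
  refine integral_mono (hi _) ((hi x).add (hi y)) fun g => ?_
  refine biSup_le_of_le (fun s hs => ?_) (add_nonneg (biSup_nonneg fun _ => abs_nonneg _)
    (biSup_nonneg fun _ => abs_nonneg _))
  rw [contract_add_left, add_dotProduct]
  exact (abs_add_le _ _).trans (add_le_add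
    (le_biSup_of_finite hT (fun s => |contract A x s ⬝ᵥ g|) hs)
    (le_biSup_of_finite hT (fun s => |contract A y s ⬝ᵥ g|) hs))

theorem betaA_smul (A : Fin n → Fin n → Fin m → ℝ) (T : Set (Fin m → ℝ)) (c : ℝ)
    (x : Fin n → ℝ) : betaA A T (c • x) = |c| * betaA A T x := by
  simp only [betaA_eq, contract_smul_left, smul_dotProduct, smul_eq_mul, abs_mul,
    ← Real.mul_iSup_of_nonneg (abs_nonneg c), integral_const_mul]

theorem integrable_betaA (A : Fin n → Fin n → Fin m → ℝ) {T : Set (Fin m → ℝ)}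
    (hT : T.Finite) : Integrable (betaA A T) (expVec n) := by
  simp only [funext (betaA_eq A T)]
  exact (integrable_biSup_contract_prod A hT).integral_prod_right

theorem integral_betaA_le (A : Fin n → Fin n → Fin m → ℝ) {T : Set (Fin m → ℝ)}
    (hT : T.Finite) : ∫ y, betaA A T y ∂expVec n ≤ sA A T := by
  have h : ∫ y, betaA A T y ∂expVec n
      = ∫ w, (⨆ s ∈ T, |contract A w.2 s ⬝ᵥ w.1|) ∂((gaussVec n).prod (expVec n)) := by
    rw [integral_prod_symm _ (integrable_biSup_contract_prod A hT)]
    simp only [betaA_eq]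
  rw [h, sA]
  simp only [sum_eq_contract_dotProduct]
  exact le_add_of_nonneg_left (integral_nonneg fun _ => biSup_nonneg fun _ => abs_nonneg _)

theorem sA_nonneg (A : Fin n → Fin n → Fin m → ℝ) (T : Set (Fin m → ℝ)) : 0 ≤ sA A T :=
  add_nonneg (integral_nonneg fun _ => biSup_nonneg fun _ => abs_nonneg _)
    (integral_nonneg fun _ => biSup_nonneg fun _ => abs_nonneg _)

theorem abs_contract_sub_dotProduct_le (A : Fin n → Fin n → Fin m → ℝ) {T : Set (Fin m → ℝ)}
    (hT : T.Finite) (g x : Fin n → ℝ) {s : Fin m → ℝ} (hs : s ∈ T - T) :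
    |contract A x s ⬝ᵥ g| ≤ 2 * ⨆ s ∈ T, |contract A x s ⬝ᵥ g| := by
  obtain ⟨t, ht, t', ht', rfl⟩ := hs
  rw [contract_sub_right, sub_dotProduct]
  have h := le_biSup_of_finite hT (fun s => |contract A x s ⬝ᵥ g|) ht
  have h' := le_biSup_of_finite hT (fun s => |contract A x s ⬝ᵥ g|) ht'
  have := abs_sub (contract A x t ⬝ᵥ g) (contract A x t' ⬝ᵥ g)
  linarith

theorem integral_abs_contract_le (A : Fin n → Fin n → Fin m → ℝ) {T : Set (Fin m → ℝ)}
    (hT : T.Finite) (x : Fin n → ℝ) {s : Fin m → ℝ} (hs : s ∈ T - T) :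
    ∫ g, |contract A x s ⬝ᵥ g| ∂gaussVec n ≤ 2 * betaA A T x := by
  rw [betaA_eq, ← integral_const_mul]
  exact integral_mono (integrable_dotProduct_gaussVec _).abs
    ((integrable_biSup_contract_gaussVec A hT x).const_mul 2)
    fun g => abs_contract_sub_dotProduct_le A hT g x hs

theorem exists_betaA_le (A : Fin n → Fin n → Fin m → ℝ) {T : Set (Fin m → ℝ)} (hT : T.Finite)
    (K : ℝ) : ∃ b, ∀ x : Fin n → ℝ, (∀ j, |x j| ≤ K) → betaA A T x ≤ b := by
  refine ⟨∫ g, ∑ s ∈ hT.toFinset, ∑ i, ∑ j, ∑ k, |A i j k| * |s k| * (|g i| * K) ∂gaussVec n,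
    fun x hx => ?_⟩
  rw [betaA_eq]
  refine integral_mono (integrable_biSup_contract_gaussVec A hT x)
    (integrable_finsetSum _ fun s _ => integrable_finsetSum _ fun i _ =>
      integrable_finsetSum _ fun j _ => integrable_finsetSum _ fun k _ =>
        ((integrable_eval_gaussVec i).abs.mul_const K).const_mul _) fun g => ?_
  refine (biSup_le_sum hT fun _ => abs_nonneg _).trans (Finset.sum_le_sum fun s _ => ?_)
  refine (abs_contract_dotProduct_le A g x s).trans ?_
  gcongr with i _ j _ k _
  exact hx j

theorem abs_le_of_mem_UB {p : ℝ} {x : Fin n → ℝ} (hx : x ∈ UB n p) (j : Fin n) :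
    |x j| ≤ 1 + √p := by
  obtain ⟨u, hu, _, ⟨w, hw, rfl⟩, rfl⟩ := hx
  have h1 : |u j| ≤ 1 := by
    refine le_trans ?_ hu
    rw [← Real.sqrt_sq_eq_abs]
    exact Real.sqrt_le_sqrt (Finset.single_le_sum (f := fun i => u i ^ 2)
      (fun i _ => sq_nonneg _) (Finset.mem_univ j))
  have h2 : |w j| ≤ 1 := (Finset.single_le_sum (f := fun i => |w i|)
    (fun i _ => abs_nonneg _) (Finset.mem_univ j)).trans hw
  refine (abs_add_le _ _).trans (add_le_add h1 ?_)
  simp only [Pi.smul_apply, smul_eq_mul, abs_mul, abs_of_nonneg (Real.sqrt_nonneg p)]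
  exact mul_le_of_le_one_right (Real.sqrt_nonneg p) h2

theorem exists_dA_le (A : Fin n → Fin n → Fin m → ℝ) {T : Set (Fin m → ℝ)} (hT : T.Finite)
    {p : ℝ} {W : Set ((Fin n → ℝ) × (Fin m → ℝ))} (hW : W ⊆ UB n p ×ˢ (T - T)) :
    ∃ K, ∀ z ∈ W, ∀ w ∈ W, dA A z w ≤ K := by
  set V : Set ((Fin n → ℝ) × (Fin m → ℝ)) :=
    (Icc (fun _ => -(1 + √p)) fun _ => 1 + √p) ×ˢ (T - T)
  have hV : IsCompact V := isCompact_Icc.prod (hT.sub hT).isCompact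
  have hWV : W ⊆ V := fun z hz => ⟨⟨fun j => (abs_le.1 (abs_le_of_mem_UB (hW hz).1 j)).1,
    fun j => (abs_le.1 (abs_le_of_mem_UB (hW hz).1 j)).2⟩, (hW hz).2⟩
  obtain ⟨K, hK⟩ := (hV.prod hV).bddAbove_image (f := fun q => dA A q.1 q.2)
    (by simp only [dA_eq]; fun_prop)
  exact ⟨K, fun z hz w hw => hK ⟨(z, w), ⟨hWV hz, hWV hw⟩, rfl⟩⟩

theorem half_le_measureReal_inter {Ω : Type*} [MeasurableSpace Ω] {μ : Measure Ω}
    [IsProbabilityMeasure μ] {f h : Ω → ℝ} (hf : Integrable f μ) (hh : Integrable h μ)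
    (hfm : Measurable f) (hhm : Measurable h)
    (hf0 : ∀ y, 0 ≤ f y) (hh0 : ∀ y, 0 ≤ h y) {K L : ℝ} (hK : 0 < K) (hL : 0 < L)
    (hfK : 4 * ∫ y, f y ∂μ ≤ K) (hhL : 4 * ∫ y, h y ∂μ ≤ L) :
    1 / 2 ≤ μ.real {y | f y ≤ K ∧ h y ≤ L} := by
  have hm : MeasurableSet {y | f y ≤ K ∧ h y ≤ L} :=
    (measurableSet_le hfm measurable_const).inter (measurableSet_le hhm measurable_const)
  have h1 : K * μ.real {y | K ≤ f y} ≤ K * (1 / 4) := by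
    linarith [mul_meas_ge_le_integral_of_nonneg (ae_of_all _ hf0) hf K]
  have h2 : L * μ.real {y | L ≤ h y} ≤ L * (1 / 4) := by
    linarith [mul_meas_ge_le_integral_of_nonneg (ae_of_all _ hh0) hh L]
  have h3 : μ.real {y | f y ≤ K ∧ h y ≤ L}ᶜ ≤ μ.real {y | K ≤ f y} + μ.real {y | L ≤ h y} := by
    refine (measureReal_mono fun y hy => ?_).trans (measureReal_union_le _ _)
    by_contra hc
    simp only [mem_union, mem_ofPred_eq, not_or, not_le] at hc
    exact hy ⟨hc.1.le, hc.2.le⟩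
  rw [probReal_compl_eq_one_sub hm] at h3
  have := le_of_mul_le_mul_left h1 hK
  have := le_of_mul_le_mul_left h2 hL
  linarith

/-- Averaging over a symmetric set, a value `r` at the centre is bounded through the exponential
mass that `expVec` puts near the shift `a + b`. -/
theorem le_of_shift_expVec {D : Set (Fin n → ℝ)} (hDm : MeasurableSet D) (hD : -D = D)
    (hD2 : 1 / 2 ≤ (expVec n).real D) {p c r : ℝ} (hp : 0 ≤ p) {a b : Fin n → ℝ}
    (ha : ∑ j, a j ^ 2 ≤ p)
    (hb : ∑ j, |b j| ≤ p) {l : (Fin n → ℝ) → ℝ} (hl : Integrable l (expVec n))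
    (hodd : ∀ y, l (-y) = -l y) {ψ : (Fin n → ℝ) → ℝ≥0∞} (hψ : Measurable ψ)
    (hψf : ∫⁻ y, ψ y ∂expVec n ≠ ∞)
    (h : ∀ y ∈ D, ENNReal.ofReal (Real.exp (r + l y)) ≤ ψ (y + (a + b))) :
    r ≤ c + 4 * p + 2 * (Real.exp (-c) * (∫⁻ y, ψ y ∂expVec n).toReal) := by
  set ν := expVec n
  set L : (Fin n → ℝ) → ℝ := fun y => ∑ j, (|y j + (a + b) j| - |y j|)
  have hLi : Integrable L ν := integrable_abs_add_sub_abs_expVec (a + b)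
  have hLm : Measurable L := by simp only [L]; fun_prop
  set η : (Fin n → ℝ) → ℝ≥0∞ := fun y => ENNReal.ofReal (Real.exp (-L y)) * ψ (y + (a + b))
  have hηm : Measurable η := by simp only [η]; fun_prop
  have hη : ∫⁻ y, η y ∂ν = ∫⁻ y, ψ y ∂ν := lintegral_expVec_shift (a + b) hψ
  have hηf : ∫⁻ y, η y ∂ν ≠ ∞ := hη ▸ hψf
  have hηi : Integrable (fun y => (η y).toReal) ν :=
    integrable_toReal_of_lintegral_ne_top hηm.aemeasurable hηf
  have hηlt := ae_lt_top hηm hηf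
  have hηint : ∫ y, (η y).toReal ∂ν = (∫⁻ y, ψ y ∂ν).toReal := by
    rw [integral_toReal hηm.aemeasurable hηlt, hη]
  have hlD : ∫ y in D, l y ∂ν = 0 := by
    have h := setIntegral_comp_neg_expVec hD l
    simp only [hodd, integral_neg] at h
    linarith
  have hpt : ∀ᵐ y ∂ν.restrict D, r + l y ≤ c + L y + Real.exp (-c) * (η y).toReal := by
    filter_upwards [ae_restrict_mem hDm, ae_restrict_of_ae hηlt] with y hy hlt
    have h1 : Real.exp (r + l y - L y) ≤ (η y).toReal := by
      rw [← ENNReal.ofReal_le_iff_le_toReal hlt.ne, sub_eq_neg_add, Real.exp_add,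
        ENNReal.ofReal_mul (Real.exp_pos _).le]
      exact mul_le_mul_right (h y hy) _
    have h2 := Real.add_one_le_exp (-c + (r + l y - L y))
    rw [Real.exp_add] at h2
    have := mul_le_mul_of_nonneg_left h1 (Real.exp_pos (-c)).le
    linarith
  have hmono := integral_mono_ae ((integrable_const r).add hl).integrableOn
    (((integrable_const c).add hLi).add (hηi.const_mul (Real.exp (-c)))).integrableOn hpt
  have e1 : ∫ y in D, (r + l y) ∂ν = r * ν.real D := by
    rw [integral_add (integrable_const r) hl.integrableOn, hlD]
    simp [mul_comm]
  have e2 : ∫ y in D, (c + L y + Real.exp (-c) * (η y).toReal) ∂ν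
      = c * ν.real D + ∫ y in D, L y ∂ν + Real.exp (-c) * ∫ y in D, (η y).toReal ∂ν := by
    have hcL : IntegrableOn (fun y => c + L y) D ν := ((integrable_const c).add hLi).integrableOn
    rw [integral_add hcL (hηi.const_mul _).integrableOn,
      integral_add (integrable_const c) hLi.integrableOn, integral_const_mul]
    simp [mul_comm]
  have h4 : ∫ y in D, L y ∂ν ≤ 2 * p := by
    linarith [setIntegral_abs_add_sub_abs_le a b hD]
  have h5 : ∫ y in D, (η y).toReal ∂ν ≤ (∫⁻ y, ψ y ∂ν).toReal := by
    rw [← hηint]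
    exact setIntegral_le_integral hηi (ae_of_all _ fun y => ENNReal.toReal_nonneg)
  simp only [Pi.add_apply] at hmono
  rw [e1, e2] at hmono
  have h6 := mul_le_mul_of_nonneg_left h5 (Real.exp_pos (-c)).le
  have h7 : 0 ≤ Real.exp (-c) * (∫⁻ y, ψ y ∂ν).toReal :=
    mul_nonneg (Real.exp_pos _).le ENNReal.toReal_nonneg
  nlinarith

/-- Exponential moment of a finite supremum of Gaussian linear functionals. -/
theorem lintegral_biSup_exp_le {ι : Type*} {S : Set ι} (hS : S.Finite) {v : ι → Fin n → ℝ} {R : ℝ}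
    (hR : ∀ s ∈ S, ∑ i, v s i ^ 2 ≤ R) {H : (Fin n → ℝ) → ℝ} (hH : Integrable H (gaussVec n))
    (hvH : ∀ s ∈ S, ∀ g, v s ⬝ᵥ g ≤ H g) :
    ∫⁻ g, ⨆ s ∈ S, ENNReal.ofReal (Real.exp (v s ⬝ᵥ g)) ∂gaussVec n
      ≤ ENNReal.ofReal (Real.exp ((√2 + 1) * (∫ g, H g ∂gaussVec n + R))) := by
  classical
  rcases S.eq_empty_or_nonempty with rfl | hne
  · simp
  obtain ⟨B, hB, hBS, hmax⟩ := exists_measurable_argmax (hS.toFinset.image v)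
    ((hS.toFinset_nonempty.2 hne).image v)
  obtain ⟨hi, hi', hle⟩ := integral_exp_argmax_le (R := R) (by simpa using hR) hB hBS hmax
  calc ∫⁻ g, ⨆ s ∈ S, ENNReal.ofReal (Real.exp (v s ⬝ᵥ g)) ∂gaussVec n
      ≤ ∫⁻ g, ENNReal.ofReal (Real.exp (B g ⬝ᵥ g)) ∂gaussVec n := by
        refine lintegral_mono fun g => iSup₂_le fun s hs => ?_
        exact ENNReal.ofReal_le_ofReal (Real.exp_le_exp.2 (hmax g _
          (Finset.mem_image_of_mem v (hS.mem_toFinset.2 hs))))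
    _ = ENNReal.ofReal (∫ g, Real.exp (B g ⬝ᵥ g) ∂gaussVec n) :=
        (ofReal_integral_eq_lintegral_ofReal hi (ae_of_all _ fun _ => (Real.exp_pos _).le)).symm
    _ ≤ _ := by
        refine ENNReal.ofReal_le_ofReal (hle.trans (Real.exp_le_exp.2 ?_))
        refine mul_le_mul_of_nonneg_left (add_le_add_left
          (integral_mono hi' hH fun g => ?_) R) (by positivity)
        obtain ⟨s, hs, hsg⟩ := Finset.mem_image.1 (hBS g)
        simp only [← hsg]
        exact hvH s (hS.mem_toFinset.1 hs) g

/-- The supremum of `exp (q ⟨g, contract A (σ y) s - z⟩)` over those `s ∈ T - T` for which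
`contract A (σ y) s` is within distance `R` of `z`; it vanishes unless `betaA A T (σ y) ≤ M`. -/
def tiltedSup (A : Fin n → Fin n → Fin m → ℝ) (T : Set (Fin m → ℝ)) (z : Fin n → ℝ)
    (σ q M R : ℝ) (w : (Fin n → ℝ) × (Fin n → ℝ)) : ℝ≥0∞ :=
  ⨆ s ∈ T - T, {y | betaA A T (σ • y) ≤ M ∧
    ‖WithLp.toLp 2 (contract A (σ • y) s - z)‖ ≤ R}.indicator
      (fun y => ENNReal.ofReal (Real.exp (q • (contract A (σ • y) s - z) ⬝ᵥ w.1))) w.2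

theorem measurable_tiltedSup (A : Fin n → Fin n → Fin m → ℝ) {T : Set (Fin m → ℝ)}
    (hT : T.Finite) (z : Fin n → ℝ) (σ q M R : ℝ) : Measurable (tiltedSup A T z σ q M R) := by
  refine Measurable.biSup _ (hT.sub hT).countable fun s _ => ?_
  have hv : Measurable fun y : Fin n → ℝ => contract A (σ • y) s - z :=
    Continuous.measurable (by fun_prop)
  have hn : Measurable fun y : Fin n → ℝ => ‖WithLp.toLp 2 (contract A (σ • y) s - z)‖ :=
    Continuous.measurable (by fun_prop)
  have hS : MeasurableSet {y | betaA A T (σ • y) ≤ M ∧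
      ‖WithLp.toLp 2 (contract A (σ • y) s - z)‖ ≤ R} :=
    (measurableSet_le ((measurable_betaA A hT).comp (measurable_const_smul σ))
      measurable_const).inter (measurableSet_le hn measurable_const)
  have hf : Measurable fun w : (Fin n → ℝ) × (Fin n → ℝ) => ENNReal.ofReal
      (Real.exp (q • (contract A (σ • w.2) s - z) ⬝ᵥ w.1)) := by
    simp only [dotProduct, Pi.smul_apply]
    fun_prop
  exact hf.indicator (measurable_snd hS)

theorem lintegral_tiltedSup_le (A : Fin n → Fin n → Fin m → ℝ) {T : Set (Fin m → ℝ)}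
    (hT : T.Finite) (z : Fin n → ℝ) {σ q M R : ℝ} (hq : 0 ≤ q) (y : Fin n → ℝ) :
    ∫⁻ g, tiltedSup A T z σ q M R (g, y) ∂gaussVec n
      ≤ ENNReal.ofReal (Real.exp ((√2 + 1) * (2 * q * M + (q * R) ^ 2))) := by
  set x := σ • y
  set S : Set (Fin m → ℝ) := {s | s ∈ T - T ∧ betaA A T x ≤ M ∧
    ‖WithLp.toLp 2 (contract A x s - z)‖ ≤ R}
  by_cases hM : betaA A T x ≤ M
  swap
  · have : ∀ g, tiltedSup A T z σ q M R (g, y) = 0 := fun g => by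
      refine le_antisymm (iSup₂_le fun s _ => ?_) zero_le
      rw [indicator_of_notMem fun h => hM h.1]
    simp [this]
  have hS : S.Finite := (hT.sub hT).subset fun s hs => hs.1
  set Y : (Fin n → ℝ) → ℝ := fun g => ⨆ s ∈ T, |contract A x s ⬝ᵥ g|
  have hY : Integrable Y (gaussVec n) := integrable_biSup_contract_gaussVec A hT x
  have hz := integrable_dotProduct_gaussVec z
  have hH : Integrable (fun g => q * (2 * Y g - z ⬝ᵥ g)) (gaussVec n) :=
    ((hY.const_mul 2).sub hz).const_mul q
  have hHi : ∫ g, q * (2 * Y g - z ⬝ᵥ g) ∂gaussVec n = q * (2 * betaA A T x) := by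
    rw [integral_const_mul, integral_sub (hY.const_mul 2) hz, integral_dotProduct_gaussVec,
      integral_const_mul, sub_zero, betaA_eq]
  calc ∫⁻ g, tiltedSup A T z σ q M R (g, y) ∂gaussVec n
      ≤ ∫⁻ g, ⨆ s ∈ S, ENNReal.ofReal (Real.exp (q • (contract A x s - z) ⬝ᵥ g))
          ∂gaussVec n := by
        refine lintegral_mono fun g => iSup₂_le fun s hs => ?_
        refine indicator_apply_le' (fun h => ?_) fun _ => zero_le
        exact le_iSup₂ (f := fun s (_ : s ∈ S) =>
          ENNReal.ofReal (Real.exp (q • (contract A x s - z) ⬝ᵥ g))) s ⟨hs, h⟩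
    _ ≤ ENNReal.ofReal (Real.exp ((√2 + 1) *
          (∫ g, q * (2 * Y g - z ⬝ᵥ g) ∂gaussVec n + (q * R) ^ 2))) := by
        refine lintegral_biSup_exp_le hS (fun s hs => ?_) hH fun s hs g => ?_
        · rw [sum_sq_eq_norm_sq, WithLp.toLp_smul, norm_smul, Real.norm_of_nonneg hq]
          gcongr
          exact hs.2.2
        · rw [smul_dotProduct, smul_eq_mul, sub_dotProduct]
          have := (le_abs_self _).trans (abs_contract_sub_dotProduct_le A hT g x hs.1)
          gcongr
    _ ≤ _ := by
        rw [hHi]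
        refine ENNReal.ofReal_le_ofReal (Real.exp_le_exp.2 ?_)
        have := mul_le_mul_of_nonneg_left hM hq
        exact mul_le_mul_of_nonneg_left (by linarith) (by positivity)

theorem exists_shift_of_mem_UB {p : ℝ} (hp : 0 ≤ p) {x : Fin n → ℝ} (hx : x ∈ UB n p) :
    ∃ a b : Fin n → ℝ, √p • x = a + b ∧ ∑ j, a j ^ 2 ≤ p ∧ ∑ j, |b j| ≤ p := by
  obtain ⟨u, hu, _, ⟨w, hw, rfl⟩, rfl⟩ := hx
  refine ⟨√p • u, √p • √p • w, smul_add _ _ _, ?_, ?_⟩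
  · have hu' : ∑ i, u i ^ 2 ≤ 1 := by
      simpa using (Real.sqrt_le_iff.1 hu).2
    simp only [Pi.smul_apply, smul_eq_mul, mul_pow, Real.sq_sqrt hp, ← Finset.mul_sum]
    exact mul_le_of_le_one_right hp hu'
  · have hw' : ∑ i, |w i| ≤ 1 := hw
    rw [smul_smul, Real.mul_self_sqrt hp]
    simp only [Pi.smul_apply, smul_eq_mul, abs_mul, abs_of_nonneg hp, ← Finset.mul_sum]
    exact mul_le_of_le_one_right hp hw'

theorem mul_dotProduct_sub_le (A : Fin n → Fin n → Fin m → ℝ) {T : Set (Fin m → ℝ)}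
    (hT : T.Finite) {p : ℝ} (hp : 0 < p) {x : Fin n → ℝ} {t : Fin m → ℝ} (hx : x ∈ UB n p)
    (ht : t ∈ T - T) {z : Fin n → ℝ} {q K L b d : ℝ} (hK : 0 < K) (hL : 0 < L)
    (hβK : 4 * ∫ y, betaA A T y ∂expVec n ≤ K) (hαL : 4 * expAlpha A t ≤ L)
    (hb : betaA A T x ≤ b) (hd : ‖WithLp.toLp 2 (contract A x t - z)‖ ≤ d) (c : ℝ)
    {g : Fin n → ℝ}
    (hg : ∫⁻ y, tiltedSup A T z (√p)⁻¹ q (b + (√p)⁻¹ * K) (d + (√p)⁻¹ * L) (g, y) ∂expVec n ≠ ∞) :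
    q * ((contract A x t - z) ⬝ᵥ g) ≤ c + 4 * p + 2 * (Real.exp (-c) *
      (∫⁻ y, tiltedSup A T z (√p)⁻¹ q (b + (√p)⁻¹ * K) (d + (√p)⁻¹ * L) (g, y)
        ∂expVec n).toReal) := by
  obtain ⟨u, v, huv, hu, hv⟩ := exists_shift_of_mem_UB hp.le hx
  have hs : 0 < √p := Real.sqrt_pos.2 hp
  set σ := (√p)⁻¹
  have hσ : 0 < σ := inv_pos.2 hs
  have hβm := measurable_betaA A hT
  have hαm : Measurable fun y => alphaA A (tens y t) := by
    simp only [alphaA_tens]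
    exact Continuous.measurable (by fun_prop)
  have hneg : ∀ y, betaA A T (-y) = betaA A T y := fun y => by
    rw [← neg_one_smul ℝ, betaA_smul]
    simp
  refine le_of_shift_expVec
    (D := {y | betaA A T y ≤ K ∧ alphaA A (tens y t) ≤ L})
    (l := fun y => q * σ * (contract A y t ⬝ᵥ g))
    ((measurableSet_le hβm measurable_const).inter (measurableSet_le hαm measurable_const)) ?_
    (half_le_measureReal_inter (integrable_betaA A hT) (integrable_alphaA_tens A t) hβm hαm
      (betaA_nonneg A T) (fun y => Real.sqrt_nonneg _) hK hL hβK hαL)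
    hp.le hu hv ((integrable_contract_dotProduct_expVec A g t).const_mul _) (fun y => ?_)
    ((measurable_tiltedSup A hT z σ q _ _).comp measurable_prodMk_left) hg fun y hy => ?_
  · ext y
    simp [hneg, alphaA_tens, contract_neg_left]
  · rw [contract_neg_left, neg_dotProduct, mul_neg]
  · have hshift : σ • (y + (u + v)) = x + σ • y := by
      rw [← huv, smul_add, smul_smul, inv_mul_cancel₀ hs.ne', one_smul, add_comm]
    have hmem : betaA A T (σ • (y + (u + v))) ≤ b + σ * K ∧
        ‖WithLp.toLp 2 (contract A (σ • (y + (u + v))) t - z)‖ ≤ d + σ * L := by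
      rw [hshift]
      constructor
      · refine (betaA_add_le A hT _ _).trans (add_le_add hb ?_)
        rw [betaA_smul, abs_of_pos hσ]
        exact mul_le_mul_of_nonneg_left hy.1 hσ.le
      · rw [contract_add_left, contract_smul_left, add_sub_right_comm, WithLp.toLp_add]
        refine (norm_add_le _ _).trans (add_le_add hd ?_)
        rw [WithLp.toLp_smul, norm_smul, Real.norm_of_nonneg hσ.le, ← alphaA_tens]
        exact mul_le_mul_of_nonneg_left hy.2 hσ.le
    refine le_trans (le_of_eq ?_) (le_iSup₂ (f := fun s (_ : s ∈ T - T) => indicator _ _ _) t ht)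
    rw [indicator_of_mem (by exact hmem), hshift, contract_add_left, contract_smul_left]
    simp only [smul_dotProduct, sub_dotProduct, add_dotProduct, smul_eq_mul]
    congr 2
    ring

theorem FA_le_of_forall_mem (A : Fin n → Fin n → Fin m → ℝ) {p : ℝ} (hp : 1 ≤ p)
    {T : Set (Fin m → ℝ)} (hT : T.Finite) {W : Set ((Fin n → ℝ) × (Fin m → ℝ))}
    (hW : W ⊆ UB n p ×ˢ (T - T)) {z : (Fin n → ℝ) × (Fin m → ℝ)} (hz : z ∈ W) {a b d ε : ℝ}
    (hb : ∀ w ∈ W, betaA A T w.1 ≤ b) (ha : ∀ w ∈ W, expAlpha A w.2 ≤ a)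
    (hd : ∀ w ∈ W, dA A w z ≤ d) (hε : 0 < ε) :
    FA A W ≤ 8 * b + 24 * ((√p)⁻¹ * sA A T) + 36 * a + 9 * (√p * d) + 15 * ε := by
  have hp0 : 0 < p := by linarith
  have hs1 : 1 ≤ √p := Real.one_le_sqrt.2 hp
  have hs : 0 < √p := by linarith
  set σ := (√p)⁻¹
  have hσ : 0 < σ := inv_pos.2 hs
  have hσ1 : σ ≤ 1 := inv_le_one_of_one_le₀ hs1
  have hσs : √p * σ = 1 := mul_inv_cancel₀ hs.ne'
  have hb0 : 0 ≤ b := (betaA_nonneg A T z.1).trans (hb z hz)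
  have ha0 : 0 ≤ a := (integral_nonneg fun _ => Real.sqrt_nonneg _).trans (ha z hz)
  have hd0 : 0 ≤ d := (Real.sqrt_nonneg _).trans (hd z hz)
  have hs0 := sA_nonneg A T
  set K := 4 * sA A T + ε
  set L := 4 * a + ε
  have hK : 0 < K := by positivity
  have hL : 0 < L := by positivity
  set M := b + σ * K with hM
  set R := d + σ * L with hR
  have hM0 : 0 < M := by positivity
  have hR0 : 0 < R := by positivity
  set q := √p / R with hq
  have hq0 : 0 < q := div_pos hs hR0
  have hqR : q * R = √p := div_mul_cancel₀ _ hR0.ne'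
  set c := (√2 + 1) * (2 * q * M + (q * R) ^ 2) with hc
  set y₀ := contract A z.1 z.2
  set Φ := tiltedSup A T y₀ σ q M R
  have hΦ : Measurable Φ := measurable_tiltedSup A hT y₀ σ q M R
  set J : (Fin n → ℝ) → ℝ≥0∞ := fun g => ∫⁻ y, Φ (g, y) ∂expVec n
  have hJ : Measurable J := hΦ.lintegral_prod_right'
  have hJle : ∫⁻ g, J g ∂gaussVec n ≤ ENNReal.ofReal (Real.exp c) := by
    rw [lintegral_lintegral_swap (f := fun g y => Φ (g, y)) hΦ.aemeasurable]
    refine (lintegral_mono fun y => lintegral_tiltedSup_le A hT y₀ hq0.le y).trans ?_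
    simp [hc]
  have hJf : ∫⁻ g, J g ∂gaussVec n ≠ ∞ := (hJle.trans_lt ENNReal.ofReal_lt_top).ne
  have hJi : Integrable (fun g => (J g).toReal) (gaussVec n) :=
    integrable_toReal_of_lintegral_ne_top hJ.aemeasurable hJf
  have hJlt := ae_lt_top hJ hJf
  have hJint : Real.exp (-c) * ∫ g, (J g).toReal ∂gaussVec n ≤ 1 := by
    rw [integral_toReal hJ.aemeasurable hJlt]
    calc _ ≤ Real.exp (-c) * Real.exp c := by
          gcongr
          exact ENNReal.toReal_le_of_le_ofReal (Real.exp_pos _).le hJle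
      _ = 1 := by rw [← Real.exp_add]; simp
  have hbound : ∀ᵐ g ∂gaussVec n, ⨆ w ∈ W, contract A w.1 w.2 ⬝ᵥ g
      ≤ |y₀ ⬝ᵥ g| + q⁻¹ * (c + 4 * p + 2 * (Real.exp (-c) * (J g).toReal)) := by
    filter_upwards [hJlt] with g hg
    have hJ0 : (0 : ℝ) ≤ (J g).toReal := ENNReal.toReal_nonneg
    refine biSup_le_of_le (fun w hw => ?_) (by positivity)
    have h := mul_dotProduct_sub_le A hT hp0 (hW hw).1 (hW hw).2 (z := y₀) (q := q) hK hL
      (by linarith [integral_betaA_le A hT]) (by linarith [ha w hw]) (hb w hw)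
      (dA_eq A w z ▸ hd w hw) c hg.ne
    rw [← le_inv_mul_iff₀ hq0, sub_dotProduct] at h
    linarith [le_abs_self (y₀ ⬝ᵥ g)]
  have hi1 := (integrable_dotProduct_gaussVec y₀).abs
  have hi2 : Integrable (fun g => c + 4 * p + 2 * (Real.exp (-c) * (J g).toReal)) (gaussVec n) :=
    (integrable_const _).add ((hJi.const_mul _).const_mul _)
  have hint : ∫ g, (|y₀ ⬝ᵥ g| + q⁻¹ * (c + 4 * p + 2 * (Real.exp (-c) * (J g).toReal))) ∂gaussVec n
      ≤ 2 * b + q⁻¹ * (c + 4 * p + 2) := by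
    rw [integral_add hi1 (hi2.const_mul _), integral_const_mul,
      integral_add (integrable_const _) ((hJi.const_mul _).const_mul _), integral_const_mul,
      integral_const_mul]
    have h1 := integral_abs_contract_le A hT z.1 (hW hz).2
    have h2 := hb z hz
    simp only [integral_const, probReal_univ, one_smul]
    gcongr ?_ + q⁻¹ * (_ + ?_)
    · linarith
    · linarith
  have hFA : FA A W ≤ 2 * b + q⁻¹ * (c + 4 * p + 2) := by
    simp only [FA, sum_eq_contract_dotProduct]
    by_cases hi : Integrable (fun g => ⨆ w ∈ W, contract A w.1 w.2 ⬝ᵥ g) (gaussVec n)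
    · exact (integral_mono_ae hi (hi1.add (hi2.const_mul _)) hbound).trans hint
    · rw [integral_undef hi]
      positivity
  have h2 : √2 ≤ 2 := Real.sqrt_le_iff.2 (by norm_num)
  have hps : √p * √p = p := Real.mul_self_sqrt hp0.le
  have hqinv : q⁻¹ * √p = R := by rw [hq]; field_simp
  have hqinv1 : q⁻¹ ≤ √p * R := by
    rw [hq, inv_div]
    exact (div_le_self hR0.le hs1).trans (le_mul_of_one_le_left hR0.le hs1)
  have h4 : q⁻¹ * c ≤ 3 * (2 * M + √p * R) := by
    have e : q⁻¹ * c = (√2 + 1) * (2 * M + √p * R) := by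
      rw [hc, hqR, ← hqinv]
      field_simp
    rw [e]
    gcongr
    linarith
  have h5 : q⁻¹ * p = √p * R := by rw [← hqinv]; linear_combination (-q⁻¹) * hps
  have h6 : √p * R = √p * d + 4 * a + ε := by
    rw [hR, mul_add, ← mul_assoc, hσs]
    simp only [L]
    ring
  have h7 : M ≤ b + 4 * (σ * sA A T) + ε := by
    have : σ * ε ≤ ε := mul_le_of_le_one_left hε.le hσ1
    simp only [hM, K]
    linarith
  linarith

/-- bound on the expected supremum of the Gaussian process. -/
theorem statement_9 :
    ∃ C : ℝ, 0 < C ∧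
      ∀ (n m : ℕ) (A : Fin n → Fin n → Fin m → ℝ) (p : ℝ), 1 ≤ p →
      ∀ T : Set (Fin m → ℝ), T.Finite → T.Nonempty →
      ∀ W : Set ((Fin n → ℝ) × (Fin m → ℝ)), W ⊆ (UB n p) ×ˢ (T - T) →
        FA A W ≤ C * ((Real.sqrt p)⁻¹ * sA A T + (⨆ z ∈ W, betaA A T z.1)
          + (⨆ z ∈ W, expAlpha A z.2) + Real.sqrt p * diamA A W) := by
  refine ⟨36, by norm_num, fun n m A p hp T hT _ W hW => ?_⟩
  have hs0 : 0 ≤ (√p)⁻¹ * sA A T :=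
    mul_nonneg (inv_nonneg.2 (Real.sqrt_nonneg p)) (sA_nonneg A T)
  have hb0 : 0 ≤ ⨆ z ∈ W, betaA A T z.1 := biSup_nonneg fun z => betaA_nonneg A T z.1
  have ha0 : 0 ≤ ⨆ z ∈ W, expAlpha A z.2 :=
    biSup_nonneg fun z => integral_nonneg fun _ => Real.sqrt_nonneg _
  have hd0 : 0 ≤ √p * diamA A W := mul_nonneg (Real.sqrt_nonneg p)
    (biSup_nonneg fun z => biSup_nonneg fun w => Real.sqrt_nonneg _)
  rcases W.eq_empty_or_nonempty with rfl | ⟨z, hz⟩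
  · have : FA A ∅ = 0 := by simp [FA]
    rw [this]
    positivity
  refine le_of_forall_pos_le_add fun ε hε => ?_
  have hb : ∀ w ∈ W, betaA A T w.1 ≤ ⨆ w ∈ W, betaA A T w.1 := fun w hw => by
    obtain ⟨K, hK⟩ := exists_betaA_le A hT (1 + √p)
    exact le_biSup_of_le (f := fun w : (Fin n → ℝ) × (Fin m → ℝ) => betaA A T w.1)
      (fun w hw => hK _ (abs_le_of_mem_UB (hW hw).1)) hw
  have ha : ∀ w ∈ W, expAlpha A w.2 ≤ ⨆ w ∈ W, expAlpha A w.2 := fun w hw => by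
    obtain ⟨K, hK⟩ := ((hT.sub hT).image (expAlpha A)).bddAbove
    exact le_biSup_of_le (f := fun w : (Fin n → ℝ) × (Fin m → ℝ) => expAlpha A w.2)
      (fun w hw => hK (mem_image_of_mem _ (hW hw).2)) hw
  have hd : ∀ w ∈ W, dA A w z ≤ diamA A W := fun w hw => by
    obtain ⟨K, hK⟩ := exists_dA_le A hT hW
    refine (le_biSup_of_le (hK w hw) hz).trans (le_biSup_of_le (K := K)
      (f := fun z => ⨆ w ∈ W, dA A z w) (fun z hz => ?_) hw)
    exact biSup_le_of_le (hK z hz) ((Real.sqrt_nonneg _).trans (hK z hz z hz))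
  linarith [FA_le_of_forall_mem A hp hT hW hz hb ha hd (ε := ε / 15) (by positivity)]

end Stmt9
end
end

section
/- Let 1 ≤ q < ∞. There is a constant C(q) depending only on q such that for every real array A = (a_{ijk})_{i,j≤n,k≤m} with ∑ⱼ a_{ijk}² > 0 for all i,k: E φ_A(Eₙ) ≤ C(q) · (∑_k (∑_{ij} a_{ijk}²)^{q/2})^{1/(2q)}, where Eₙ = (ℰ₁,…,ℰₙ) is a vector of i.i.d. symmetric exponential variables (density e^{−|x|}/2). -/
open MeasureTheory ProbabilityTheory Set
open scoped ENNReal BigOperators Pointwise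

noncomputable section

namespace Stmt11

/-- the symmetric exponential distribution on `ℝ`, with density `e^{-|x|}/2`. -/
def symExp : Measure ℝ :=
  MeasureTheory.volume.withDensity fun x => ENNReal.ofReal (Real.exp (-|x|) / 2)

/-- the law of `Eₙ`, a vector of `n` i.i.d. symmetric exponential variables. -/
def expVec (n : ℕ) : Measure (Fin n → ℝ) := Measure.pi fun _ => symExp

/-- the law of a standard Gaussian vector in `ℝⁿ`. -/
def gaussVec (n : ℕ) : Measure (Fin n → ℝ) := Measure.pi fun _ => gaussianReal 0 1

/-- the law of an `n × n` array of i.i.d. standard Gaussian variables. -/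
def gaussMat (n : ℕ) : Measure (Fin n × Fin n → ℝ) := Measure.pi fun _ => gaussianReal 0 1

variable {n m : ℕ}

/-- `α_A(y) = √(∑ᵢ (∑_{jk} a_{ijk} y_{jk})²)` for `y ∈ ℝ^{n×m}`. -/
def alphaA (A : Fin n → Fin n → Fin m → ℝ) (y : Fin n → Fin m → ℝ) : ℝ :=
  Real.sqrt (∑ i, (∑ j, ∑ k, A i j k * y j k) ^ 2)

/-- `α_{∞,A}(y) = maxᵢ |∑_{jk} a_{ijk} y_{jk}|`. -/
def alphaInf (A : Fin n → Fin n → Fin m → ℝ) (y : Fin n → Fin m → ℝ) : ℝ :=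
  ⨆ i, |∑ j, ∑ k, A i j k * y j k|

/-- `x ⊗ t = (x_j t_k)_{jk}`. -/
def tens (x : Fin n → ℝ) (t : Fin m → ℝ) : Fin n → Fin m → ℝ := fun j k => x j * t k

/-- the distance `d_A((x,t),(x',t')) = α_A(x⊗t − x'⊗t')`. -/
def dA (A : Fin n → Fin n → Fin m → ℝ) (z w : (Fin n → ℝ) × (Fin m → ℝ)) : ℝ :=
  alphaA A (tens z.1 z.2 - tens w.1 w.2)

/-- the distance `d_{∞,A}((x,t),(x',t')) = α_{∞,A}(x⊗t − x'⊗t')`. -/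
def dInf (A : Fin n → Fin n → Fin m → ℝ) (z w : (Fin n → ℝ) × (Fin m → ℝ)) : ℝ :=
  alphaInf A (tens z.1 z.2 - tens w.1 w.2)

/-- the diameter of `V` in the metric `d_A`. -/
def diamA (A : Fin n → Fin n → Fin m → ℝ) (V : Set ((Fin n → ℝ) × (Fin m → ℝ))) : ℝ :=
  ⨆ z ∈ V, ⨆ w ∈ V, dA A z w

/-- the diameter of `V` in the metric `d_{∞,A}`. -/
def diamInf (A : Fin n → Fin n → Fin m → ℝ) (V : Set ((Fin n → ℝ) × (Fin m → ℝ))) : ℝ :=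
  ⨆ z ∈ V, ⨆ w ∈ V, dInf A z w

/-- `F_A(V) = E sup_{(x,t)∈V} ∑_{ijk} a_{ijk} gᵢ x_j t_k`. -/
def FA (A : Fin n → Fin n → Fin m → ℝ) (V : Set ((Fin n → ℝ) × (Fin m → ℝ))) : ℝ :=
  ∫ g, (⨆ z ∈ V, ∑ i, ∑ j, ∑ k, A i j k * g i * z.1 j * z.2 k) ∂gaussVec n

/-- `β_{A,T}(x) = E sup_{s∈T} |∑_{ijk} a_{ijk} gᵢ x_j s_k|`. -/
def betaA (A : Fin n → Fin n → Fin m → ℝ) (T : Set (Fin m → ℝ)) (x : Fin n → ℝ) : ℝ :=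
  ∫ g, (⨆ s ∈ T, |∑ i, ∑ j, ∑ k, A i j k * g i * x j * s k|) ∂gaussVec n

/-- `s_A(T) = E sup_{t∈T} |∑_{ijk} a_{ijk} g_{ij} t_k| + E sup_{t∈T} |∑_{ijk} a_{ijk} gᵢ ℰⱼ t_k|`. -/
def sA (A : Fin n → Fin n → Fin m → ℝ) (T : Set (Fin m → ℝ)) : ℝ :=
  (∫ G, (⨆ t ∈ T, |∑ i, ∑ j, ∑ k, A i j k * G (i, j) * t k|) ∂gaussMat n) +
  (∫ w, (⨆ t ∈ T, |∑ i, ∑ j, ∑ k, A i j k * w.1 i * w.2 j * t k|)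
      ∂((gaussVec n).prod (expVec n)))

/-- `E α_A(Eₙ ⊗ t)`. -/
def expAlpha (A : Fin n → Fin n → Fin m → ℝ) (t : Fin m → ℝ) : ℝ :=
  ∫ e, alphaA A (tens e t) ∂expVec n

/-- the closed Euclidean unit ball `B₂ⁿ`. -/
def B2 (n : ℕ) : Set (Fin n → ℝ) := {x | Real.sqrt (∑ i, x i ^ 2) ≤ 1}

/-- the closed `ℓ₁` unit ball `B₁ⁿ`. -/
def B1 (n : ℕ) : Set (Fin n → ℝ) := {x | ∑ i, |x i| ≤ 1}

/-- the Minkowski sum `B₂ⁿ + √p·B₁ⁿ`. -/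
def UB (n : ℕ) (p : ℝ) : Set (Fin n → ℝ) := B2 n + Real.sqrt p • B1 n

/-- `s_q(A) = (∑_k (∑_{ij} a_{ijk}²)^{q/2})^{1/q}`. -/
def sq (q : ℝ) (A : Fin n → Fin n → Fin m → ℝ) : ℝ :=
  (∑ k, (∑ i, ∑ j, A i j k ^ 2) ^ (q / 2)) ^ (1 / q)

/-- `φ_A(x) = (∑_k (∑ᵢ (∑ⱼ a_{ijk} x_j)⁴ / ∑ⱼ a_{ijk}²)^{q/2})^{1/(2q)}`. -/
def phiA (q : ℝ) (A : Fin n → Fin n → Fin m → ℝ) (x : Fin n → ℝ) : ℝ :=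
  (∑ k, (∑ i, (∑ j, A i j k * x j) ^ 4 / ∑ j, A i j k ^ 2) ^ (q / 2)) ^ (1 / (2 * q))

/-- `B_{q'} = {t ∈ ℝᵐ : ∑_k |t_k|^{q'} ≤ 1}`. -/
def Bconj (q' : ℝ) (m : ℕ) : Set (Fin m → ℝ) := {t | ∑ k, |t k| ^ q' ≤ 1}

lemma symExp_density_measurable :
    Measurable fun x : ℝ => ENNReal.ofReal (Real.exp (-|x|) / 2) := by fun_prop

lemma exp_mul_density_eq_of_nonpos (t : ℝ) {x : ℝ} (hx : x ≤ 0) :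
    Real.exp (t * x) * (Real.exp (-|x|) / 2) = Real.exp ((1 + t) * x) / 2 := by
  rw [abs_of_nonpos hx, ← mul_div_assoc, ← Real.exp_add]
  ring_nf

lemma exp_mul_density_eq_of_nonneg (t : ℝ) {x : ℝ} (hx : 0 ≤ x) :
    Real.exp (t * x) * (Real.exp (-|x|) / 2) = Real.exp ((t - 1) * x) / 2 := by
  rw [abs_of_nonneg hx, ← mul_div_assoc, ← Real.exp_add]
  ring_nf

lemma integrableOn_Iic_exp_mul_density {t : ℝ} (ht : |t| < 1) :
    IntegrableOn (fun x => Real.exp (t * x) * (Real.exp (-|x|) / 2)) (Iic 0) := by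
  refine IntegrableOn.congr_fun ?_
    (fun x hx => (exp_mul_density_eq_of_nonpos t hx).symm) measurableSet_Iic
  exact (integrableOn_exp_mul_Iic (by linarith [(abs_lt.1 ht).1]) 0).div_const 2

lemma integrableOn_Ioi_exp_mul_density {t : ℝ} (ht : |t| < 1) :
    IntegrableOn (fun x => Real.exp (t * x) * (Real.exp (-|x|) / 2)) (Ioi 0) := by
  refine IntegrableOn.congr_fun ?_
    (fun x hx => (exp_mul_density_eq_of_nonneg t (le_of_lt hx)).symm) measurableSet_Ioi
  exact (integrableOn_exp_mul_Ioi (by linarith [(abs_lt.1 ht).2]) 0).div_const 2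

lemma integrable_exp_mul_density {t : ℝ} (ht : |t| < 1) :
    Integrable fun x => Real.exp (t * x) * (Real.exp (-|x|) / 2) := by
  rw [← integrableOn_univ, ← Iic_union_Ioi (a := (0 : ℝ))]
  exact (integrableOn_Iic_exp_mul_density ht).union (integrableOn_Ioi_exp_mul_density ht)

lemma integral_exp_mul_density {t : ℝ} (ht : |t| < 1) :
    ∫ x, Real.exp (t * x) * (Real.exp (-|x|) / 2) = 1 / (1 - t ^ 2) := by
  have h1 : 0 < 1 + t := by linarith [(abs_lt.1 ht).1]
  have h2 : t - 1 < 0 := by linarith [(abs_lt.1 ht).2]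
  rw [← intervalIntegral.integral_Iic_add_Ioi (integrableOn_Iic_exp_mul_density ht)
      (integrableOn_Ioi_exp_mul_density ht),
    setIntegral_congr_fun measurableSet_Iic fun x hx => exp_mul_density_eq_of_nonpos t hx,
    setIntegral_congr_fun measurableSet_Ioi
      fun x hx => exp_mul_density_eq_of_nonneg t (le_of_lt hx),
    integral_div, integral_div, integral_exp_mul_Iic h1, integral_exp_mul_Ioi h2]
  have h3 : 1 - t ^ 2 ≠ 0 := by nlinarith
  have h4 : 1 - t ≠ 0 := by linarith
  rw [show t - 1 = -(1 - t) by ring]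
  simp only [mul_zero, Real.exp_zero, neg_div_neg_eq]
  field_simp
  ring

instance : IsProbabilityMeasure symExp := by
  constructor
  have h := integrable_exp_mul_density (t := 0) (by simp)
  have h' := integral_exp_mul_density (t := 0) (by simp)
  simp only [zero_mul, Real.exp_zero, one_mul] at h h'
  rw [symExp, withDensity_apply _ MeasurableSet.univ, Measure.restrict_univ,
    ← ofReal_integral_eq_lintegral_ofReal h (ae_of_all _ fun x => by positivity), h']
  simp

lemma integrable_exp_mul_symExp {t : ℝ} (ht : |t| < 1) :
    Integrable (fun x => Real.exp (t * x)) symExp := by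
  rw [symExp, integrable_withDensity_iff symExp_density_measurable
    (ae_of_all _ fun _ => ENNReal.ofReal_lt_top)]
  refine (integrable_exp_mul_density ht).congr (ae_of_all _ fun x => ?_)
  simp only
  rw [ENNReal.toReal_ofReal (by positivity)]

lemma integral_exp_mul_symExp {t : ℝ} (ht : |t| < 1) :
    ∫ x, Real.exp (t * x) ∂symExp = 1 / (1 - t ^ 2) := by
  rw [symExp, integral_withDensity_eq_integral_toReal_smul symExp_density_measurable
    (ae_of_all _ fun _ => ENNReal.ofReal_lt_top), ← integral_exp_mul_density ht]
  refine integral_congr_ae (ae_of_all _ fun x => ?_)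
  simp only
  rw [ENNReal.toReal_ofReal (by positivity), smul_eq_mul, mul_comm]

lemma integral_exp_mul_symExp_le {t : ℝ} (ht : |t| ≤ 1 / 2) :
    ∫ x, Real.exp (t * x) ∂symExp ≤ Real.exp (2 * t ^ 2) := by
  rw [integral_exp_mul_symExp (by linarith)]
  have h : t ^ 2 ≤ 1 / 4 := by
    rw [← sq_abs]; nlinarith [abs_nonneg t]
  have h' := Real.add_one_le_exp (2 * t ^ 2)
  rw [div_le_iff₀ (by linarith)]
  nlinarith [sq_nonneg t]

lemma abs_div_two_le {b : Fin n → ℝ} (hb : ∑ j, b j ^ 2 ≤ 1) (j : Fin n) :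
    |b j / 2| ≤ 1 / 2 := by
  have h : b j ^ 2 ≤ 1 :=
    (Finset.single_le_sum (f := fun j => b j ^ 2) (fun i _ => sq_nonneg _)
      (Finset.mem_univ j)).trans hb
  rw [abs_div, abs_two]
  linarith [(sq_le_one_iff_abs_le_one (b j)).1 h]

lemma exp_half_sum_eq_prod (b e : Fin n → ℝ) :
    Real.exp ((∑ j, b j * e j) / 2) = ∏ j, Real.exp (b j / 2 * e j) := by
  rw [← Real.exp_sum, Finset.sum_div]
  congr 1
  exact Finset.sum_congr rfl fun j _ => by ring

lemma integrable_exp_half_sum_expVec {b : Fin n → ℝ} (hb : ∑ j, b j ^ 2 ≤ 1) :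
    Integrable (fun e => Real.exp ((∑ j, b j * e j) / 2)) (expVec n) := by
  simp_rw [exp_half_sum_eq_prod]
  exact Integrable.fintype_prod (f := fun j x => Real.exp (b j / 2 * x)) fun j =>
    integrable_exp_mul_symExp (by linarith [abs_div_two_le hb j])

lemma integral_exp_half_sum_expVec_le {b : Fin n → ℝ} (hb : ∑ j, b j ^ 2 ≤ 1) :
    ∫ e, Real.exp ((∑ j, b j * e j) / 2) ∂expVec n ≤ Real.exp 1 := by
  simp_rw [exp_half_sum_eq_prod]
  rw [expVec, integral_fintype_prod_eq_prod (fun j x => Real.exp (b j / 2 * x))]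
  calc ∏ j, ∫ x, Real.exp (b j / 2 * x) ∂symExp
      ≤ ∏ j, Real.exp (2 * (b j / 2) ^ 2) :=
        Finset.prod_le_prod (fun j _ => integral_nonneg fun _ => (Real.exp_pos _).le)
          fun j _ => integral_exp_mul_symExp_le (abs_div_two_le hb j)
    _ = Real.exp ((∑ j, b j ^ 2) / 2) := by
        rw [← Real.exp_sum, Finset.sum_div]
        congr 1
        exact Finset.sum_congr rfl fun j _ => by ring
    _ ≤ Real.exp 1 := Real.exp_le_exp.2 (by linarith)

/-- The function `y ↦ e^{y/2} + e^{-y/2}`, which dominates every even power up to a constant. -/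
def expSum (y : ℝ) : ℝ := Real.exp (y / 2) + Real.exp (-y / 2)

lemma exp_half_abs_le_expSum (y : ℝ) : Real.exp (|y| / 2) ≤ expSum y := by
  unfold expSum
  rcases abs_cases y with ⟨h, _⟩ | ⟨h, _⟩ <;> rw [h]
  · linarith [Real.exp_pos (-y / 2)]
  · linarith [Real.exp_pos (y / 2)]

lemma one_le_expSum (y : ℝ) : 1 ≤ expSum y :=
  (Real.one_le_exp (by positivity)).trans (exp_half_abs_le_expSum y)

lemma pow_le_mul_expSum (s : ℕ) (y : ℝ) : |y| ^ s ≤ s.factorial * 2 ^ s * expSum y := by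
  have h := Real.pow_div_factorial_le_exp (|y| / 2) (by positivity) s
  rw [div_le_iff₀ (by positivity), div_pow, div_le_iff₀ (by positivity)] at h
  calc |y| ^ s ≤ Real.exp (|y| / 2) * s.factorial * 2 ^ s := h
    _ = s.factorial * 2 ^ s * Real.exp (|y| / 2) := by ring
    _ ≤ _ := by gcongr; exact exp_half_abs_le_expSum y

lemma integrable_expSum_expVec {b : Fin n → ℝ} (hb : ∑ j, b j ^ 2 ≤ 1) :
    Integrable (fun e => expSum (∑ j, b j * e j)) (expVec n) := by
  have h := integrable_exp_half_sum_expVec (b := fun j => -b j) (by simpa using hb)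
  simp only [neg_mul, Finset.sum_neg_distrib] at h
  exact (integrable_exp_half_sum_expVec hb).add h

lemma integral_expSum_expVec_le {b : Fin n → ℝ} (hb : ∑ j, b j ^ 2 ≤ 1) :
    ∫ e, expSum (∑ j, b j * e j) ∂expVec n ≤ 2 * Real.exp 1 := by
  have hb' : ∑ j, (-b j) ^ 2 ≤ 1 := by simpa using hb
  have h := integrable_exp_half_sum_expVec hb'
  have h' := integral_exp_half_sum_expVec_le hb'
  simp only [neg_mul, Finset.sum_neg_distrib] at h h'
  unfold expSum
  rw [integral_add (integrable_exp_half_sum_expVec hb) h]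
  linarith [integral_exp_half_sum_expVec_le hb]

lemma rpow_le_one_add_pow {x s : ℝ} {r : ℕ} (hx : 0 ≤ x) (hs : 0 ≤ s) (hsr : s ≤ r) :
    x ^ s ≤ 1 + x ^ r := by
  rcases le_total x 1 with h | h
  · linarith [Real.rpow_le_one hx h hs, pow_nonneg hx r]
  · have := Real.rpow_le_rpow_of_exponent_le h hsr
    rw [Real.rpow_natCast] at this
    linarith

/-- A constant such that `1 + y ^ (4 * r) ≤ momentConst r * expSum y`. -/
def momentConst (r : ℕ) : ℝ := 1 + (4 * r).factorial * 2 ^ (4 * r)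

lemma momentConst_pos (r : ℕ) : 0 < momentConst r := by
  unfold momentConst; positivity

lemma one_add_pow_le_expSum (r : ℕ) (y : ℝ) :
    1 + (y ^ 4) ^ r ≤ momentConst r * expSum y := by
  have h := pow_le_mul_expSum (4 * r) y
  rw [pow_mul, Even.pow_abs (by decide)] at h
  rw [momentConst, add_mul]
  linarith [one_le_expSum y]

lemma rpow_weighted_sum_le {ι : Type*} (s : Finset ι) {w Y : ι → ℝ} (hw : ∀ i ∈ s, 0 ≤ w i)
    (hw1 : ∑ i ∈ s, w i = 1) {p : ℝ} (hp : 0 ≤ p) {r : ℕ} (hr : p ≤ r) :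
    (∑ i ∈ s, w i * Y i ^ 4) ^ p ≤ momentConst r * ∑ i ∈ s, w i * expSum (Y i) := by
  have hX : 0 ≤ ∑ i ∈ s, w i * Y i ^ 4 :=
    Finset.sum_nonneg fun i hi => mul_nonneg (hw i hi) (by positivity)
  calc (∑ i ∈ s, w i * Y i ^ 4) ^ p ≤ 1 + (∑ i ∈ s, w i * Y i ^ 4) ^ r :=
        rpow_le_one_add_pow hX hp hr
    _ ≤ 1 + ∑ i ∈ s, w i * (Y i ^ 4) ^ r := by
        gcongr
        exact Real.pow_arith_mean_le_arith_mean_pow s w _ hw hw1 (fun i _ => by positivity) r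
    _ = ∑ i ∈ s, w i * (1 + (Y i ^ 4) ^ r) := by
        simp_rw [mul_add, Finset.sum_add_distrib, mul_one, hw1]
    _ ≤ ∑ i ∈ s, w i * (momentConst r * expSum (Y i)) :=
        Finset.sum_le_sum fun i hi =>
          mul_le_mul_of_nonneg_left (one_add_pow_le_expSum r (Y i)) (hw i hi)
    _ = _ := by
        rw [Finset.mul_sum]
        exact Finset.sum_congr rfl fun i _ => by ring

lemma rpow_sum_pow_four_div_le {ι : Type*} {s : Finset ι} (hs : s.Nonempty) {v S : ι → ℝ}
    (hv : ∀ i ∈ s, 0 < v i) {p : ℝ} (hp : 0 ≤ p) {r : ℕ} (hr : p ≤ r) :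
    (∑ i ∈ s, S i ^ 4 / v i) ^ p ≤
      (∑ i ∈ s, v i) ^ p *
        (momentConst r * ∑ i ∈ s, v i / (∑ l ∈ s, v l) * expSum (S i / √(v i))) := by
  have hW : 0 < ∑ i ∈ s, v i := Finset.sum_pos hv hs
  have key : ∑ i ∈ s, S i ^ 4 / v i =
      (∑ i ∈ s, v i) * ∑ i ∈ s, v i / (∑ l ∈ s, v l) * (S i / √(v i)) ^ 4 := by
    rw [Finset.mul_sum]
    refine Finset.sum_congr rfl fun i hi => ?_
    have h4 : √(v i) ^ 4 = v i ^ 2 := by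
      rw [show (4 : ℕ) = 2 * 2 by norm_num, pow_mul, Real.sq_sqrt (hv i hi).le]
    have := (hv i hi).ne'
    rw [div_pow, h4]
    field_simp
  have hw : ∀ i ∈ s, 0 ≤ v i / ∑ l ∈ s, v l := fun i hi => (div_pos (hv i hi) hW).le
  have hw1 : ∑ i ∈ s, v i / ∑ l ∈ s, v l = 1 := by
    rw [← Finset.sum_div, div_self hW.ne']
  rw [key, Real.mul_rpow hW.le (Finset.sum_nonneg fun i hi =>
    mul_nonneg (hw i hi) (by positivity))]
  exact mul_le_mul_of_nonneg_left (rpow_weighted_sum_le s hw hw1 hp hr)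
    (Real.rpow_nonneg hW.le p)

/-- The rows `a_{i·k}` of the array, normalised in `ℓ₂`. -/
def unitRow (A : Fin n → Fin n → Fin m → ℝ) (i : Fin n) (k : Fin m) (j : Fin n) : ℝ :=
  A i j k / √(∑ l, A i l k ^ 2)

lemma sum_unitRow_sq_le (A : Fin n → Fin n → Fin m → ℝ) (i : Fin n) (k : Fin m) :
    ∑ j, unitRow A i k j ^ 2 ≤ 1 := by
  simp_rw [unitRow, div_pow, Real.sq_sqrt (Finset.sum_nonneg fun l _ => sq_nonneg (A i l k))]
  rw [← Finset.sum_div]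
  exact div_self_le_one _

/-- The exponential majorant of the `k`-th summand of `φ_A`, relative to its size. -/
def majorant (A : Fin n → Fin n → Fin m → ℝ) (k : Fin m) (e : Fin n → ℝ) : ℝ :=
  ∑ i, (∑ j, A i j k ^ 2) / (∑ l, ∑ j, A l j k ^ 2) * expSum (∑ j, unitRow A i k j * e j)

lemma integrable_majorant (A : Fin n → Fin n → Fin m → ℝ) (k : Fin m) :
    Integrable (majorant A k) (expVec n) :=
  integrable_finsetSum _ fun i _ =>
    (integrable_expSum_expVec (sum_unitRow_sq_le A i k)).const_mul _

lemma integral_majorant_le (A : Fin n → Fin n → Fin m → ℝ) (k : Fin m) :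
    ∫ e, majorant A k e ∂expVec n ≤ 2 * Real.exp 1 := by
  unfold majorant
  rw [integral_finsetSum _ fun i _ =>
    (integrable_expSum_expVec (sum_unitRow_sq_le A i k)).const_mul _]
  simp_rw [integral_const_mul]
  calc _ ≤ ∑ i, (∑ j, A i j k ^ 2) / (∑ l, ∑ j, A l j k ^ 2) * (2 * Real.exp 1) :=
        Finset.sum_le_sum fun i _ => mul_le_mul_of_nonneg_left
          (integral_expSum_expVec_le (sum_unitRow_sq_le A i k)) (by positivity)
    _ ≤ 1 * (2 * Real.exp 1) := by
        rw [← Finset.sum_mul, ← Finset.sum_div]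
        gcongr
        exact div_self_le_one _
    _ = _ := one_mul _

lemma phiA_summand_le [Nonempty (Fin n)] {A : Fin n → Fin n → Fin m → ℝ} {k : Fin m}
    (hA : ∀ i, 0 < ∑ j, A i j k ^ 2) {p : ℝ} (hp : 0 ≤ p) {r : ℕ} (hr : p ≤ r)
    (e : Fin n → ℝ) :
    (∑ i, (∑ j, A i j k * e j) ^ 4 / ∑ j, A i j k ^ 2) ^ p ≤
      (∑ i, ∑ j, A i j k ^ 2) ^ p * (momentConst r * majorant A k e) := by
  have h := rpow_sum_pow_four_div_le (s := Finset.univ) Finset.univ_nonempty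
    (v := fun i => ∑ j, A i j k ^ 2) (S := fun i => ∑ j, A i j k * e j)
    (fun i _ => hA i) hp hr
  refine h.trans_eq ?_
  simp only [majorant, unitRow, Finset.sum_div, div_mul_eq_mul_div]

lemma rpow_le_rpow_mul_one_add_div {x R s : ℝ} (hx : 0 ≤ x) (hR : 0 < R) (hs : 0 ≤ s)
    (hs1 : s ≤ 1) : x ^ s ≤ R ^ s * (1 + x / R) := by
  have h := rpow_le_one_add_pow (r := 1) (div_nonneg hx hR.le) hs (by simpa using hs1)
  rw [pow_one, Real.div_rpow hx hR.le, div_le_iff₀ (Real.rpow_pos_of_pos hR s)] at h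
  linarith

/-- `E φ_A(Eₙ) ≤ C(q)·(∑_k (∑_{ij} a_{ijk}²)^{q/2})^{1/(2q)}`. -/
theorem statement_11 :
    ∀ q : ℝ, 1 ≤ q →
    ∃ C : ℝ, 0 < C ∧
      ∀ (n m : ℕ) (A : Fin n → Fin n → Fin m → ℝ),
        (∀ i k, 0 < ∑ j, A i j k ^ 2) →
        (∫ e, phiA q A e ∂expVec n)
          ≤ C * (∑ k, (∑ i, ∑ j, A i j k ^ 2) ^ (q / 2)) ^ (1 / (2 * q)) := by
  intro q hq
  obtain ⟨r, hr⟩ := exists_nat_ge (q / 2)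
  have hc := momentConst_pos r
  have hp : 0 ≤ q / 2 := by linarith
  have hs : 0 ≤ 1 / (2 * q) := by positivity
  have hs0 : 1 / (2 * q) ≠ 0 := by positivity
  have hs1 : 1 / (2 * q) ≤ 1 := by rw [div_le_one (by linarith)]; linarith
  refine ⟨1 + momentConst r * (2 * Real.exp 1), by positivity, fun n m A hA => ?_⟩
  rcases isEmpty_or_nonempty (Fin n) with hn | hn
  · have hq2 : q / 2 ≠ 0 := by linarith
    simp [phiA, Real.zero_rpow hq2, Real.zero_rpow hs0, -one_div, -mul_inv_rev]
  rcases isEmpty_or_nonempty (Fin m) with hm | hm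
  · simp [phiA, Real.zero_rpow hs0, -one_div, -mul_inv_rev]
  set c := momentConst r
  set V : Fin m → ℝ := fun k => (∑ i, ∑ j, A i j k ^ 2) ^ (q / 2)
  have hVpos : ∀ k, 0 < V k := fun k =>
    Real.rpow_pos_of_pos (Finset.sum_pos (fun i _ => hA i k) Finset.univ_nonempty) _
  have hR : 0 < ∑ k, V k := Finset.sum_pos (fun k _ => hVpos k) Finset.univ_nonempty
  set R := ∑ k, V k
  set B : (Fin n → ℝ) → ℝ := fun e => ∑ k, V k * (c * majorant A k e)
  have hBint : Integrable B (expVec n) :=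
    integrable_finsetSum _ fun k _ => ((integrable_majorant A k).const_mul _).const_mul _
  have hB : ∫ e, B e ∂expVec n ≤ R * (c * (2 * Real.exp 1)) := by
    rw [integral_finsetSum _ fun k _ =>
      ((integrable_majorant A k).const_mul _).const_mul _, Finset.sum_mul]
    refine Finset.sum_le_sum fun k _ => ?_
    rw [integral_const_mul, integral_const_mul]
    have := integral_majorant_le A k
    have := (hVpos k).le
    gcongr
  have : IsProbabilityMeasure (expVec n) := by unfold expVec; infer_instance
  have hXnonneg : ∀ e : Fin n → ℝ,
      0 ≤ ∑ k, (∑ i, (∑ j, A i j k * e j) ^ 4 / ∑ j, A i j k ^ 2) ^ (q / 2) :=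
    fun e => Finset.sum_nonneg fun k _ => Real.rpow_nonneg
      (Finset.sum_nonneg fun i _ => by positivity) _
  have hpt : ∀ e, phiA q A e ≤ R ^ (1 / (2 * q)) * (1 + B e / R) := by
    intro e
    refine (rpow_le_rpow_mul_one_add_div (hXnonneg e) hR hs hs1).trans ?_
    gcongr
    exact Finset.sum_le_sum fun k _ => phiA_summand_le (fun i => hA i k) hp hr e
  calc ∫ e, phiA q A e ∂expVec n
      ≤ ∫ e, R ^ (1 / (2 * q)) * (1 + B e / R) ∂expVec n :=
        integral_mono_of_nonneg (ae_of_all _ fun e => Real.rpow_nonneg (hXnonneg e) _)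
          (((integrable_const 1).add (hBint.div_const R)).const_mul _) (ae_of_all _ hpt)
    _ = R ^ (1 / (2 * q)) * (1 + (∫ e, B e ∂expVec n) / R) := by
        rw [integral_const_mul, integral_add (integrable_const 1) (hBint.div_const R),
          integral_div]
        simp
    _ ≤ R ^ (1 / (2 * q)) * (1 + c * (2 * Real.exp 1)) := by
        gcongr
        rw [div_le_iff₀ hR]
        linarith
    _ = _ := mul_comm _ _

end Stmt11
end
end
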